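/- arXiv:1410.3007 — 10 statements merged into one kernel-verified Lean document; each statement's English description precedes it below -/
import Mathlib

section
/- Let G be a finite group and K a normal subgroup of G. Then: (i) diam(G/K) ≤ diam(G); (ii) diam(G) ≤ diam(G/K) + diam(K)·(2·diam(G/K) + 1). -/
/-- `diam S` for a subset `S` of a group `G`: the least `N` such that every element
of `G` is a product of at most `N` elements of `S ∪ S⁻¹ ∪ {1}`. -/
noncomputable def diamWith {G : Type*} [Group G] (S : Set G) : ℕ :=
  sInf {N : ℕ | ∀ x : G, ∃ L : List G,
    (∀ y ∈ L, y ∈ S ∪ S⁻¹ ∪ {1}) ∧ L.length ≤ N ∧ L.prod = x}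

/-- The (worst-case) diameter of a group `G`: the maximum of `diamWith S` over all
generating sets `S` of `G`. -/
noncomputable def groupDiam (G : Type*) [Group G] : ℕ :=
  sSup {d : ℕ | ∃ S : Set G, Subgroup.closure S = ⊤ ∧ diamWith S = d}

/-- `x` is a product of at most `n` elements of `S ∪ S⁻¹ ∪ {1}`. -/
def InBall {G : Type*} [Group G] (S : Set G) (n : ℕ) (x : G) : Prop :=
  ∃ L : List G, (∀ y ∈ L, y ∈ S ∪ S⁻¹ ∪ {1}) ∧ L.length ≤ n ∧ L.prod = x

theorem InBall.mono {G : Type*} [Group G] {S : Set G} {m n : ℕ} {x : G}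
    (h : InBall S m x) (hmn : m ≤ n) : InBall S n x := by
  obtain ⟨L, h1, h2, h3⟩ := h
  exact ⟨L, h1, h2.trans hmn, h3⟩

theorem InBall.mul {G : Type*} [Group G] {S : Set G} {m n : ℕ} {x y : G}
    (h : InBall S m x) (h' : InBall S n y) : InBall S (m + n) (x * y) := by
  obtain ⟨L, h1, h2, h3⟩ := h
  obtain ⟨L', h1', h2', h3'⟩ := h'
  refine ⟨L ++ L', ?_, ?_, ?_⟩
  · intro z hz
    rcases List.mem_append.1 hz with hz | hz
    · exact h1 z hz
    · exact h1' z hz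
  · rw [List.length_append]; omega
  · rw [List.prod_append, h3, h3']

theorem InBall.one {G : Type*} [Group G] (S : Set G) (n : ℕ) : InBall S n (1 : G) :=
  ⟨[], by simp, by simp, by simp⟩

theorem InBall.single {G : Type*} [Group G] {S : Set G} {x : G}
    (h : x ∈ S ∪ S⁻¹ ∪ {1}) : InBall S 1 x :=
  ⟨[x], by simpa using h, by simp, by simp⟩

theorem mem_sym_inv {G : Type*} [Group G] {S : Set G} {x : G}
    (h : x ∈ S ∪ S⁻¹ ∪ {1}) : x⁻¹ ∈ S ∪ S⁻¹ ∪ {1} := by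
  rcases h with (h | h) | h
  · exact Or.inl (Or.inr (by simpa using h))
  · exact Or.inl (Or.inl h)
  · exact Or.inr (by simpa using h)

theorem InBall.inv {G : Type*} [Group G] {S : Set G} {n : ℕ} {x : G}
    (h : InBall S n x) : InBall S n x⁻¹ := by
  obtain ⟨L, h1, h2, h3⟩ := h
  refine ⟨(L.map (·⁻¹)).reverse, ?_, by simpa using h2, ?_⟩
  · intro y hy
    rw [List.mem_reverse, List.mem_map] at hy
    obtain ⟨z, hz, rfl⟩ := hy
    exact mem_sym_inv (h1 z hz)
  · rw [← h3, List.prod_inv_reverse]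

/-- Substitution of words along a homomorphism. -/
theorem InBall.map {H G : Type*} [Group H] [Group G] {T : Set H} {S : Set G} {n m : ℕ} {x : H}
    (f : H →* G) (hT : ∀ t ∈ T, InBall S m (f t)) (h : InBall T n x) :
    InBall S (n * m) (f x) := by
  have key : ∀ L : List H, (∀ y ∈ L, y ∈ T ∪ T⁻¹ ∪ {1}) →
      InBall S (L.length * m) (f L.prod) := by
    intro L
    induction L with
    | nil => intro _; simpa using InBall.one S 0
    | cons a L ih =>
      intro hL
      have ha : InBall S m (f a) := by
        rcases hL a (by simp) with (h | h) | h
        · exact hT a h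
        · simpa using (hT a⁻¹ h).inv
        · have : a = 1 := h
          rw [this, map_one]; exact InBall.one S m
      have := ha.mul (ih fun y hy => hL y (by simp [hy]))
      rw [List.prod_cons, map_mul, List.length_cons]
      exact this.mono (by ring_nf; exact le_rfl)
  obtain ⟨L, h1, h2, h3⟩ := h
  rw [← h3]
  exact (key L h1).mono (Nat.mul_le_mul_right m h2)

theorem diamWith_le {G : Type*} [Group G] {S : Set G} {n : ℕ} (h : ∀ x, InBall S n x) :
    diamWith S ≤ n := Nat.sInf_le h

theorem inBall_diamWith {G : Type*} [Group G] [Finite G] {S : Set G}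
    (hS : Subgroup.closure S = ⊤) (x : G) : InBall S (diamWith S) x := by
  have h1 : ∀ x : G, ∃ n, InBall S n x := by
    intro x
    have hx : x ∈ Subgroup.closure S := hS ▸ Subgroup.mem_top x
    induction hx using Subgroup.closure_induction with
    | mem s hs => exact ⟨1, InBall.single (Or.inl (Or.inl hs))⟩
    | one => exact ⟨0, InBall.one S 0⟩
    | mul a b _ _ ha hb =>
      obtain ⟨m, hm⟩ := ha
      obtain ⟨n, hn⟩ := hb
      exact ⟨m + n, hm.mul hn⟩
    | inv a _ ha =>
      obtain ⟨m, hm⟩ := ha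
      exact ⟨m, hm.inv⟩
  choose n hn using h1
  obtain ⟨N, hN⟩ := (Set.finite_range n).bddAbove
  have hne : {N : ℕ | ∀ x : G, InBall S N x}.Nonempty :=
    ⟨N, fun x => (hn x).mono (hN ⟨x, rfl⟩)⟩
  exact Nat.sInf_mem hne x

theorem diamWith_le_groupDiam {G : Type*} [Group G] [Finite G] {S : Set G}
    (hS : Subgroup.closure S = ⊤) : diamWith S ≤ groupDiam G := by
  refine le_csSup ?_ ⟨S, hS, rfl⟩
  refine ((Set.finite_range (fun S : Set G => diamWith S)).subset ?_).bddAbove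
  rintro _ ⟨S, _, rfl⟩
  exact ⟨S, rfl⟩

theorem inBall_groupDiam {G : Type*} [Group G] [Finite G] {S : Set G}
    (hS : Subgroup.closure S = ⊤) (x : G) : InBall S (groupDiam G) x :=
  (inBall_diamWith hS x).mono (diamWith_le_groupDiam hS)

theorem groupDiam_le {G : Type*} [Group G] {n : ℕ}
    (h : ∀ S : Set G, Subgroup.closure S = ⊤ → ∀ x, InBall S n x) : groupDiam G ≤ n := by
  refine csSup_le ⟨_, Set.univ, by simp, rfl⟩ ?_
  rintro _ ⟨S, hS, rfl⟩
  exact diamWith_le (h S hS)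

theorem groupDiam_quotient_le {G : Type*} [Group G] [Finite G] (K : Subgroup G) [K.Normal] :
    groupDiam (G ⧸ K) ≤ groupDiam G := by
  refine groupDiam_le fun S hS x => ?_
  set T : Set G := (QuotientGroup.mk' K) ⁻¹' (S ∪ {1}) with hTdef
  have hT : Subgroup.closure T = ⊤ := by
    have hK : K ≤ Subgroup.closure T := by
      intro k hk
      refine Subgroup.subset_closure (Or.inr ?_)
      simpa using hk
    have hmap : (Subgroup.closure T).map (QuotientGroup.mk' K) = ⊤ := by
      rw [MonoidHom.map_closure, hTdef,
        Set.image_preimage_eq _ (QuotientGroup.mk'_surjective K), eq_top_iff, ← hS]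
      exact Subgroup.closure_mono Set.subset_union_left
    have h2 := congrArg (Subgroup.comap (QuotientGroup.mk' K)) hmap
    rw [Subgroup.comap_map_eq, QuotientGroup.ker_mk', Subgroup.comap_top] at h2
    rwa [sup_eq_left.2 hK] at h2
  obtain ⟨g, rfl⟩ := QuotientGroup.mk'_surjective K x
  have := (inBall_groupDiam hT g).map (S := S) (m := 1) (QuotientGroup.mk' K) (by
    intro t ht
    rcases ht with h | h
    · exact InBall.single (Or.inl (Or.inl h))
    · exact InBall.single (Or.inr h))
  simpa using this

theorem exists_rep {G : Type*} [Group G] [Finite G] (K : Subgroup G) [K.Normal] {S : Set G}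
    (hS : Subgroup.closure S = ⊤) (q : G ⧸ K) :
    ∃ t : G, InBall S (groupDiam (G ⧸ K)) t ∧ QuotientGroup.mk' K t = q := by
  have hT : Subgroup.closure ((QuotientGroup.mk' K) '' S) = ⊤ := by
    rw [← MonoidHom.map_closure, hS]
    exact Subgroup.map_top_of_surjective _ (QuotientGroup.mk'_surjective K)
  obtain ⟨L, h1, h2, h3⟩ := inBall_groupDiam hT q
  have key : ∀ L : List (G ⧸ K),
      (∀ y ∈ L, y ∈ (QuotientGroup.mk' K) '' S ∪ ((QuotientGroup.mk' K) '' S)⁻¹ ∪ {1}) →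
      ∃ t : G, InBall S L.length t ∧ QuotientGroup.mk' K t = L.prod := by
    intro L
    induction L with
    | nil => intro _; exact ⟨1, InBall.one S _, by simp⟩
    | cons a L ih =>
      intro hL
      obtain ⟨t, ht, ht'⟩ := ih fun y hy => hL y (by simp [hy])
      have ha : ∃ s : G, InBall S 1 s ∧ QuotientGroup.mk' K s = a := by
        rcases hL a (by simp) with (⟨s, hs, h⟩ | ⟨s, hs, h⟩) | h
        · exact ⟨s, InBall.single (Or.inl (Or.inl hs)), h⟩
        · exact ⟨s⁻¹, (InBall.single (Or.inl (Or.inl hs))).inv, by rw [map_inv, h, inv_inv]⟩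
        · exact ⟨1, InBall.one S 1, by rw [map_one]; exact h.symm⟩
      obtain ⟨s, hs, hs'⟩ := ha
      refine ⟨s * t, (hs.mul ht).mono (by simp; omega), ?_⟩
      rw [map_mul, hs', ht', List.prod_cons]
  obtain ⟨t, ht, ht'⟩ := key L h1
  exact ⟨t, ht.mono h2, ht'.trans h3⟩

theorem groupDiam_extension {G : Type*} [Group G] [Finite G] (K : Subgroup G) [K.Normal] :
    groupDiam G ≤ groupDiam (G ⧸ K) + groupDiam K * (2 * groupDiam (G ⧸ K) + 1) := by
  refine groupDiam_le fun S hS x => ?_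
  set D := groupDiam (G ⧸ K) with hD
  choose t ht ht' using exists_rep K hS
  let π : G →* G ⧸ K := QuotientGroup.mk' K
  have hker : ∀ g : G, π g = 1 → g ∈ K := fun g hg => (QuotientGroup.eq_one_iff g).1 hg
  let T : Set K := {k | InBall S (2 * D + 1) (k : G)}
  let H : Subgroup G := (Subgroup.closure T).map K.subtype
  have hmem : ∀ g : G, π g = 1 → InBall S (2 * D + 1) g → g ∈ H := fun g hg hb =>
    ⟨⟨g, hker g hg⟩, Subgroup.subset_closure hb, rfl⟩
  have step : ∀ g s : G, InBall S 1 s → g * (t (π g))⁻¹ ∈ H →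
      g * s * (t (π (g * s)))⁻¹ ∈ H := by
    intro g s hs hg
    have h2 : t (π g) * s * (t (π (g * s)))⁻¹ ∈ H := by
      refine hmem _ ?_ ?_
      · have e1 : π (t (π g)) = π g := ht' _
        have e2 : π (t (π (g * s))) = π (g * s) := ht' _
        rw [map_mul, map_mul, map_inv, e1, e2, map_mul, mul_inv_cancel]
      · exact (((ht _).mul hs).mul (ht _).inv).mono (by omega)
    have := H.mul_mem hg h2
    have e : g * (t (π g))⁻¹ * (t (π g) * s * (t (π (g * s)))⁻¹)
        = g * s * (t (π (g * s)))⁻¹ := by group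
    rwa [e] at this
  have t1 : t 1 ∈ H := hmem _ (ht' 1) ((ht 1).mono (by omega))
  have all : ∀ g : G, g * (t (π g))⁻¹ ∈ H := by
    intro g
    have hg : g ∈ Subgroup.closure S := hS ▸ Subgroup.mem_top g
    induction hg using Subgroup.closure_induction_right with
    | one => rw [map_one, one_mul]; exact H.inv_mem t1
    | mul_right g _ s hs ih => exact step g s (InBall.single (Or.inl (Or.inl hs))) ih
    | mul_inv_cancel g _ s hs ih =>
      exact step g s⁻¹ (InBall.single (Or.inl (Or.inl hs))).inv ih
  have hT : Subgroup.closure T = ⊤ := by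
    rw [eq_top_iff]
    rintro ⟨k, hk⟩ -
    have h1 := all k
    have hk1 : π k = 1 := (QuotientGroup.eq_one_iff k).2 hk
    rw [hk1] at h1
    have h2 := H.mul_mem h1 t1
    rw [inv_mul_cancel_right] at h2
    obtain ⟨y, hy, hyk⟩ := h2
    have : y = ⟨k, hk⟩ := Subtype.ext hyk
    exact this ▸ hy
  obtain ⟨y, _, hy⟩ := all x
  have hb : InBall S (groupDiam K * (2 * D + 1)) (K.subtype y) :=
    (inBall_groupDiam hT y).map K.subtype fun k hk => hk
  have h3 := hb.mul (ht (π x))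
  rw [hy, inv_mul_cancel_right] at h3
  exact h3.mono (by rw [add_comm])

/-- **Lemma 3.1 (diameter and extensions).**  Let `G` be a finite group and
`K ⊴ G`.  Then (i) `diam(G/K) ≤ diam(G)` and
(ii) `diam(G) ≤ diam(G/K) + diam(K)·(2·diam(G/K) + 1)`. -/
theorem groupDiam_quotient_le_and_extension_bound
    {G : Type*} [Group G] [Finite G] (K : Subgroup G) [K.Normal] :
    groupDiam (G ⧸ K) ≤ groupDiam G ∧
    groupDiam G ≤ groupDiam (G ⧸ K) + groupDiam K * (2 * groupDiam (G ⧸ K) + 1) := by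
  exact ⟨groupDiam_quotient_le K, groupDiam_extension K⟩
end

section
/- Let R be a unital (not necessarily commutative) ring, I a two-sided ideal of R, and let 1 ≤ n ≤ m be natural numbers. Let g, h be units of R with g − 1 ∈ Iⁿ and h − 1 ∈ Iᵐ. Then g⁻¹h⁻¹gh − 1 − ((g−1)(h−1) − (h−1)(g−1)) ∈ I^{2n+m}; in particular, g⁻¹h⁻¹gh − 1 ∈ I^{n+m}. -/
/-- The `k`-th power of a two-sided ideal `I` of a (possibly noncommutative) unital
ring: the two-sided ideal generated by products of `k` elements of `I`. -/
def TwoSidedIdeal.npow {R : Type*} [Ring R] (I : TwoSidedIdeal R) (k : ℕ) :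
    TwoSidedIdeal R :=
  TwoSidedIdeal.span
    {x : R | ∃ l : List R, l.length = k ∧ (∀ a ∈ l, a ∈ I) ∧ l.prod = x}

theorem npow_aux {R : Type*} [Ring R] (s : Set R) (J : TwoSidedIdeal R) (P : R → Prop)
    (hJ : J = TwoSidedIdeal.span s)
    (h0 : P 0) (hs : ∀ x ∈ s, P x) (ha : ∀ x y, P x → P y → P (x + y))
    (hneg : ∀ x, P x → P (-x)) (hl : ∀ r x, P x → P (r * x)) (hr : ∀ x r, P x → P (x * r))
    (x : R) (hx : x ∈ J) : P x := by
  subst hJ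
  have := TwoSidedIdeal.mem_span_iff.1 hx
    (TwoSidedIdeal.mk' {x | P x} h0 (ha _ _) (hneg _) (hl _ _) (hr _ _))
    (fun y hy => by simpa [TwoSidedIdeal.mem_mk'] using hs y hy)
  simpa [TwoSidedIdeal.mem_mk'] using this

theorem npow_gen {R : Type*} [Ring R] (I : TwoSidedIdeal R) (l : List R)
    (hl : ∀ a ∈ l, a ∈ I) : l.prod ∈ I.npow l.length :=
  TwoSidedIdeal.subset_span ⟨l, rfl, hl, rfl⟩

theorem npow_mul_mem {R : Type*} [Ring R] (I : TwoSidedIdeal R) (i j : ℕ) (x y : R)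
    (hx : x ∈ I.npow i) (hy : y ∈ I.npow j) : x * y ∈ I.npow (i + j) := by
  have key : ∀ r, x * r * y ∈ I.npow (i + j) := by
    refine npow_aux _ (I.npow i) (fun x => ∀ r, x * r * y ∈ I.npow (i + j)) rfl
      ?_ ?_ ?_ ?_ ?_ ?_ x hx
    · intro r; simpa using TwoSidedIdeal.zero_mem _
    · rintro _ ⟨l, hli, hl, rfl⟩
      refine npow_aux _ (I.npow j) (fun y => ∀ r, l.prod * r * y ∈ I.npow (i + j)) rfl
        ?_ ?_ ?_ ?_ ?_ ?_ y hy
      · intro r; simpa using TwoSidedIdeal.zero_mem _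
      · rintro _ ⟨l', hlj, hl', rfl⟩ r
        cases l' with
        | nil =>
          have h1 := npow_gen I l hl
          simp only [List.length_nil] at hlj
          subst hlj hli
          simpa using TwoSidedIdeal.mul_mem_right _ _ r h1
        | cons a t =>
          have h1 := npow_gen I (l ++ (r * a) :: t) (by
            intro b hb
            simp only [List.mem_append, List.mem_cons] at hb
            rcases hb with hb | rfl | hb
            · exact hl b hb
            · exact TwoSidedIdeal.mul_mem_left _ _ _ (hl' a (by simp))
            · exact hl' b (by simp [hb]))
          subst hlj hli
          simpa [mul_assoc] using h1
      · intro a b ha hb r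
        rw [mul_add]; exact TwoSidedIdeal.add_mem _ (ha r) (hb r)
      · intro a ha r
        rw [mul_neg]; exact TwoSidedIdeal.neg_mem _ (ha r)
      · intro s a ha r
        simpa [mul_assoc] using ha (r * s)
      · intro a s ha r
        rw [← mul_assoc]; exact TwoSidedIdeal.mul_mem_right _ _ _ (ha r)
    · intro a b ha hb r
      rw [add_mul, add_mul]; exact TwoSidedIdeal.add_mem _ (ha r) (hb r)
    · intro a ha r
      rw [neg_mul, neg_mul]; exact TwoSidedIdeal.neg_mem _ (ha r)
    · intro s a ha r
      have := TwoSidedIdeal.mul_mem_left _ s _ (ha r)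
      simpa [mul_assoc] using this
    · intro a s ha r
      simpa [mul_assoc] using ha (s * r)
  simpa using key 1

theorem npow_anti {R : Type*} [Ring R] (I : TwoSidedIdeal R) (i j : ℕ) (hij : i ≤ j) (x : R)
    (hx : x ∈ I.npow j) : x ∈ I.npow i := by
  refine TwoSidedIdeal.mem_span_iff.1 hx _ ?_
  rintro _ ⟨l, hlj, hl, rfl⟩
  have h1 := npow_gen I (l.take i) (fun a ha => hl a (List.mem_of_mem_take ha))
  rw [List.length_take, hlj, min_eq_left hij] at h1
  have h2 := TwoSidedIdeal.mul_mem_right _ _ (l.drop i).prod h1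
  rwa [List.prod_take_mul_prod_drop] at h2

/-- **Example 2.7(ii) (commutators of congruence units).**  Let `R` be a unital
ring, `I` a two-sided ideal, `1 ≤ n ≤ m`, and let `g, h` be units of `R` with
`g − 1 ∈ Iⁿ` and `h − 1 ∈ Iᵐ`.  Then
`g⁻¹h⁻¹gh − 1 − ((g−1)(h−1) − (h−1)(g−1)) ∈ I^(2n+m)`; in particular
`g⁻¹h⁻¹gh − 1 ∈ I^(n+m)`. -/
theorem unit_commutator_congruence
    {R : Type*} [Ring R] (I : TwoSidedIdeal R) (n m : ℕ) (hn : 1 ≤ n) (hnm : n ≤ m)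
    (g h : Rˣ) (hg : (g : R) - 1 ∈ I.npow n) (hh : (h : R) - 1 ∈ I.npow m) :
    ((g⁻¹ * h⁻¹ * g * h : Rˣ) : R) - 1 -
        (((g : R) - 1) * ((h : R) - 1) - ((h : R) - 1) * ((g : R) - 1)) ∈
      I.npow (2 * n + m) ∧
    ((g⁻¹ * h⁻¹ * g * h : Rˣ) : R) - 1 ∈ I.npow (n + m) := by
  have hh' := npow_anti I n m hnm _ hh
  set c : R := ((g : R) - 1) * ((h : R) - 1) - ((h : R) - 1) * ((g : R) - 1) with hc
  have hcm : c ∈ I.npow (n + m) := by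
    refine TwoSidedIdeal.sub_mem _ (npow_mul_mem I n m _ _ hg hh) ?_
    rw [add_comm]
    exact npow_mul_mem I m n _ _ hh hg
  have hc' : c = (h * g : Rˣ) * (((g⁻¹ * h⁻¹ * g * h : Rˣ) : R) - 1) := by
    rw [mul_sub, ← Units.val_mul]
    have : h * g * (g⁻¹ * h⁻¹ * g * h) = g * h := by group
    rw [this, hc]
    push_cast
    noncomm_ring
  have e : ((g⁻¹ * h⁻¹ * g * h : Rˣ) : R) - 1 = ((h * g)⁻¹ : Rˣ) * c := by
    rw [hc', Units.inv_mul_cancel_left]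
  have hu : (((h * g)⁻¹ : Rˣ) : R) - 1 ∈ I.npow n := by
    have e2 : (((h * g)⁻¹ : Rˣ) : R) - 1 =
        -(((h * g)⁻¹ : Rˣ) * (((h : R) - 1) * g + ((g : R) - 1))) := by
      have : ((h : R) - 1) * g + ((g : R) - 1) = (h * g : Rˣ) - 1 := by
        push_cast; noncomm_ring
      rw [this, mul_sub, Units.inv_mul]; simp
    rw [e2]
    exact TwoSidedIdeal.neg_mem _ (TwoSidedIdeal.mul_mem_left _ _ _
      (TwoSidedIdeal.add_mem _ (TwoSidedIdeal.mul_mem_right _ _ _ hh') hg))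
  rw [e]
  refine ⟨?_, TwoSidedIdeal.mul_mem_left _ _ _ hcm⟩
  have := npow_mul_mem I n (n + m) _ _ hu hcm
  rw [sub_mul, one_mul] at this
  rwa [two_mul, add_assoc]
end

section
/- Let R be a commutative unital ring and d ≥ 3 a natural number. For every d×d matrix X over R with trace 0, there exist d×d matrices Y₁, Z₁, Y₂, Z₂ over R, each with trace 0, such that X = (Y₁Z₁ − Z₁Y₁) + (Y₂Z₂ − Z₂Y₂). In other words, every element of the Lie ring 𝔰𝔩_d(R) of traceless matrices is the sum of two Lie brackets of elements of 𝔰𝔩_d(R). -/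
open Finset in
lemma shift_sum {R : Type*} [CommRing R] (d : ℕ) (x : ℕ → ℕ → R)
    (h0 : ∀ i j, d ≤ i → x i j = 0) (i j : ℕ) :
    ∑ m ∈ range d, x (i + m) (j + m) = x i j + ∑ m ∈ range d, x (i + 1 + m) (j + 1 + m) := by
  have h1 := sum_range_succ (fun m => x (i + m) (j + m)) d
  have h2 := sum_range_succ' (fun m => x (i + m) (j + m)) d
  rw [h1, h0 (i + d) _ (by omega), add_zero] at h2
  rw [h2, add_comm]
  simp only [add_zero]
  congr 1
  refine sum_congr rfl fun m _ => ?_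
  congr 1 <;> omega

open Finset in
lemma mul_of_nat {R : Type*} [CommRing R] (d : ℕ) (f g : ℕ → ℕ → R) (i j : Fin d) :
    ((Matrix.of fun i j : Fin d => f i j) * (Matrix.of fun i j : Fin d => g i j)) i j
      = ∑ m ∈ range d, f i m * g m j := by
  simp [Matrix.mul_apply, Finset.sum_range]

open Finset in
lemma trace_of_nat {R : Type*} [CommRing R] (d : ℕ) (f : ℕ → ℕ → R) :
    (Matrix.of fun i j : Fin d => f i j).trace = ∑ m ∈ range d, f m m := by
  simp [Matrix.trace, Finset.sum_range]

open Finset in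
lemma bracket_with_shift {R : Type*} [CommRing R] (d : ℕ) (x : ℕ → ℕ → R)
    (h0 : ∀ i j, d ≤ i → x i j = 0)
    (hF : ∀ k < d, ∑ m ∈ range d, x (k + m) (0 + m) = 0)
    (hT : ∑ i ∈ range d, ∑ m ∈ range d, x (i + m) (i + 1 + m) = 0) :
    ∃ Y Z : Matrix (Fin d) (Fin d) R, Y.trace = 0 ∧ Z.trace = 0 ∧
      (Matrix.of fun i j : Fin d => x i j) = Y * Z - Z * Y := by
  let y : ℕ → ℕ → R := fun a b => if a + 1 = b then (1 : R) else 0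
  let z : ℕ → ℕ → R := fun a b => -∑ m ∈ range d, x (a + m) (b + 1 + m)
  refine ⟨Matrix.of fun i j : Fin d => y i j, Matrix.of fun i j : Fin d => z i j, ?_, ?_, ?_⟩
  · rw [trace_of_nat]; simp [y]
  · rw [trace_of_nat]; simp [z, hT]
  · ext ⟨i, hi⟩ ⟨j, hj⟩
    rw [Matrix.sub_apply, mul_of_nat, mul_of_nat]
    have hz : ∀ j, d ≤ i + 1 → ∑ m ∈ range d, x (i + 1 + m) (j + m) = 0 := fun j h =>
      sum_eq_zero fun m _ => h0 _ _ (by omega)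
    have e1 : ∑ m ∈ range d, (if i + 1 = m then (1 : R) else 0) *
        (-∑ k ∈ range d, x (m + k) (j + 1 + k)) = -∑ k ∈ range d, x (i + 1 + k) (j + 1 + k) := by
      simp only [ite_mul, one_mul, zero_mul, sum_ite_eq, mem_range]
      split_ifs with h
      · rfl
      · rw [hz _ (by omega), neg_zero]
    simp only [Matrix.of_apply, y, z]
    rw [e1]
    cases j with
    | zero =>
      have := shift_sum d x h0 i 0
      rw [hF i hi] at this
      simp
      simp at this
      linear_combination -this
    | succ j =>
      have := shift_sum d x h0 i (j + 1)
      have e2 : ∑ m ∈ range d, (-∑ k ∈ range d, x (i + k) (m + 1 + k)) *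
          (if m + 1 = j + 1 then (1 : R) else 0) = -∑ k ∈ range d, x (i + k) (j + 1 + k) := by
        simp only [mul_ite, mul_one, mul_zero, add_left_inj, sum_ite_eq', mem_range]
        rw [if_pos (by omega)]
      rw [e2]
      linear_combination -this

/-- The correction term. -/
def corrW {R : Type*} [CommRing R] (n : ℕ) (u : ℕ → R) (t : R) (i j : ℕ) : R :=
  (if i = n + 2 then (if j < n + 2 then u j else 0) else 0) +
    (if i = 0 then (if j = 1 then t else 0) else 0) -
    (if j = 2 then (if i = 0 then u 0 else 0) else 0)

open Finset in
lemma corrW_bracket {R : Type*} [CommRing R] (n : ℕ) (u : ℕ → R) (t : R) :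
    ∃ Y Z : Matrix (Fin (n + 3)) (Fin (n + 3)) R, Y.trace = 0 ∧ Z.trace = 0 ∧
      (Matrix.of fun i j : Fin (n + 3) => corrW n u t i j) = Y * Z - Z * Y := by
  let y : ℕ → ℕ → R := fun a b =>
    (if a = n + 2 then (if b = 0 then 1 else 0) else 0) +
      (if a = 0 then (if b = 2 then 1 else 0) else 0)
  let z : ℕ → ℕ → R := fun a b =>
    (if a = 0 then (if b < n + 2 then u b else 0) else 0) +
      (if a = 2 then (if b = 1 then t else 0) else 0) -
      (if a = 1 then (if b = 1 then u 0 else 0) else 0)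
  have hyl : ∀ (g : ℕ → R) (i : ℕ), ∑ m ∈ range (n + 3), y i m * g m =
      (if i = n + 2 then g 0 else 0) + (if i = 0 then g 2 else 0) := by
    intro g i
    simp only [y, add_mul, sum_add_distrib]
    congr 1
    · split_ifs <;> simp
    · split_ifs <;> simp
  have hyr : ∀ (g : ℕ → R) (j : ℕ), ∑ m ∈ range (n + 3), g m * y m j =
      (if j = 0 then g (n + 2) else 0) + (if j = 2 then g 0 else 0) := by
    intro g j
    simp only [y, mul_add, sum_add_distrib]
    congr 1
    · simp
    · simp
  refine ⟨Matrix.of fun i j : Fin (n + 3) => y i j, Matrix.of fun i j : Fin (n + 3) => z i j,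
    ?_, ?_, ?_⟩
  · rw [trace_of_nat]
    refine sum_eq_zero fun m _ => ?_
    simp only [y]
    split_ifs <;> first | omega | simp
  · rw [trace_of_nat, sum_range_succ', sum_range_succ']
    have : ∑ m ∈ range (n + 1), z (m + 1 + 1) (m + 1 + 1) = 0 :=
      sum_eq_zero fun m _ => by simp [z]
    rw [this]
    simp [z]
  · ext ⟨i, hi⟩ ⟨j, hj⟩
    rw [Matrix.sub_apply, mul_of_nat, mul_of_nat, hyl (fun m => z m j), hyr (fun m => z i m)]
    simp only [Matrix.of_apply, corrW, z]
    by_cases h1 : i = 0 <;> by_cases h2 : i = n + 2 <;> by_cases h3 : j = 0 <;>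
      by_cases h4 : j = 2 <;> simp_all

open Finset in
lemma corrW_diag {R : Type*} [CommRing R] (n : ℕ) (u : ℕ → R) (t : R) (k : ℕ) (hk : k < n + 2) :
    ∑ m ∈ range (n + 3), corrW n u t (n + 2 - k + m) (0 + m) = u k := by
  rw [sum_eq_single k]
  · simp only [corrW]
    split_ifs <;> first | omega | simp
  · intro m _ hm
    simp only [corrW]
    split_ifs <;> first | omega | simp
  · intro h; simp at h; omega

open Finset in
lemma corrW_diag_zero {R : Type*} [CommRing R] (n : ℕ) (u : ℕ → R) (t : R) :
    ∑ m ∈ range (n + 3), corrW n u t (0 + m) (0 + m) = 0 := by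
  refine sum_eq_zero fun m _ => ?_
  simp only [corrW]
  split_ifs <;> first | omega | simp

open Finset in
lemma corrW_super {R : Type*} [CommRing R] (n : ℕ) (u : ℕ → R) (t : R) :
    ∑ i ∈ range (n + 3), ∑ m ∈ range (n + 3), corrW n u t (i + m) (i + 1 + m) = t := by
  have h : ∀ i m, corrW n u t (i + m) (i + 1 + m) = if i = 0 then (if m = 0 then t else 0) else 0 := by
    intro i m
    simp only [corrW]
    split_ifs <;> first | omega | simp
  simp only [h]
  simp

/-- **(𝔰𝔩_d, d ≥ 3): every traceless matrix is a sum of two brackets.**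
Let `R` be a commutative unital ring and `d ≥ 3`.  Every `d × d` matrix `X` over
`R` with trace `0` can be written as `X = [Y₁, Z₁] + [Y₂, Z₂]` with all of
`Y₁, Z₁, Y₂, Z₂` traceless, where `[Y, Z] = YZ − ZY`. -/
theorem sl_sum_of_two_brackets
    {R : Type*} [CommRing R] (d : ℕ) (hd : 3 ≤ d)
    (X : Matrix (Fin d) (Fin d) R) (hX : X.trace = 0) :
    ∃ Y₁ Z₁ Y₂ Z₂ : Matrix (Fin d) (Fin d) R,
      Y₁.trace = 0 ∧ Z₁.trace = 0 ∧ Y₂.trace = 0 ∧ Z₂.trace = 0 ∧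
      X = (Y₁ * Z₁ - Z₁ * Y₁) + (Y₂ * Z₂ - Z₂ * Y₂) := by
  obtain ⟨n, rfl⟩ : ∃ n, d = n + 3 := ⟨d - 3, by omega⟩
  let x : ℕ → ℕ → R := fun i j =>
    if h : i < n + 3 ∧ j < n + 3 then X ⟨i, h.1⟩ ⟨j, h.2⟩ else 0
  have hxX : X = Matrix.of fun i j : Fin (n + 3) => x i j := by
    ext i j
    simp [x]
  have hx0 : ∀ i j, n + 3 ≤ i → x i j = 0 := by
    intro i j h
    simp only [x]
    rw [dif_neg (by omega)]
  let u : ℕ → R := fun k => ∑ m ∈ Finset.range (n + 3), x (n + 2 - k + m) (0 + m)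
  let t : R := ∑ i ∈ Finset.range (n + 3), ∑ m ∈ Finset.range (n + 3), x (i + m) (i + 1 + m)
  obtain ⟨Y₂, Z₂, hY₂, hZ₂, h₂⟩ := corrW_bracket n u t
  obtain ⟨Y₁, Z₁, hY₁, hZ₁, h₁⟩ := bracket_with_shift (n + 3) (fun i j => x i j - corrW n u t i j)
    (by
      intro i j h
      simp only [hx0 i j h, corrW]
      split_ifs <;> first | omega | simp)
    (by
      intro k hk
      rw [Finset.sum_sub_distrib]
      rcases Nat.eq_zero_or_pos k with rfl | hk0
      · rw [corrW_diag_zero, sub_zero]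
        rw [hxX, trace_of_nat] at hX
        simpa using hX
      · have h := corrW_diag n u t (n + 2 - k) (by omega)
        have e : n + 2 - (n + 2 - k) = k := by omega
        simp only [u] at h
        rw [e] at h
        rw [h, sub_self])
    (by
      simp only [Finset.sum_sub_distrib]
      rw [corrW_super, sub_self])
  refine ⟨Y₁, Z₁, Y₂, Z₂, hY₁, hZ₁, hY₂, hZ₂, ?_⟩
  rw [← h₁, ← h₂, hxX]
  ext i j
  simp
end

section
/- Let R be a commutative unital ring in which 2 is invertible. For every 2×2 matrix X over R with trace 0, there exist 2×2 matrices Y₁, Z₁, Y₂, Z₂ over R, each with trace 0, such that X = (Y₁Z₁ − Z₁Y₁) + (Y₂Z₂ − Z₂Y₂). -/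
/-- **(𝔰𝔩₂, 2 invertible): every traceless 2×2 matrix is a sum of two brackets.**
Let `R` be a commutative unital ring in which `2` is invertible.  Every `2 × 2`
matrix `X` over `R` with trace `0` can be written as `X = [Y₁, Z₁] + [Y₂, Z₂]`
with all of `Y₁, Z₁, Y₂, Z₂` traceless, where `[Y, Z] = YZ − ZY`. -/
theorem sl2_sum_of_two_brackets
    {R : Type*} [CommRing R] (h2 : IsUnit (2 : R))
    (X : Matrix (Fin 2) (Fin 2) R) (hX : X.trace = 0) :
    ∃ Y₁ Z₁ Y₂ Z₂ : Matrix (Fin 2) (Fin 2) R,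
      Y₁.trace = 0 ∧ Z₁.trace = 0 ∧ Y₂.trace = 0 ∧ Z₂.trace = 0 ∧
      X = (Y₁ * Z₁ - Z₁ * Y₁) + (Y₂ * Z₂ - Z₂ * Y₂) := by
  obtain ⟨t, ht⟩ := h2.exists_right_inv
  rw [Matrix.trace_fin_two] at hX
  refine ⟨!![1, 0; 0, -1], !![0, t * X 0 1; -(t * X 1 0), 0], !![0, 1; 0, 0],
    !![0, 0; X 0 0, 0], ?_, ?_, ?_, ?_, ?_⟩
  · simp [Matrix.trace_fin_two]
  · simp [Matrix.trace_fin_two]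
  · simp [Matrix.trace_fin_two]
  · simp [Matrix.trace_fin_two]
  · ext i j
    fin_cases i <;> fin_cases j <;> simp [Matrix.mul_apply, Fin.sum_univ_two]
    · linear_combination (-X 0 1) * ht
    · linear_combination (-X 1 0) * ht
    · linear_combination hX
end

section
/- Let R be a commutative unital ring in which 2 is invertible and d ≥ 5 a natural number. For every skew-symmetric d×d matrix X over R (i.e., Xᵀ = −X), there exist skew-symmetric d×d matrices Y₁, Z₁, Y₂, Z₂, Y₃, Z₃ over R such that X = (Y₁Z₁ − Z₁Y₁) + (Y₂Z₂ − Z₂Y₂) + (Y₃Z₃ − Z₃Y₃). In other words, every element of the Lie ring 𝔰𝔬_d(R) of skew-symmetric matrices is the sum of three Lie brackets of elements of 𝔰𝔬_d(R). -/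
open Matrix

/-- Solution of the recursion for the coefficients. -/
def recA {R : Type*} [CommRing R] (x : ℕ → ℕ → R) : ℕ → ℕ → R
  | 0 => fun _ => 0
  | 1 => fun _ => 0
  | r + 2 => fun s => if s ≤ r then
      x (r + 1) s + recA x r s - recA x (r + 1) (s + 1)
        + (if s = 0 then 0 else recA x (r + 1) (s - 1)) else 0

lemma recA_zero {R : Type*} [CommRing R] (x : ℕ → ℕ → R) (r s : ℕ) (h : r ≤ s + 1) :
    recA x r s = 0 := by
  match r with
  | 0 => simp [recA]
  | 1 => simp [recA]
  | r + 2 => simp only [recA]; rw [if_neg (by omega)]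

lemma exists_a {R : Type*} [CommRing R] (x : ℕ → ℕ → R) (n : ℕ) (c : R) :
    ∃ a : ℕ → ℕ → R, (∀ r s, r ≤ s + 1 → a r s = 0) ∧
      (∀ r s, s ≤ r → r + 1 < n + 1 → a (r + 2) s = x (r + 1) s + a r s - a (r + 1) (s + 1)
        + (if s = 0 then 0 else a (r + 1) (s - 1))) ∧ a (n + 2) n = c := by
  refine ⟨fun r s => if r ≤ n + 1 then recA x r s else if s = n ∧ r = n + 2 then c else 0,
    ?_, ?_, ?_⟩
  · intro r s h
    dsimp only
    split_ifs
    · exact recA_zero x r s h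
    · omega
    · rfl
  · intro r s h h'
    dsimp only
    have e1 : r + 2 ≤ n + 1 := by omega
    have e2 : r ≤ n + 1 := by omega
    have e3 : r + 1 ≤ n + 1 := by omega
    simp only [e1, e2, e3, if_true]
    rw [recA]
    simp only [h, if_true]
  · simp

lemma sum_T {R : Type*} [CommRing R] (d : ℕ) (r : Fin d) (g : ℕ → R) :
    ∑ k : Fin d, ((if (k : ℕ) = r + 1 then (1 : R) else 0) -
      (if (r : ℕ) = k + 1 then 1 else 0)) * g k =
    (if (r : ℕ) + 1 < d then g (r + 1) else 0) - (if (r : ℕ) = 0 then 0 else g (r - 1)) := by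
  simp only [sub_mul, Finset.sum_sub_distrib, ite_mul, one_mul, zero_mul]
  congr 1
  · split_ifs with h
    · rw [Finset.sum_eq_single ⟨r + 1, h⟩]
      · simp
      · intro b _ hb
        rw [if_neg]
        intro h'
        exact hb (Fin.ext h')
      · simp
    · apply Finset.sum_eq_zero
      intro k _
      rw [if_neg]
      have := k.2
      omega
  · split_ifs with h
    · apply Finset.sum_eq_zero
      intro k _
      rw [if_neg]
      omega
    · have hr := r.2
      rw [Finset.sum_eq_single ⟨r - 1, by omega⟩]
      · rw [if_pos]
        simp only
        omega
      · intro b _ hb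
        rw [if_neg]
        intro h'
        exact hb (Fin.ext (by simp only; omega))
      · simp

lemma skew_eq {R : Type*} [CommRing R] {d : ℕ} (Y Z : Matrix (Fin d) (Fin d) R)
    (hY : Yᵀ = -Y) (hZ : Zᵀ = -Z) : Z * Y = (Y * Z)ᵀ := by
  rw [transpose_mul, hY, hZ]; simp

lemma skew_bracket {R : Type*} [CommRing R] {d : ℕ} (Y Z : Matrix (Fin d) (Fin d) R)
    (hY : Yᵀ = -Y) (hZ : Zᵀ = -Z) : (Y * Z - Z * Y)ᵀ = -(Y * Z - Z * Y) := by
  rw [transpose_sub, transpose_mul, transpose_mul, hY, hZ]; simp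

/-- First step: kill the block of indices `≤ n` and the corner entry. -/
lemma step_one {R : Type*} [CommRing R] (n : ℕ) (X : Matrix (Fin (n + 3)) (Fin (n + 3)) R)
    (hX : ∀ i j, X i j = - X j i) :
    ∃ Y Z : Matrix (Fin (n + 3)) (Fin (n + 3)) R, Yᵀ = -Y ∧ Zᵀ = -Z ∧
      (∀ r s : Fin (n + 3), (s : ℕ) < r → (r : ℕ) < n + 1 → X r s = (Y * Z - Z * Y) r s) ∧
      (∀ r s : Fin (n + 3), (s : ℕ) = n + 1 → (r : ℕ) = n + 2 →
        X r s = (Y * Z - Z * Y) r s) := by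
  obtain ⟨a, h0, h1, hc⟩ := exists_a
    (fun r s => if h : r < n + 3 ∧ s < n + 3 then X ⟨r, h.1⟩ ⟨s, h.2⟩ else 0) n
    (- X ⟨n + 2, by omega⟩ ⟨n + 1, by omega⟩)
  let T : Matrix (Fin (n + 3)) (Fin (n + 3)) R := Matrix.of fun r k =>
    (if (k : ℕ) = r + 1 then (1 : R) else 0) - (if (r : ℕ) = k + 1 then 1 else 0)
  let Z : Matrix (Fin (n + 3)) (Fin (n + 3)) R := Matrix.of fun r s => a r s - a s r
  have hT : Tᵀ = -T := by
    ext i j; simp [T]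
  have hZ : Zᵀ = -Z := by
    ext i j; simp [Z]
  have hTZ : ∀ r s : Fin (n + 3), (T * Z) r s =
      (if (r : ℕ) + 1 < n + 3 then a (r + 1) s - a s (r + 1) else 0) -
        (if (r : ℕ) = 0 then 0 else a (r - 1) s - a s (r - 1)) := by
    intro r s
    rw [Matrix.mul_apply]
    exact sum_T (n + 3) r (fun k => a k s - a s k)
  refine ⟨T, Z, hT, hZ, ?_, ?_⟩
  · intro r s hsr hrn
    rw [skew_eq T Z hT hZ, Matrix.sub_apply, transpose_apply, hTZ, hTZ]
    obtain ⟨r, hr⟩ := r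
    obtain ⟨s, hs⟩ := s
    simp only at *
    obtain ⟨r, rfl⟩ : ∃ k, r = k + 1 := ⟨r - 1, by omega⟩
    have e := h1 r s (by omega) hrn
    rw [dif_pos ⟨hr, hs⟩] at e
    rw [if_pos (by omega), if_neg (by omega), if_pos (by omega)]
    simp only [Nat.add_sub_cancel]
    rw [e, h0 s (r + 1 + 1) (by omega), h0 s r (by omega), h0 (s + 1) (r + 1) (by omega)]
    by_cases hs0 : s = 0
    · simp only [hs0, if_true]; ring
    · simp only [hs0, if_false]
      rw [h0 (s - 1) (r + 1) (by omega)]; ring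
  · intro r s hs hr
    rw [skew_eq T Z hT hZ, Matrix.sub_apply, transpose_apply, hTZ, hTZ]
    obtain ⟨r, hr'⟩ := r
    obtain ⟨s, hs'⟩ := s
    simp only at *
    subst hs hr
    simp [hc, h0, h0 n (n + 2) (by omega)]

/-- Second step: the rest is a bracket with a single elementary matrix. -/
lemma step_two {R : Type*} [CommRing R] {d : ℕ} (p q : Fin d) (hpq : p ≠ q)
    (W : Matrix (Fin d) (Fin d) R) (hW : Wᵀ = -W)
    (h0 : ∀ r s, r ≠ p → r ≠ q → s ≠ p → s ≠ q → W r s = 0)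
    (hd : ∀ r, W r r = 0) (hc : W p q = 0) :
    ∃ Y Z : Matrix (Fin d) (Fin d) R, Yᵀ = -Y ∧ Zᵀ = -Z ∧ W = Y * Z - Z * Y := by
  have hs : ∀ i j, W i j = - W j i := fun i j => by
    have := congrFun (congrFun hW j) i
    simpa using this
  have hc' : W q p = 0 := by rw [hs, hc, neg_zero]
  let E : Matrix (Fin d) (Fin d) R := Matrix.of fun r s =>
    (if r = p then (1 : R) else 0) * (if s = q then 1 else 0) -
      (if r = q then 1 else 0) * (if s = p then 1 else 0)
  have hE : Eᵀ = -E := by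
    ext i j; simp only [E, transpose_apply, Matrix.neg_apply, Matrix.of_apply]; ring
  have hEM : ∀ (M : Matrix (Fin d) (Fin d) R) r s, (E * M) r s =
      (if r = p then (1 : R) else 0) * M q s - (if r = q then 1 else 0) * M p s := by
    intro M r s
    simp [Matrix.mul_apply, E, sub_mul, Finset.sum_sub_distrib, mul_assoc]
  have hZ := skew_bracket W E hW hE
  refine ⟨E, W * E - E * W, hE, hZ, ?_⟩
  rw [skew_eq E _ hE hZ]
  ext r s
  rw [Matrix.sub_apply, transpose_apply, hEM, hEM]
  rw [skew_eq E W hE hW]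
  simp only [Matrix.sub_apply, transpose_apply, hEM]
  have hqp := hpq.symm
  by_cases h1 : r = p
  · subst h1
    by_cases h3 : s = r
    · subst h3; simp [hd]
    · by_cases h4 : s = q
      · subst h4; simp [hd, hc, hc', hpq, hqp]
      · simp [h3, h4, hpq, hqp]
  · by_cases h2 : r = q
    · subst h2
      by_cases h3 : s = p
      · subst h3; simp [hd, hc, hc', hpq, hqp]
      · by_cases h4 : s = r
        · subst h4; simp [hd]
        · simp [h3, h4, hpq, hqp]
    · by_cases h3 : s = p
      · subst h3; simp [h1, h2, hpq, hqp, ← hs]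
      · by_cases h4 : s = q
        · subst h4; simp [h1, h2, hpq, hqp, ← hs]
        · simp [h1, h2, h3, h4, h0]

theorem so_sum_of_three_brackets
    {R : Type*} [CommRing R] (h2 : IsUnit (2 : R)) (d : ℕ) (hd : 5 ≤ d)
    (X : Matrix (Fin d) (Fin d) R) (hX : Xᵀ = -X) :
    ∃ Y₁ Z₁ Y₂ Z₂ Y₃ Z₃ : Matrix (Fin d) (Fin d) R,
      Y₁ᵀ = -Y₁ ∧ Z₁ᵀ = -Z₁ ∧ Y₂ᵀ = -Y₂ ∧ Z₂ᵀ = -Z₂ ∧ Y₃ᵀ = -Y₃ ∧ Z₃ᵀ = -Z₃ ∧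
      X = (Y₁ * Z₁ - Z₁ * Y₁) + (Y₂ * Z₂ - Z₂ * Y₂) + (Y₃ * Z₃ - Z₃ * Y₃) := by
  obtain ⟨n, rfl⟩ : ∃ n, d = n + 3 := ⟨d - 3, by omega⟩
  have skew : ∀ (M : Matrix (Fin (n + 3)) (Fin (n + 3)) R), Mᵀ = -M →
      ∀ i j, M i j = - M j i := fun M hM i j => by
    have := congrFun (congrFun hM j) i
    simpa using this
  obtain ⟨Y, Z, hY, hZ, hb, hc⟩ := step_one n X (skew X hX)
  have hW : (X - (Y * Z - Z * Y))ᵀ = -(X - (Y * Z - Z * Y)) := by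
    rw [transpose_sub, skew_bracket Y Z hY hZ, hX]; abel
  have hdiag : ∀ r, (X - (Y * Z - Z * Y)) r r = 0 := by
    intro r
    have h := skew _ hW r r
    have h' : (2 : R) * (X - (Y * Z - Z * Y)) r r = 0 := by
      rw [two_mul]; nth_rewrite 1 [h]; exact neg_add_cancel _
    exact (h2.mul_right_eq_zero).1 h'
  obtain ⟨Y', Z', hY', hZ', e⟩ := step_two ⟨n + 2, by omega⟩ ⟨n + 1, by omega⟩
    (by simp) (X - (Y * Z - Z * Y)) hW (by
      intro r s hr1 hr2 hs1 hs2
      have hr : (r : ℕ) < n + 1 := by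
        have := r.2
        simp only [ne_eq, Fin.ext_iff] at hr1 hr2
        omega
      have hs : (s : ℕ) < n + 1 := by
        have := s.2
        simp only [ne_eq, Fin.ext_iff] at hs1 hs2
        omega
      rcases lt_trichotomy (s : ℕ) r with h | h | h
      · rw [Matrix.sub_apply, hb r s h hr, sub_self]
      · rw [Fin.ext h]; exact hdiag r
      · rw [skew _ hW, Matrix.sub_apply, hb s r h hs, sub_self, neg_zero]) hdiag (by
      rw [Matrix.sub_apply, ← hc _ _ rfl rfl, sub_self])
  refine ⟨Y, Z, Y', Z', 0, 0, hY, hZ, hY', hZ', by simp, by simp, ?_⟩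
  rw [← e]; simp
end

section
/- Let R be a commutative unital ring in which 2 is invertible, let g ≥ 1 and d = 2g, and let Ω be the d×d block matrix Ω = [[0, I_g],[−I_g, 0]]. Let 𝔰𝔭_d(R) = { X ∈ M_d(R) : XᵀΩ + ΩX = 0 }. Then for every X ∈ 𝔰𝔭_d(R) there exist Y₁, Z₁, Y₂, Z₂, Y₃, Z₃ ∈ 𝔰𝔭_d(R) such that X = (Y₁Z₁ − Z₁Y₁) + (Y₂Z₂ − Z₂Y₂) + (Y₃Z₃ − Z₃Y₃). -/
open Matrix

/-- Entries of the solution of `N Z - Z N = W` for strictly upper triangular `W`. -/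
def zAux {R : Type*} [CommRing R] (w : ℕ → ℕ → R) : ℕ → ℕ → R
  | 0, _ => 0
  | _ + 1, 0 => 0
  | i + 1, j + 1 => w i (j + 1) + zAux w i j

theorem zAux_lower {R : Type*} [CommRing R] (w : ℕ → ℕ → R)
    (hw : ∀ i j, j ≤ i → w i j = 0) : ∀ i j, j < i → zAux w i j = 0
  | 0, _, h => by omega
  | _ + 1, 0, _ => rfl
  | i + 1, j + 1, h => by
    rw [zAux, hw i (j + 1) (by omega), zAux_lower w hw i j (by omega), add_zero]

/-- Every square matrix is symmetric plus a commutator. -/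
theorem exists_symm_add_comm {R : Type*} [CommRing R] (g : ℕ) (A : Matrix (Fin g) (Fin g) R) :
    ∃ Q N Z : Matrix (Fin g) (Fin g) R, Qᵀ = Q ∧ A = Q + (N * Z - Z * N) := by
  let w : ℕ → ℕ → R := fun i j =>
    if h : i < j ∧ j < g then A ⟨i, by omega⟩ ⟨j, h.2⟩ - A ⟨j, h.2⟩ ⟨i, by omega⟩ else 0
  have hw : ∀ i j, j ≤ i → w i j = 0 := fun i j h => dif_neg (by omega)
  let N : Matrix (Fin g) (Fin g) R := Matrix.of fun i j => if i.1 + 1 = j.1 then 1 else 0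
  let Z : Matrix (Fin g) (Fin g) R := Matrix.of fun i j => zAux w i j
  have hW : ∀ i j : Fin g, (N * Z - Z * N) i j = w i j := by
    intro i j
    have h1 : (N * Z) i j = zAux w (i.1 + 1) j := by
      rw [Matrix.mul_apply]
      by_cases hi : i.1 + 1 < g
      · rw [Finset.sum_eq_single (⟨i.1 + 1, hi⟩ : Fin g)]
        · simp [N, Z]
        · intro b _ hb
          have : i.1 + 1 ≠ b.1 := fun h => hb (Fin.ext h.symm)
          simp [N, this]
        · simp
      · rw [zAux_lower w hw _ _ (by omega)]
        apply Finset.sum_eq_zero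
        intro b _
        have : i.1 + 1 ≠ b.1 := by omega
        simp [N, this]
    have h2 : (Z * N) i j = if j.1 = 0 then 0 else zAux w i (j.1 - 1) := by
      rw [Matrix.mul_apply]
      split_ifs with hj
      · apply Finset.sum_eq_zero
        intro b _
        have : b.1 + 1 ≠ j.1 := by omega
        simp [N, this]
      · rw [Finset.sum_eq_single (⟨j.1 - 1, by omega⟩ : Fin g)]
        · have : j.1 - 1 + 1 = j.1 := by omega
          simp [N, Z, this]
        · intro b _ hb
          have : b.1 + 1 ≠ j.1 := fun h => hb (Fin.ext (by simp; omega))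
          simp [N, this]
        · simp
    rw [Matrix.sub_apply, h1, h2]
    rcases hj : j.1 with _ | k
    · simp [zAux, hw i 0 (by omega)]
    · simp [zAux]
  refine ⟨A - (N * Z - Z * N), N, Z, ?_, by abel⟩
  ext i j
  rw [Matrix.transpose_apply, Matrix.sub_apply, Matrix.sub_apply A, hW, hW]
  rcases lt_trichotomy i.1 j.1 with h | h | h
  · rw [hw j i h.le]
    simp [w, h]
  · rw [Fin.ext h]
  · rw [hw i j h.le]
    simp [w, h]

/-- **(𝔰𝔭_d, 2 invertible): every symplectic-Lie matrix is a sum of three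
brackets.**  Let `R` be a commutative unital ring in which `2` is invertible,
`g ≥ 1`, `d = 2g`, and `Ω = [[0, I_g], [−I_g, 0]]`.  Every `d × d` matrix `X` over
`R` with `XᵀΩ + ΩX = 0` can be written as `X = [Y₁, Z₁] + [Y₂, Z₂] + [Y₃, Z₃]`
with all of the `Yᵢ, Zᵢ` satisfying the same relation, where `[Y, Z] = YZ − ZY`. -/
theorem sp_sum_of_three_brackets
    {R : Type*} [CommRing R] (h2 : IsUnit (2 : R)) (g : ℕ) (hg : 1 ≤ g)
    (Ω : Matrix (Fin g ⊕ Fin g) (Fin g ⊕ Fin g) R)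
    (hΩ : Ω = Matrix.fromBlocks 0 1 (-1) 0)
    (X : Matrix (Fin g ⊕ Fin g) (Fin g ⊕ Fin g) R)
    (hX : Xᵀ * Ω + Ω * X = 0) :
    ∃ Y₁ Z₁ Y₂ Z₂ Y₃ Z₃ : Matrix (Fin g ⊕ Fin g) (Fin g ⊕ Fin g) R,
      Y₁ᵀ * Ω + Ω * Y₁ = 0 ∧ Z₁ᵀ * Ω + Ω * Z₁ = 0 ∧
      Y₂ᵀ * Ω + Ω * Y₂ = 0 ∧ Z₂ᵀ * Ω + Ω * Z₂ = 0 ∧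
      Y₃ᵀ * Ω + Ω * Y₃ = 0 ∧ Z₃ᵀ * Ω + Ω * Z₃ = 0 ∧
      X = (Y₁ * Z₁ - Z₁ * Y₁) + (Y₂ * Z₂ - Z₂ * Y₂) + (Y₃ * Z₃ - Z₃ * Y₃) := by
  subst hΩ
  obtain ⟨u, hu⟩ := h2.exists_right_inv
  have huu : u + u = 1 := by rw [← hu]; ring
  obtain ⟨A, B, C, D, rfl⟩ : ∃ A B C D, X = Matrix.fromBlocks A B C D :=
    ⟨_, _, _, _, (Matrix.fromBlocks_toBlocks X).symm⟩
  have key : ∀ A B C D : Matrix (Fin g) (Fin g) R,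
      (Matrix.fromBlocks A B C D)ᵀ * Matrix.fromBlocks 0 1 (-1) 0 +
        Matrix.fromBlocks 0 1 (-1) 0 * Matrix.fromBlocks A B C D = 0 ↔
      Cᵀ = C ∧ D = -Aᵀ ∧ Bᵀ = B ∧ Dᵀ = -A := by
    intro A B C D
    rw [Matrix.fromBlocks_transpose, Matrix.fromBlocks_multiply, Matrix.fromBlocks_multiply,
      Matrix.fromBlocks_add, ← Matrix.fromBlocks_zero, Matrix.fromBlocks_inj]
    simp only [mul_zero, zero_mul, mul_one, one_mul, mul_neg, neg_mul, zero_add, add_zero]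
    constructor
    · rintro ⟨h1, h2, h3, h4⟩
      refine ⟨(neg_add_eq_zero.mp h1), ?_, ?_, ?_⟩
      · exact (neg_eq_of_add_eq_zero_right h2).symm
      · exact (add_neg_eq_zero.mp h4)
      · rw [← neg_add_rev, neg_eq_zero] at h3
        exact eq_neg_of_add_eq_zero_right h3
    · rintro ⟨h1, h2, h3, h4⟩
      rw [h1, h3, h4, h2]
      simp
  obtain ⟨hC, hD, hB, -⟩ := (key _ _ _ _).1 hX
  obtain ⟨Q, N, Z, hQ, hA⟩ := exists_symm_add_comm g A
  have hB2 : u • B + u • B = B := by rw [← add_smul, huu, one_smul]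
  have hC2 : u • C + u • C = C := by rw [← add_smul, huu, one_smul]
  refine ⟨Matrix.fromBlocks 1 0 0 (-1), Matrix.fromBlocks 0 (u • B) (-(u • C)) 0,
    Matrix.fromBlocks 0 Q 0 0, Matrix.fromBlocks 0 0 1 0,
    Matrix.fromBlocks N 0 0 (-Nᵀ), Matrix.fromBlocks Z 0 0 (-Zᵀ), ?_, ?_, ?_, ?_, ?_, ?_, ?_⟩
  · rw [key]; simp
  · rw [key]; simp [hB, hC]
  · rw [key]; simp [hQ]
  · rw [key]; simp
  · rw [key]; simp
  · rw [key]; simp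
  · simp only [Matrix.fromBlocks_multiply, sub_eq_add_neg, Matrix.fromBlocks_neg, Matrix.fromBlocks_add]
    rw [Matrix.fromBlocks_inj]
    refine ⟨?_, ?_, ?_, ?_⟩
    · simpa [sub_eq_add_neg] using hA
    · simp [hB2]
    · simp [hC2]
    · rw [hD, hA]
      simp [hQ, Matrix.transpose_mul]
      try abel
end

section
/- Let p be a prime and let R be a commutative unital Noetherian local integral domain whose maximal ideal M is principal with generator P, which is complete with respect to the M-adic topology (i.e., R is a complete discrete valuation ring), and whose residue field R/M is finite of characteristic p. Let d ≥ 2, and assume either d ≥ 3, or d = 2 and p ≥ 3. For n ≥ 1 let K_n be the kernel of the reduction homomorphism SL_d(R) → SL_d(R/Mⁿ) (equivalently, K_n = { A ∈ SL_d(R) : every entry of A − I lies in Mⁿ }). Then each quotient SL_d(R)/K_n is finite, and there exist real constants C₁, C₂ > 0 such that for every n ≥ 1 and every generating set S of SL_d(R)/K_n, every element of SL_d(R)/K_n is a product of at most C₁·n^{C₂} elements of S ∪ S⁻¹ ∪ {1}. -/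
/-- The `n`-th principal congruence subgroup of `SL_d(R)` over a local ring `R`:
the kernel of reduction modulo the `n`-th power of the maximal ideal.  Its
elements are exactly the `A ∈ SL_d(R)` all of whose entries of `A − I` lie in
`Mⁿ`. -/
def SLcongruence (d : ℕ) (R : Type*) [CommRing R] [IsLocalRing R] (n : ℕ) :
    Subgroup (Matrix.SpecialLinearGroup (Fin d) R) :=
  MonoidHom.ker
    (Matrix.SpecialLinearGroup.map
      (Ideal.Quotient.mk ((IsLocalRing.maximalIdeal R) ^ n)))

instance SLcongruence.normal (d : ℕ) (R : Type*) [CommRing R] [IsLocalRing R]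
    (n : ℕ) : (SLcongruence d R n).Normal :=
  MonoidHom.normal_ker _

open Matrix in
theorem SLaux_mem {d : ℕ} {R : Type*} [CommRing R] [IsLocalRing R] (P : R)
    (hP : IsLocalRing.maximalIdeal R = Ideal.span {P}) (n : ℕ)
    (g h : SpecialLinearGroup (Fin d) R) :
    g⁻¹ * h ∈ SLcongruence d R n ↔
      ∃ Z : Matrix (Fin d) (Fin d) R, (h : Matrix (Fin d) (Fin d) R) = g + P ^ n • Z := by
  unfold SLcongruence
  rw [MonoidHom.mem_ker, map_mul, map_inv, inv_mul_eq_one]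
  have key : ∀ x y : R, Ideal.Quotient.mk (IsLocalRing.maximalIdeal R ^ n) x =
      Ideal.Quotient.mk (IsLocalRing.maximalIdeal R ^ n) y ↔ ∃ z, y = x + P ^ n * z := by
    intro x y
    rw [eq_comm, Ideal.Quotient.eq, hP, Ideal.span_singleton_pow, Ideal.mem_span_singleton]
    constructor
    · rintro ⟨z, hz⟩; exact ⟨z, by rw [← hz]; ring⟩
    · rintro ⟨z, hz⟩; exact ⟨z, by rw [hz]; ring⟩
  constructor
  · intro H
    have H' : ∀ i j, ∃ z, h i j = g i j + P ^ n * z := by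
      intro i j
      rw [← key]
      have := congrArg (fun M : SpecialLinearGroup (Fin d) _ => M i j) H
      simpa using this
    choose Z hZ using H'
    refine ⟨Matrix.of Z, ?_⟩
    ext i j
    simp [hZ]
  · rintro ⟨Z, hZ⟩
    ext i j
    have : ∃ z, h i j = g i j + P ^ n * z := ⟨Z i j, by
      have := congrFun (congrFun hZ i) j
      simpa using this⟩
    simpa using (key _ _).2 this

theorem SLaux_finite (d : ℕ) (R : Type*) [CommRing R] [IsNoetherianRing R] [IsLocalRing R]
    [Finite (IsLocalRing.ResidueField R)] (n : ℕ) :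
    Finite (Matrix.SpecialLinearGroup (Fin d) R ⧸ SLcongruence d R n) := by
  have : Finite (R ⧸ IsLocalRing.maximalIdeal R) :=
    inferInstanceAs (Finite (IsLocalRing.ResidueField R))
  have : Finite (R ⧸ IsLocalRing.maximalIdeal R ^ n) :=
    Ideal.finite_quotient_pow (IsNoetherian.noetherian _) n
  exact Finite.of_injective _ (QuotientGroup.kerLift_injective
    (Matrix.SpecialLinearGroup.map (n := Fin d)
      (Ideal.Quotient.mk ((IsLocalRing.maximalIdeal R) ^ n))))

/-- Uniform bound on the diameter of a finite group. -/
theorem SLaux_bound (H : Type*) [Group H] [Finite H] : ∃ c : ℕ, ∀ S : Set H,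
    Subgroup.closure S = ⊤ → ∀ x : H, ∃ L : List H, (∀ y ∈ L, y ∈ S ∪ S⁻¹ ∪ {1}) ∧
      L.length ≤ c ∧ L.prod = x := by
  classical
  have h : ∀ q : Set H × H, ∃ c : ℕ, Subgroup.closure q.1 = ⊤ →
      ∃ L : List H, (∀ y ∈ L, y ∈ q.1 ∪ q.1⁻¹ ∪ {1}) ∧ L.length ≤ c ∧ L.prod = q.2 := by
    rintro ⟨S, x⟩
    by_cases hS : Subgroup.closure S = ⊤
    · obtain ⟨L, hL, hx⟩ := Submonoid.exists_list_of_mem_closure (s := S ∪ S⁻¹) (x := x)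
        (by rw [← Subgroup.closure_toSubmonoid, hS]; trivial)
      refine ⟨L.length, fun _ => ⟨L, fun y hy => ?_, le_rfl, hx⟩⟩
      rcases hL y hy with h | h
      · exact Or.inl (Or.inl h)
      · exact Or.inl (Or.inr h)
    · exact ⟨0, fun h => absurd h hS⟩
  choose f hf using h
  obtain ⟨c, hc⟩ := (Set.finite_range f).bddAbove
  refine ⟨c, fun S hS x => ?_⟩
  obtain ⟨L, h1, h2, h3⟩ := hf (S, x) hS
  exact ⟨L, h1, h2.trans (hc ⟨_, rfl⟩), h3⟩

/-- Elements of `G` whose image in `G ⧸ N` has a word of length at most `l`. -/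
def SLaux_T {G : Type*} [Group G] (N : Subgroup G) [N.Normal] (S : Set (G ⧸ N)) (l : ℕ) :
    Set G :=
  {g | ∃ L : List (G ⧸ N), (∀ y ∈ L, y ∈ S ∪ S⁻¹ ∪ {1}) ∧ L.length ≤ l ∧
    L.prod = (QuotientGroup.mk g : G ⧸ N)}

section words
variable {G : Type*} [Group G] (N : Subgroup G) [N.Normal] (S : Set (G ⧸ N))

theorem SLaux_T_one : (1 : G) ∈ SLaux_T N S 0 := ⟨[], by simp⟩

theorem SLaux_T_mono {a b : ℕ} (h : a ≤ b) {g : G} (hg : g ∈ SLaux_T N S a) :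
    g ∈ SLaux_T N S b := by
  obtain ⟨L, h1, h2, h3⟩ := hg
  exact ⟨L, h1, h2.trans h, h3⟩

theorem SLaux_T_mul {a b : ℕ} {g h : G} (hg : g ∈ SLaux_T N S a) (hh : h ∈ SLaux_T N S b) :
    g * h ∈ SLaux_T N S (a + b) := by
  obtain ⟨L, h1, h2, h3⟩ := hg
  obtain ⟨L', h1', h2', h3'⟩ := hh
  refine ⟨L ++ L', ?_, ?_, ?_⟩
  · intro y hy
    rcases List.mem_append.1 hy with hy | hy
    · exact h1 y hy
    · exact h1' y hy
  · rw [List.length_append]; omega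
  · rw [List.prod_append, h3, h3', QuotientGroup.mk_mul]

theorem SLaux_T_inv {a : ℕ} {g : G} (hg : g ∈ SLaux_T N S a) :
    g⁻¹ ∈ SLaux_T N S a := by
  obtain ⟨L, h1, h2, h3⟩ := hg
  refine ⟨(L.map (fun x => x⁻¹)).reverse, ?_, ?_, ?_⟩
  · intro y hy
    rw [List.mem_reverse, List.mem_map] at hy
    obtain ⟨z, hz, rfl⟩ := hy
    rcases h1 z hz with (h | h) | h
    · exact Or.inl (Or.inr (by simpa using h))
    · exact Or.inl (Or.inl (by simpa using h))
    · right
      have : z = 1 := h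
      simp [this]
  · simpa using h2
  · rw [← List.prod_inv_reverse, h3, QuotientGroup.mk_inv]

/-- Base case: approximating modulo a larger normal subgroup. -/
theorem SLaux_base (K : Subgroup G) [K.Normal] (hNK : N ≤ K) (c : ℕ)
    (hc : ∀ S : Set (G ⧸ K),
      Subgroup.closure S = ⊤ → ∀ x : G ⧸ K, ∃ L : List (G ⧸ K), (∀ y ∈ L, y ∈ S ∪ S⁻¹ ∪ {1}) ∧
      L.length ≤ c ∧ L.prod = x) (hS : Subgroup.closure S = ⊤) (g : G) :
    ∃ t ∈ SLaux_T N S c, g⁻¹ * t ∈ K := by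
  set φ : G ⧸ N →* G ⧸ K := QuotientGroup.map N K (MonoidHom.id G) hNK with hφ
  have hsurj : Function.Surjective φ := by
    intro x
    obtain ⟨y, rfl⟩ := QuotientGroup.mk_surjective x
    exact ⟨(y : G ⧸ N), rfl⟩
  have hcl : Subgroup.closure (φ '' S) = ⊤ := by
    rw [← MonoidHom.map_closure, hS, ← MonoidHom.range_eq_map, MonoidHom.range_eq_top]
    exact hsurj
  obtain ⟨L, h1, h2, h3⟩ := hc _ hcl (g : G ⧸ K)
  have hlift : ∀ L : List (G ⧸ K), (∀ y ∈ L, y ∈ φ '' S ∪ (φ '' S)⁻¹ ∪ {1}) →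
      ∃ L' : List (G ⧸ N), (∀ y ∈ L', y ∈ S ∪ S⁻¹ ∪ {1}) ∧ L'.length = L.length ∧
        φ L'.prod = L.prod := by
    intro L
    induction L with
    | nil => intro _; exact ⟨[], by simp⟩
    | cons a L ih =>
      intro h
      obtain ⟨L', h1, h2, h3⟩ := ih (fun y hy => h y (List.mem_cons_of_mem _ hy))
      have : ∃ b ∈ S ∪ S⁻¹ ∪ {1}, φ b = a := by
        rcases h a List.mem_cons_self with (h | h) | h
        · obtain ⟨b, hb, rfl⟩ := h
          exact ⟨b, Or.inl (Or.inl hb), rfl⟩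
        · obtain ⟨b, hb, hb'⟩ := h
          exact ⟨b⁻¹, Or.inl (Or.inr (by simpa using hb)), by rw [map_inv, hb', inv_inv]⟩
        · exact ⟨1, Or.inr rfl, by rw [map_one]; exact h.symm⟩
      obtain ⟨b, hb, rfl⟩ := this
      refine ⟨b :: L', ?_, by simp [h2], by simp [h3]⟩
      intro y hy
      rcases List.mem_cons.1 hy with rfl | hy
      · exact hb
      · exact h1 y hy
  obtain ⟨L', h1', h2', h3'⟩ := hlift L h1
  obtain ⟨t, ht⟩ := QuotientGroup.mk_surjective L'.prod
  refine ⟨t, ⟨L', h1', by omega, ht.symm⟩, ?_⟩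
  rw [← QuotientGroup.eq, ← h3, ← h3', ← ht]
  rfl

end words

open Matrix in
theorem SLaux_comm {d : ℕ} {R : Type*} [CommRing R] (P : R) (i j : ℕ) (hij : i ≤ j)
    (a b : SpecialLinearGroup (Fin d) R) (A B A' B' U V : Matrix (Fin d) (Fin d) R)
    (ha : (a : Matrix (Fin d) (Fin d) R) = 1 + P ^ i • A')
    (hb : (b : Matrix (Fin d) (Fin d) R) = 1 + P ^ j • B')
    (hA : A' = A + P ^ i • U) (hB : B' = B + P ^ i • V) :
    ∃ Z, ((a * b * (a⁻¹ * b⁻¹) : SpecialLinearGroup (Fin d) R) : Matrix (Fin d) (Fin d) R) =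
      1 + P ^ (i + j) • (A * B - B * A) + P ^ (i + j + i) • Z := by
  obtain ⟨k, rfl⟩ := Nat.exists_eq_add_of_le hij
  obtain ⟨g, hg⟩ : ∃ g : Matrix (Fin d) (Fin d) R,
    g = ((a⁻¹ * b⁻¹ : SpecialLinearGroup (Fin d) R) : Matrix (Fin d) (Fin d) R) := ⟨_, rfl⟩
  have h1 : (b : Matrix (Fin d) (Fin d) R) * a * g = 1 := by
    have h0 : b * a * (a⁻¹ * b⁻¹) = 1 := by group
    rw [hg]
    exact congrArg Subtype.val h0
  have h0 : ((a * b * (a⁻¹ * b⁻¹) : SpecialLinearGroup (Fin d) R) : Matrix (Fin d) (Fin d) R)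
    = a * b * g := by rw [hg]; rfl
  rw [h0]
  have h2 : (a : Matrix (Fin d) (Fin d) R) * b = b * a + P ^ (i + (i + k)) • (A' * B' - B' * A') := by
    rw [ha, hb]
    simp only [add_mul, mul_add, one_mul, mul_one, smul_mul_assoc, mul_smul_comm, smul_smul,
      smul_sub, smul_add, pow_add]
    rw [show P ^ i * P ^ k * P ^ i = P ^ i * (P ^ i * P ^ k) by ring]
    abel
  obtain ⟨W, hW⟩ : ∃ W, g = 1 + P ^ i • W := by
    refine ⟨-((A' + P ^ k • B' + P ^ (i + k) • (B' * A')) * g), ?_⟩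
    have h3 : (b : Matrix (Fin d) (Fin d) R) * a = 1 + P ^ i • (A' + P ^ k • B' + P ^ (i + k) • (B' * A')) := by
      rw [ha, hb]
      simp only [add_mul, mul_add, one_mul, mul_one, smul_mul_assoc, mul_smul_comm, smul_smul,
        smul_add, pow_add]
      abel
    rw [h3, add_mul, one_mul, smul_mul_assoc] at h1
    rw [smul_neg, ← sub_eq_add_neg]
    exact eq_sub_of_add_eq h1
  refine ⟨(A' * B' - B' * A') * W + (U * B + A * V + P ^ i • (U * V) - V * A - B * U
    - P ^ i • (V * U)), ?_⟩
  rw [h2, add_mul, h1, smul_mul_assoc, add_assoc, pow_add P (i + (i + k)) i, mul_smul, ← smul_add]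
  congr 2
  nth_rewrite 1 [hW]
  rw [mul_add, mul_one, mul_smul_comm, smul_add, add_comm ((P ^ i) • _), ← add_assoc]
  congr 1
  rw [hA, hB]
  simp only [add_mul, mul_add, smul_mul_assoc, mul_smul_comm, smul_smul, smul_add, smul_sub]
  abel

open Matrix in
/-- `X` is a Lie bracket of matrices that lift to congruence elements of depth `i`, `j`. -/
def SLaux_Gen {d : ℕ} {R : Type*} [CommRing R] (P : R) (i j : ℕ)
    (X : Matrix (Fin d) (Fin d) R) : Prop :=
  ∃ a b : SpecialLinearGroup (Fin d) R, ∃ A B : Matrix (Fin d) (Fin d) R,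
    (a : Matrix (Fin d) (Fin d) R) = 1 + P ^ i • A ∧
    (b : Matrix (Fin d) (Fin d) R) = 1 + P ^ j • B ∧ A * B - B * A = X

open Matrix in
theorem SLaux_transv {d : ℕ} {R : Type*} [CommRing R] (P : R) (i : ℕ) (s t : Fin d)
    (h : s ≠ t) (x : R) : ∃ a : SpecialLinearGroup (Fin d) R,
      (a : Matrix (Fin d) (Fin d) R) = 1 + P ^ i • single s t x := by
  refine ⟨⟨transvection s t (P ^ i * x), det_transvection_of_ne s t h _⟩, ?_⟩
  rw [smul_single, smul_eq_mul]
  rfl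

open Matrix in
theorem SLaux_gen_diag {d : ℕ} {R : Type*} [CommRing R] (P : R) (i j : ℕ) (s t : Fin d)
    (h : s ≠ t) (x : R) : SLaux_Gen P i j (single s s x - single t t x) := by
  obtain ⟨a, ha⟩ := SLaux_transv P i s t h 1
  obtain ⟨b, hb⟩ := SLaux_transv P j t s h.symm x
  refine ⟨a, b, _, _, ha, hb, ?_⟩
  simp [single_mul_single_same]

open Matrix in
theorem SLaux_gen_off3 {d : ℕ} {R : Type*} [CommRing R] (P : R) (i j : ℕ) (s t : Fin d)
    (h : s ≠ t) (hd : 3 ≤ d) (x : R) : SLaux_Gen P i j (single s t x) := by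
  obtain ⟨k, hks, hkt⟩ : ∃ k : Fin d, k ≠ s ∧ k ≠ t := by
    have : ∃ k : Fin d, k ∉ ({s, t} : Finset (Fin d)) := by
      by_contra! hh
      have h1 : (Finset.univ : Finset (Fin d)) ⊆ {s, t} := fun k _ => hh k
      have h2 := Finset.card_le_card h1
      have h3 := Finset.card_le_two (a := s) (b := t)
      rw [Finset.card_univ, Fintype.card_fin] at h2
      omega
    obtain ⟨k, hk⟩ := this
    simp only [Finset.mem_insert, Finset.mem_singleton, not_or] at hk
    exact ⟨k, hk⟩
  obtain ⟨a, ha⟩ := SLaux_transv P i s k hks.symm 1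
  obtain ⟨b, hb⟩ := SLaux_transv P j k t hkt x
  refine ⟨a, b, _, _, ha, hb, ?_⟩
  have h0 : single k t x * single s k (1 : R) = 0 := by simp [h.symm]
  rw [single_mul_single_same, h0]
  simp

open Matrix in
theorem SLaux_gen_off2 {R : Type*} [CommRing R] [IsLocalRing R] (P : R)
    (hP : P ∈ IsLocalRing.maximalIdeal R) (h2 : IsUnit (2 : R))
    (i j : ℕ) (hi : 1 ≤ i) (s t : Fin 2)
    (h : s ≠ t) (x : R) : SLaux_Gen P i j (single s t x) := by
  have hPi : P ^ i ∈ IsLocalRing.maximalIdeal R := Ideal.pow_mem_of_mem _ hP i hi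
  have hunit : ∀ v : R, IsUnit v → IsUnit (v + P ^ i) := by
    intro v hv
    by_contra hcon
    have h1 : v + P ^ i ∈ IsLocalRing.maximalIdeal R := hcon
    have h3 : v ∈ IsLocalRing.maximalIdeal R := by
      have := Ideal.sub_mem _ h1 hPi
      simpa using this
    exact h3 hv
  obtain ⟨w, hw⟩ := (hunit 1 isUnit_one).exists_right_inv
  obtain ⟨z, hz⟩ := (hunit 2 h2).exists_right_inv
  -- y = -w ; 1 - y = 1 + w = (2 + u) w
  have hdiag : ∃ a : SpecialLinearGroup (Fin 2) R, (a : Matrix (Fin 2) (Fin 2) R) =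
      1 + P ^ i • (single s s 1 + single t t (-w)) := by
    refine ⟨⟨1 + P ^ i • (single s s 1 + single t t (-w)), ?_⟩, rfl⟩
    rw [det_fin_two]
    fin_cases s <;> fin_cases t <;> simp [single] at h ⊢ <;> linear_combination (-P ^ i) * hw
  obtain ⟨a, ha⟩ := hdiag
  obtain ⟨v, hv⟩ : ∃ v, v = x * z * (1 + P ^ i) := ⟨_, rfl⟩
  obtain ⟨b, hb⟩ := SLaux_transv P j s t h v
  refine ⟨a, b, _, _, ha, hb, ?_⟩
  have h0 : single t t (-w) * single s t v = 0 := by simp [h.symm]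
  have h0' : single s t v * single s s (1 : R) = 0 := by simp [h.symm]
  rw [add_mul, mul_add, h0, h0', single_mul_single_same, single_mul_single_same, add_zero, zero_add,
    sub_eq_iff_eq_add, ← single_add, hv]
  congr 1
  linear_combination x * z * hw + x * hz

section step
open Matrix
variable {d : ℕ} {R : Type*} [CommRing R] (P : R)
  (N : Subgroup (SpecialLinearGroup (Fin d) R)) [N.Normal]
  (S : Set (SpecialLinearGroup (Fin d) R ⧸ N))

/-- Every element is approximated modulo `P ^ m` by words of length `l`. -/
def SLaux_A (m l : ℕ) : Prop := ∀ g : SpecialLinearGroup (Fin d) R, ∃ t ∈ SLaux_T N S l,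
  ∃ Z : Matrix (Fin d) (Fin d) R, (t : Matrix (Fin d) (Fin d) R) = g + P ^ m • Z

/-- `1 + P ^ m X` is approximated modulo `P ^ r` by a word of length `l`. -/
def SLaux_Good (m r l : ℕ) (X : Matrix (Fin d) (Fin d) R) : Prop := ∃ t ∈ SLaux_T N S l,
  ∃ Z : Matrix (Fin d) (Fin d) R, (t : Matrix (Fin d) (Fin d) R) = 1 + P ^ m • X + P ^ r • Z

theorem SLaux_A_mono {m m' l l' : ℕ} (hm : m' ≤ m) (hl : l ≤ l') (h : SLaux_A P N S m l) :
    SLaux_A P N S m' l' := by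
  intro g
  obtain ⟨t, ht, Z, hZ⟩ := h g
  refine ⟨t, SLaux_T_mono N S hl ht, P ^ (m - m') • Z, ?_⟩
  rw [hZ, smul_smul, ← pow_add, Nat.add_sub_cancel' hm]

theorem SLaux_good_of_gen {i j l : ℕ} (hij : i ≤ j) (hA : SLaux_A P N S (i + j) l)
    {X : Matrix (Fin d) (Fin d) R} (hX : SLaux_Gen P i j X) :
    SLaux_Good P N S (i + j) (i + j + i) (4 * l) X := by
  obtain ⟨a, b, A, B, ha, hb, rfl⟩ := hX
  obtain ⟨a', ha', Za, hZa⟩ := hA a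
  obtain ⟨b', hb', Zb, hZb⟩ := hA b
  obtain ⟨Z, hZ⟩ := SLaux_comm P i j hij a' b' A B (A + P ^ i • (P ^ (j - i) • Za))
    (B + P ^ i • Zb) (P ^ (j - i) • Za) Zb
    (by
      rw [hZa, ha, smul_smul, ← pow_add, Nat.add_sub_cancel' hij, pow_add, mul_smul, smul_add,
        add_assoc])
    (by rw [hZb, hb, add_comm i j, pow_add, mul_smul, smul_add, add_assoc]) rfl rfl
  refine ⟨_, ?_, Z, hZ⟩
  have := SLaux_T_mul N S (SLaux_T_mul N S ha' hb')
    (SLaux_T_mul N S (SLaux_T_inv N S ha') (SLaux_T_inv N S hb'))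
  exact SLaux_T_mono N S (by omega) this

theorem SLaux_good_zero (m r l : ℕ) : SLaux_Good P N S m r l 0 :=
  ⟨1, SLaux_T_mono N S (Nat.zero_le _) (SLaux_T_one N S), 0, by
    rw [smul_zero, smul_zero, add_zero, add_zero]; rfl⟩

theorem SLaux_good_add {m r l l' : ℕ} (hr : r ≤ m + m) {X Y : Matrix (Fin d) (Fin d) R}
    (hX : SLaux_Good P N S m r l X) (hY : SLaux_Good P N S m r l' Y) :
    SLaux_Good P N S m r (l + l') (X + Y) := by
  obtain ⟨t, ht, Z, hZ⟩ := hX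
  obtain ⟨t', ht', Z', hZ'⟩ := hY
  refine ⟨t * t', SLaux_T_mul N S ht ht', P ^ (m + m - r) • (X * Y) + (1 + P ^ m • X) * Z'
    + Z * t', ?_⟩
  have h0 : ((t * t' : SpecialLinearGroup (Fin d) R) : Matrix (Fin d) (Fin d) R)
    = (1 + P ^ m • X + P ^ r • Z) * t' := by rw [← hZ]; rfl
  have h1 : P ^ r • P ^ (m + m - r) • (X * Y) = (P ^ m * P ^ m) • (X * Y) := by
    rw [smul_smul, ← pow_add, Nat.add_sub_cancel' hr, pow_add]
  rw [h0, add_mul (1 + P ^ m • X), smul_add (P ^ r), smul_add (P ^ r), h1, smul_mul_assoc]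
  nth_rewrite 1 [hZ']
  simp only [add_mul, mul_add, one_mul, mul_one, smul_mul_assoc, mul_smul_comm, smul_smul,
      smul_add, pow_add]
  rw [mul_comm (P ^ r)]
  abel

theorem SLaux_good_sum {m r l : ℕ} (hr : r ≤ m + m) {ι : Type*} (s : Finset ι)
    (F : ι → Matrix (Fin d) (Fin d) R) (hF : ∀ x ∈ s, SLaux_Good P N S m r l (F x)) :
    SLaux_Good P N S m r (l * s.card) (∑ x ∈ s, F x) := by
  classical
  induction s using Finset.induction_on with
  | empty => simpa using SLaux_good_zero P N S m r 0
  | insert a s ha ih =>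
    rw [Finset.sum_insert ha, Finset.card_insert_of_notMem ha, mul_add, mul_one, add_comm (l * _)]
    exact SLaux_good_add P N S hr (hF a (Finset.mem_insert_self _ _))
      (ih fun x hx => hF x (Finset.mem_insert_of_mem hx))

theorem SLaux_step {i j l : ℕ} (hij : i ≤ j) (o : Fin d) (hA : SLaux_A P N S (i + j) l)
    (hoff : ∀ s t : Fin d, s ≠ t → ∀ x, SLaux_Gen P i j (single s t x)) :
    SLaux_A P N S (i + j + i) (l * (1 + 4 * (d * d))) := by
  intro g
  obtain ⟨t, ht, Z, hZ⟩ := hA g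
  -- t⁻¹ g = 1 + P ^ m X
  set h : SpecialLinearGroup (Fin d) R := t⁻¹ * g with hh
  obtain ⟨X, hX⟩ : ∃ X, (h : Matrix (Fin d) (Fin d) R) = 1 + P ^ (i + j) • X := by
    refine ⟨-((t⁻¹ : SpecialLinearGroup (Fin d) R) : Matrix (Fin d) (Fin d) R) * Z, ?_⟩
    have h1 : (h : Matrix (Fin d) (Fin d) R) =
      ((t⁻¹ : SpecialLinearGroup (Fin d) R) : Matrix (Fin d) (Fin d) R) * g := rfl
    have h2 : ((t⁻¹ : SpecialLinearGroup (Fin d) R) : Matrix (Fin d) (Fin d) R) * t = 1 :=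
      congrArg Subtype.val (inv_mul_cancel t)
    rw [h1, eq_sub_of_add_eq hZ.symm, mul_sub, h2, mul_smul_comm, neg_mul, smul_neg,
      sub_eq_add_neg]
  obtain ⟨q, hq⟩ : ∃ q, P ^ (i + j) * trace X = P ^ (i + j + i) * q := by
    have h1 := det_one_add_smul (P ^ (i + j)) X
    rw [← hX, show det (h : Matrix (Fin d) (Fin d) R) = 1 from h.2] at h1
    obtain ⟨e, he⟩ : ∃ e : R, e = (det (1 + (Polynomial.X : Polynomial R) •
      X.map Polynomial.C)).divX.divX.eval (P ^ (i + j)) := ⟨_, rfl⟩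
    rw [← he] at h1
    refine ⟨-(e * P ^ j), ?_⟩
    rw [pow_add] at h1 ⊢
    rw [pow_add (P)]
    linear_combination (-1 : R) * h1
  set F : Fin d × Fin d → Matrix (Fin d) (Fin d) R := fun x =>
    if x.1 = x.2 then single x.1 x.1 (X x.1 x.1) - single o o (X x.1 x.1)
    else single x.1 x.2 (X x.1 x.2) with hF
  have hsum : X = ∑ x, F x + single o o (trace X) := by
    have h1 : ∀ x : Fin d × Fin d, F x = single x.1 x.2 (X x.1 x.2) -
        (if x.1 = x.2 then single o o (X x.1 x.1) else 0) := by
      rintro ⟨a, b⟩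
      by_cases hab : a = b
      · subst hab; simp [hF]
      · simp [hF, hab]
    simp_rw [h1]
    rw [Finset.sum_sub_distrib, Fintype.sum_prod_type, Fintype.sum_prod_type]
    simp only [Finset.sum_ite_eq, Finset.mem_univ, if_true]
    rw [← matrix_eq_sum_single X]
    have : ∑ a, single o o (X a a) = single o o (trace X) := by
      simp only [trace, diag_apply]
      exact (map_sum (singleAddMonoidHom (α := R) o o) (fun a => X a a) _).symm
    rw [this, sub_add_cancel]
  have hgood := SLaux_good_sum P N S (m := i + j) (r := i + j + i) (l := 4 * l) (by omega)
    Finset.univ F (by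
      rintro ⟨a, b⟩ -
      by_cases hab : a = b
      · subst hab
        by_cases hao : a = o
        · subst hao
          simpa [hF] using SLaux_good_zero P N S _ _ _
        · simp only [hF, if_true]
          exact SLaux_good_of_gen P N S hij hA (SLaux_gen_diag P i j a o hao _)
      · simp only [hF, if_neg hab]
        exact SLaux_good_of_gen P N S hij hA (hoff a b hab _))
  obtain ⟨w, hw, Y, hY⟩ := hgood
  rw [Finset.card_univ, Fintype.card_prod, Fintype.card_fin] at hw
  refine ⟨t * w, SLaux_T_mono N S (le_of_eq (by ring)) (SLaux_T_mul N S ht hw),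
    t * (Y - single o o q), ?_⟩
  have h1 : (w : Matrix (Fin d) (Fin d) R) = h + P ^ (i + j + i) • (Y - single o o q) := by
    have h3 : P ^ (i + j) • single o o (trace X) = P ^ (i + j + i) • single o o q := by
      rw [smul_single, smul_single, smul_eq_mul, smul_eq_mul, hq]
    rw [hX, hY]
    have h5 : P ^ (i + j) • X = P ^ (i + j) • ∑ x, F x + P ^ (i + j + i) • single o o q := by
      rw [← h3, ← smul_add, ← hsum]
    rw [h5, smul_sub]
    abel
  have h2 : ((t * w : SpecialLinearGroup (Fin d) R) : Matrix (Fin d) (Fin d) R) =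
    (t : Matrix (Fin d) (Fin d) R) * w := rfl
  have h4 : (t : Matrix (Fin d) (Fin d) R) * h = g :=
    congrArg Subtype.val (show t * h = g by rw [hh, mul_inv_cancel_left])
  rw [h2, h1, mul_add, h4, mul_smul_comm]

theorem SLaux_iter (o : Fin d) (c e : ℕ) (he : (1 + 4 * (d * d)) * 4 ^ e ≤ 5 ^ e)
    (hoff : ∀ i j, 1 ≤ i → ∀ s t : Fin d, s ≠ t → ∀ x, SLaux_Gen P i j (single s t x))
    (h2 : SLaux_A P N S 2 c) (n : ℕ) (hn : 1 ≤ n) : SLaux_A P N S n (c * n ^ e) := by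
  induction n using Nat.strong_induction_on with
  | _ n ih =>
    by_cases hn2 : n ≤ 2
    · exact SLaux_A_mono P N S hn2 (Nat.le_mul_of_pos_right _ (by positivity)) h2
    · obtain ⟨m, hm⟩ : ∃ m, m = n - n / 3 := ⟨_, rfl⟩
      have h := ih m (by omega) (by omega)
      obtain ⟨i, hi⟩ : ∃ i, i = m / 2 := ⟨_, rfl⟩
      obtain ⟨j, hj⟩ : ∃ j, j = m - i := ⟨_, rfl⟩
      have hmij : m = i + j := by omega
      rw [hmij] at h
      have h' := SLaux_step P N S (i := i) (j := j) (by omega) o h (hoff i j (by omega))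
      refine SLaux_A_mono P N S (by omega) ?_ h'
      rw [← hmij]
      have h5 : (5 * m) ^ e ≤ (4 * n) ^ e := Nat.pow_le_pow_left (by omega) e
      rw [mul_pow, mul_pow] at h5
      have h4 : 0 < 4 ^ e := by positivity
      have h6 : m ^ e * (1 + 4 * (d * d)) ≤ n ^ e := by
        refine Nat.le_of_mul_le_mul_left ?_ h4
        calc 4 ^ e * (m ^ e * (1 + 4 * (d * d))) = ((1 + 4 * (d * d)) * 4 ^ e) * m ^ e := by ring
          _ ≤ 5 ^ e * m ^ e := Nat.mul_le_mul_right _ he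
          _ ≤ _ := h5
      rw [mul_assoc]
      exact Nat.mul_le_mul_left _ h6

end step

/-- **Theorem 1.5 for `SL_d` (classical case of Theorem 1.5).**
Let `p` be a prime and `R` a commutative unital Noetherian local domain with
principal maximal ideal `M = (P)`, complete in the `M`-adic topology, with finite
residue field of characteristic `p`.  Let `d ≥ 2` and assume `d ≥ 3`, or `d = 2`
and `p ≥ 3`.  Then each quotient `SL_d(R)/K_n` by the congruence subgroups `K_n`
is finite and there are `C₁, C₂ > 0` such that for every `n ≥ 1` and every
generating set `S` of `SL_d(R)/K_n`, every element of `SL_d(R)/K_n` is a product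
of at most `C₁ · n^{C₂}` elements of `S ∪ S⁻¹ ∪ {1}`. -/
theorem SL_congruence_diameter_bound
    (p : ℕ) (hp : p.Prime)
    {R : Type*} [CommRing R] [IsDomain R] [IsNoetherianRing R] [IsLocalRing R]
    (P : R) (hP : IsLocalRing.maximalIdeal R = Ideal.span {P})
    [IsAdicComplete (IsLocalRing.maximalIdeal R) R]
    [Finite (IsLocalRing.ResidueField R)] [CharP (IsLocalRing.ResidueField R) p]
    (d : ℕ) (hd : 2 ≤ d) (hdp : 3 ≤ d ∨ (d = 2 ∧ 3 ≤ p)) :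
    (∀ n, 1 ≤ n →
      Finite (Matrix.SpecialLinearGroup (Fin d) R ⧸ SLcongruence d R n)) ∧
    ∃ C₁ C₂ : ℝ, 0 < C₁ ∧ 0 < C₂ ∧ ∀ n, 1 ≤ n →
      ∀ S : Set (Matrix.SpecialLinearGroup (Fin d) R ⧸ SLcongruence d R n),
        Subgroup.closure S = ⊤ →
        ∀ x, ∃ L : List (Matrix.SpecialLinearGroup (Fin d) R ⧸ SLcongruence d R n),
          (∀ y ∈ L, y ∈ S ∪ S⁻¹ ∪ {1}) ∧
          (L.length : ℝ) ≤ C₁ * (n : ℝ) ^ C₂ ∧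
          L.prod = x := by
  classical
  refine ⟨fun n _ => SLaux_finite d R n, ?_⟩
  have hfin := SLaux_finite d R
  obtain ⟨c1, hc1⟩ := SLaux_bound (Matrix.SpecialLinearGroup (Fin d) R ⧸ SLcongruence d R 1)
  obtain ⟨c2, hc2⟩ := SLaux_bound (Matrix.SpecialLinearGroup (Fin d) R ⧸ SLcongruence d R 2)
  obtain ⟨e, he⟩ : ∃ e : ℕ, (1 + 4 * (d * d)) * 4 ^ e ≤ 5 ^ e := by
    obtain ⟨e, he⟩ := pow_unbounded_of_one_lt ((1 + 4 * (d * d) : ℕ) : ℝ)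
      (show (1 : ℝ) < 5 / 4 by norm_num)
    refine ⟨e, ?_⟩
    rw [div_pow, lt_div_iff₀ (by positivity)] at he
    exact_mod_cast he.le
  have hPmem : P ∈ IsLocalRing.maximalIdeal R := by
    rw [hP]; exact Ideal.mem_span_singleton_self P
  have hoff : ∀ i j, 1 ≤ i → ∀ s t : Fin d, s ≠ t → ∀ x,
      SLaux_Gen P i j (Matrix.single s t x) := by
    intro i j hi s t hst x
    rcases hdp with h3 | ⟨rfl, hp3⟩
    · exact SLaux_gen_off3 P i j s t hst h3 x
    · refine SLaux_gen_off2 P hPmem ?_ i j hi s t hst x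
      by_contra h2
      have h2' : (2 : R) ∈ IsLocalRing.maximalIdeal R := h2
      have h0 : ((2 : ℕ) : IsLocalRing.ResidueField R) = 0 := by
        have := (IsLocalRing.residue_eq_zero_iff (2 : R)).2 h2'
        rw [map_ofNat] at this
        exact_mod_cast this
      have := (CharP.cast_eq_zero_iff (IsLocalRing.ResidueField R) p 2).1 h0
      have := Nat.le_of_dvd (by norm_num) this
      omega
  have hanti : ∀ a b : ℕ, a ≤ b → SLcongruence d R b ≤ SLcongruence d R a := by
    intro a b hab g hg
    have h1 := (SLaux_mem P hP b 1 g).1 (by simpa using hg)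
    have h2 := (SLaux_mem P hP a 1 g).2 (by
      obtain ⟨Z, hZ⟩ := h1
      refine ⟨P ^ (b - a) • Z, ?_⟩
      rw [hZ, smul_smul, ← pow_add, Nat.add_sub_cancel' hab])
    simpa using h2
  refine ⟨((c1 + c2 + 1 : ℕ) : ℝ), ((e + 1 : ℕ) : ℝ), by positivity, by positivity, ?_⟩
  intro n hn S hS x
  have hbase : ∀ k c, k ≤ n → (∀ S : Set (Matrix.SpecialLinearGroup (Fin d) R ⧸ SLcongruence d R k),
      Subgroup.closure S = ⊤ → ∀ x, ∃ L : List (Matrix.SpecialLinearGroup (Fin d) R ⧸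
        SLcongruence d R k), (∀ y ∈ L, y ∈ S ∪ S⁻¹ ∪ {1}) ∧ L.length ≤ c ∧ L.prod = x) →
      SLaux_A P (SLcongruence d R n) S k c := by
    intro k c hk hc g
    obtain ⟨t, ht, htk⟩ := SLaux_base (SLcongruence d R n) S (SLcongruence d R k)
      (hanti k n hk) c hc hS g
    exact ⟨t, ht, (SLaux_mem P hP k g t).1 htk⟩
  have hmain : SLaux_A P (SLcongruence d R n) S n ((c1 + c2 + 1) * n ^ e) := by
    rcases Nat.lt_or_ge n 2 with h | h
    · have h1 : n = 1 := by omega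
      subst h1
      exact SLaux_A_mono P _ S le_rfl (by rw [one_pow]; omega) (hbase 1 c1 le_rfl hc1)
    · exact SLaux_iter P _ S ⟨0, by omega⟩ _ e he hoff
        (SLaux_A_mono P _ S le_rfl (by omega) (hbase 2 c2 h hc2)) n hn
  obtain ⟨g, rfl⟩ := QuotientGroup.mk_surjective x
  obtain ⟨t, ⟨L, hL1, hL2, hL3⟩, hZ⟩ := hmain g
  refine ⟨L, hL1, ?_, ?_⟩
  · rw [Real.rpow_natCast]
    have h1 : L.length ≤ (c1 + c2 + 1) * n ^ (e + 1) :=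
      hL2.trans (Nat.mul_le_mul_left _ (Nat.pow_le_pow_right hn (by omega)))
    exact_mod_cast h1
  · rw [hL3, eq_comm, QuotientGroup.eq]
    exact (SLaux_mem P hP n g t).2 hZ
end

section
/- Let p ≥ 3 be a prime and let R be a commutative unital Noetherian local integral domain whose maximal ideal M is principal with generator P, which is complete with respect to the M-adic topology (i.e., R is a complete discrete valuation ring), and whose residue field R/M is finite of characteristic p. Let g ≥ 1, d = 2g, Ω = [[0, I_g],[−I_g, 0]], and let G = Sp_d(R) = { A ∈ M_d(R) : Aᵀ·Ω·A = Ω }. For n ≥ 1 let K_n = { A ∈ G : every entry of A − I lies in Mⁿ }. Then each quotient G/K_n is finite, and there exist real constants C₁, C₂ > 0 such that for every n ≥ 1 and every generating set S of G/K_n, every element of G/K_n is a product of at most C₁·n^{C₂} elements of S ∪ S⁻¹ ∪ {1}. -/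
open Matrix


/-- The matrix `Ω = [[0, 1], [−1, 0]]` defining the symplectic form. -/
def sympOmega (g : ℕ) (R : Type*) [CommRing R] :
    Matrix (Fin g ⊕ Fin g) (Fin g ⊕ Fin g) R :=
  Matrix.fromBlocks 0 1 (-1) 0

/-- The symplectic group `Sp_{2g}(R) = {A : AᵀΩA = Ω}`, realised as a subgroup of
the units of the matrix ring. -/
def SpGroup (g : ℕ) (R : Type*) [CommRing R] :
    Subgroup (Matrix (Fin g ⊕ Fin g) (Fin g ⊕ Fin g) R)ˣ where
  carrier := {A | (A : Matrix (Fin g ⊕ Fin g) (Fin g ⊕ Fin g) R)ᵀ * sympOmega g R *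
    (A : Matrix (Fin g ⊕ Fin g) (Fin g ⊕ Fin g) R) = sympOmega g R}
  one_mem' := by simp
  mul_mem' := by
    intro a b ha hb
    show ((a * b : (Matrix (Fin g ⊕ Fin g) (Fin g ⊕ Fin g) R)ˣ) :
        Matrix (Fin g ⊕ Fin g) (Fin g ⊕ Fin g) R)ᵀ * sympOmega g R *
      ((a * b : (Matrix (Fin g ⊕ Fin g) (Fin g ⊕ Fin g) R)ˣ) :
        Matrix (Fin g ⊕ Fin g) (Fin g ⊕ Fin g) R) = sympOmega g R
    rw [Units.val_mul, Matrix.transpose_mul]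
    calc (b : Matrix (Fin g ⊕ Fin g) (Fin g ⊕ Fin g) R)ᵀ *
          (a : Matrix (Fin g ⊕ Fin g) (Fin g ⊕ Fin g) R)ᵀ * sympOmega g R *
          ((a : Matrix (Fin g ⊕ Fin g) (Fin g ⊕ Fin g) R) *
            (b : Matrix (Fin g ⊕ Fin g) (Fin g ⊕ Fin g) R))
        = (b : Matrix (Fin g ⊕ Fin g) (Fin g ⊕ Fin g) R)ᵀ *
          ((a : Matrix (Fin g ⊕ Fin g) (Fin g ⊕ Fin g) R)ᵀ * sympOmega g R *
            (a : Matrix (Fin g ⊕ Fin g) (Fin g ⊕ Fin g) R)) *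
          (b : Matrix (Fin g ⊕ Fin g) (Fin g ⊕ Fin g) R) := by noncomm_ring
      _ = sympOmega g R := by rw [ha, hb]
  inv_mem' := by
    intro a ha
    show ((a⁻¹ : (Matrix (Fin g ⊕ Fin g) (Fin g ⊕ Fin g) R)ˣ) :
        Matrix (Fin g ⊕ Fin g) (Fin g ⊕ Fin g) R)ᵀ * sympOmega g R *
      ((a⁻¹ : (Matrix (Fin g ⊕ Fin g) (Fin g ⊕ Fin g) R)ˣ) :
        Matrix (Fin g ⊕ Fin g) (Fin g ⊕ Fin g) R) = sympOmega g R
    have key : ((a : Matrix (Fin g ⊕ Fin g) (Fin g ⊕ Fin g) R) *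
        ((a⁻¹ : (Matrix (Fin g ⊕ Fin g) (Fin g ⊕ Fin g) R)ˣ) :
          Matrix (Fin g ⊕ Fin g) (Fin g ⊕ Fin g) R)) = 1 := by
      rw [← Units.val_mul, mul_inv_cancel, Units.val_one]
    calc ((a⁻¹ : (Matrix (Fin g ⊕ Fin g) (Fin g ⊕ Fin g) R)ˣ) :
          Matrix (Fin g ⊕ Fin g) (Fin g ⊕ Fin g) R)ᵀ * sympOmega g R *
        ((a⁻¹ : (Matrix (Fin g ⊕ Fin g) (Fin g ⊕ Fin g) R)ˣ) :
          Matrix (Fin g ⊕ Fin g) (Fin g ⊕ Fin g) R)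
        = ((a⁻¹ : (Matrix (Fin g ⊕ Fin g) (Fin g ⊕ Fin g) R)ˣ) :
          Matrix (Fin g ⊕ Fin g) (Fin g ⊕ Fin g) R)ᵀ *
          ((a : Matrix (Fin g ⊕ Fin g) (Fin g ⊕ Fin g) R)ᵀ * sympOmega g R *
            (a : Matrix (Fin g ⊕ Fin g) (Fin g ⊕ Fin g) R)) *
          ((a⁻¹ : (Matrix (Fin g ⊕ Fin g) (Fin g ⊕ Fin g) R)ˣ) :
            Matrix (Fin g ⊕ Fin g) (Fin g ⊕ Fin g) R) := by rw [ha]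
      _ = ((a : Matrix (Fin g ⊕ Fin g) (Fin g ⊕ Fin g) R) *
            ((a⁻¹ : (Matrix (Fin g ⊕ Fin g) (Fin g ⊕ Fin g) R)ˣ) :
              Matrix (Fin g ⊕ Fin g) (Fin g ⊕ Fin g) R))ᵀ * sympOmega g R *
          ((a : Matrix (Fin g ⊕ Fin g) (Fin g ⊕ Fin g) R) *
            ((a⁻¹ : (Matrix (Fin g ⊕ Fin g) (Fin g ⊕ Fin g) R)ˣ) :
              Matrix (Fin g ⊕ Fin g) (Fin g ⊕ Fin g) R)) := by
            rw [Matrix.transpose_mul]; noncomm_ring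
      _ = sympOmega g R := by rw [key]; simp

/-- The `n`-th congruence subgroup of `Sp_{2g}(R)`: matrices `A` in the symplectic
group with all entries of `A − I` in `Mⁿ` (the kernel of entrywise reduction
modulo `Mⁿ`). -/
def Spcongruence (g : ℕ) (R : Type*) [CommRing R] [IsLocalRing R] (n : ℕ) :
    Subgroup (SpGroup g R) :=
  MonoidHom.ker
    (MonoidHom.comp
      (Units.map
        (RingHom.toMonoidHom
          ((Ideal.Quotient.mk ((IsLocalRing.maximalIdeal R) ^ n)).mapMatrix :
            Matrix (Fin g ⊕ Fin g) (Fin g ⊕ Fin g) R →+*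
              Matrix (Fin g ⊕ Fin g) (Fin g ⊕ Fin g)
                (R ⧸ (IsLocalRing.maximalIdeal R) ^ n))))
      (SpGroup g R).subtype)

instance Spcongruence.normal (g : ℕ) (R : Type*) [CommRing R] [IsLocalRing R]
    (n : ℕ) : (Spcongruence g R n).Normal := by
  unfold Spcongruence
  infer_instance

section SpAux

open scoped Pointwise

variable {R : Type*} [CommRing R] {g : ℕ}

lemma spaux_omega_sq : sympOmega g R * sympOmega g R = -1 := by
  simp [sympOmega, Matrix.fromBlocks_multiply, ← Matrix.fromBlocks_one, Matrix.fromBlocks_neg]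

lemma spaux_omega_transpose : (sympOmega g R)ᵀ = - sympOmega g R := by
  simp [sympOmega, Matrix.fromBlocks_transpose, Matrix.fromBlocks_neg]

/-- The bilinear form. -/
def spForm (v w : Fin g ⊕ Fin g → R) : R := v ⬝ᵥ (sympOmega g R *ᵥ w)

lemma spForm_swap (v w : Fin g ⊕ Fin g → R) : spForm v w = - spForm w v := by
  unfold spForm
  rw [Matrix.dotProduct_mulVec, ← Matrix.mulVec_transpose, spaux_omega_transpose, dotProduct_comm]
  simp [Matrix.neg_mulVec]

lemma spForm_self (v : Fin g ⊕ Fin g → R) : spForm v v = 0 := by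
  simp [spForm, sympOmega, dotProduct, Matrix.mulVec, Matrix.fromBlocks, Matrix.one_apply, mul_comm]

lemma spForm_add (u v w : Fin g ⊕ Fin g → R) : spForm u (v + w) = spForm u v + spForm u w := by
  simp [spForm, Matrix.mulVec_add]

/-- The nilpotent `v vᵀ Ω`. -/
def spNil (v w : Fin g ⊕ Fin g → R) : Matrix (Fin g ⊕ Fin g) (Fin g ⊕ Fin g) R :=
  Matrix.vecMulVec v w * sympOmega g R

lemma spNil_mul (u v w x : Fin g ⊕ Fin g → R) :
    spNil u v * spNil w x = spForm v w • spNil u x := by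
  unfold spNil spForm
  rw [Matrix.mul_assoc, ← Matrix.mul_assoc (sympOmega g R), Matrix.mul_vecMulVec,
    ← Matrix.mul_assoc, Matrix.vecMulVec_mul_vecMulVec, Matrix.vecMulVec_smul,
    Matrix.smul_mul]

lemma spNil_transpose (v : Fin g ⊕ Fin g → R) :
    (spNil v v)ᵀ * sympOmega g R = - (sympOmega g R * spNil v v) := by
  unfold spNil
  rw [Matrix.transpose_mul, spaux_omega_transpose, Matrix.transpose_vecMulVec]
  simp [Matrix.mul_assoc]

lemma spNil_sq (v : Fin g ⊕ Fin g → R) : spNil v v * spNil v v = 0 := by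
  rw [spNil_mul, spForm_self, zero_smul]

/-- Symplectic transvection. -/
def spTrans (c : R) (v : Fin g ⊕ Fin g → R) : SpGroup g R :=
  ⟨⟨1 + c • spNil v v, 1 - c • spNil v v, by
      have := spNil_sq v
      simp [mul_add, add_mul, mul_sub, sub_mul, this], by
      have := spNil_sq v
      simp [mul_add, add_mul, mul_sub, sub_mul, this]⟩, by
    change (1 + c • spNil v v)ᵀ * sympOmega g R * (1 + c • spNil v v) = sympOmega g R
    have h1 := spNil_sq v
    have h2 := spNil_transpose v
    rw [Matrix.transpose_add, Matrix.transpose_smul, Matrix.transpose_one, add_mul,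
      smul_mul_assoc, h2, one_mul]
    simp [mul_add, add_mul, Matrix.mul_assoc, h1]⟩

/-- The underlying matrix, as a monoid homomorphism. -/
def spVal : SpGroup g R →* Matrix (Fin g ⊕ Fin g) (Fin g ⊕ Fin g) R :=
  (Units.coeHom _).comp (SpGroup g R).subtype

lemma spTrans_val (c : R) (v : Fin g ⊕ Fin g → R) :
    spVal (spTrans c v) = 1 + c • spNil v v := rfl

lemma spNil_bracket (v w : Fin g ⊕ Fin g → R) :
    spNil v v * spNil w w - spNil w w * spNil v v = spForm v w • (spNil v w + spNil w v) := by
  rw [spNil_mul, spNil_mul, spForm_swap w v, smul_add, neg_smul, sub_neg_eq_add]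

lemma spNil_add_right (u v w : Fin g ⊕ Fin g → R) : spNil u (v + w) = spNil u v + spNil u w := by
  simp [spNil, Matrix.vecMulVec_add, add_mul]

lemma spNil_add_left (u v w : Fin g ⊕ Fin g → R) : spNil (v + w) u = spNil v u + spNil w u := by
  simp [spNil, Matrix.add_vecMulVec, add_mul]

variable [IsLocalRing R]

lemma mem_Spcongruence_iff {P : R} (hP : IsLocalRing.maximalIdeal R = Ideal.span {P}) (k : ℕ)
    (A : SpGroup g R) : A ∈ Spcongruence g R k ↔
      ∃ X : Matrix (Fin g ⊕ Fin g) (Fin g ⊕ Fin g) R,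
        spVal A = 1 + P ^ k • X := by
  unfold Spcongruence
  rw [MonoidHom.mem_ker, Units.ext_iff]
  change (Ideal.Quotient.mk (IsLocalRing.maximalIdeal R ^ k)).mapMatrix
    (spVal A) = 1 ↔ _
  rw [← map_one (Ideal.Quotient.mk (IsLocalRing.maximalIdeal R ^ k)).mapMatrix]
  constructor
  · intro h
    have h' : ∀ i j, ∃ x, spVal A i j =
        (1 : Matrix (Fin g ⊕ Fin g) (Fin g ⊕ Fin g) R) i j + P ^ k * x := by
      intro i j
      have := congrFun (congrFun h i) j
      simp only [RingHom.mapMatrix_apply, Matrix.map_apply] at this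
      rw [Ideal.Quotient.eq, hP, Ideal.span_singleton_pow, Ideal.mem_span_singleton] at this
      obtain ⟨x, hx⟩ := this
      exact ⟨x, by rw [← hx]; ring⟩
    choose X hX using h'
    exact ⟨Matrix.of X, by ext i j; simp [hX]⟩
  · rintro ⟨X, hX⟩
    rw [hX]
    ext i j
    simp only [RingHom.mapMatrix_apply, Matrix.map_apply]
    rw [Ideal.Quotient.eq, hP, Ideal.span_singleton_pow, Ideal.mem_span_singleton]
    exact ⟨X i j, by simp⟩

lemma Spcongruence_finite [IsNoetherianRing R] [Finite (IsLocalRing.ResidueField R)] (n : ℕ) :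
    Finite (SpGroup g R ⧸ Spcongruence g R n) := by
  have : Finite (R ⧸ IsLocalRing.maximalIdeal R) := ‹Finite (IsLocalRing.ResidueField R)›
  have : Finite (R ⧸ IsLocalRing.maximalIdeal R ^ n) :=
    Ideal.finite_quotient_pow (IsNoetherian.noetherian _) n
  exact Finite.of_injective _ (QuotientGroup.kerLift_injective _)

/-- Uniform bound for a fixed finite quotient. -/
lemma spaux_base {G : Type*} [Group G] (K : Subgroup G) [K.Normal] [Finite (G ⧸ K)] :
    ∃ N : ℕ, 1 ≤ N ∧ ∀ T : Set G, Subgroup.closure T = ⊤ → T⁻¹ = T → (1 : G) ∈ T →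
      ∀ x : G, ∃ w ∈ T ^ N, w⁻¹ * x ∈ K := by
  classical
  have key : ∀ q : Set (G ⧸ K) × (G ⧸ K), ∃ N : ℕ, ∀ T : Set G, Subgroup.closure T = ⊤ → T⁻¹ = T →
      (QuotientGroup.mk '' T) = q.1 → ∃ w ∈ T ^ N, (w : G ⧸ K) = q.2 := by
    rintro ⟨U, y⟩
    by_cases hT : ∃ T : Set G, Subgroup.closure T = ⊤ ∧ T⁻¹ = T ∧ (QuotientGroup.mk '' T) = U
    · obtain ⟨T, hT1, hT2, hT3⟩ := hT
      obtain ⟨x, rfl⟩ := QuotientGroup.mk_surjective y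
      have hx : x ∈ Submonoid.closure T := by
        have : x ∈ (Subgroup.closure T).toSubmonoid := by rw [hT1]; trivial
        rwa [Subgroup.closure_toSubmonoid, hT2, Set.union_self] at this
      obtain ⟨L, hL, hLx⟩ := Submonoid.exists_list_of_mem_closure hx
      have gen : ∀ L : List G, (∀ y ∈ L, y ∈ T) → (L.prod : G ⧸ K) ∈ U ^ L.length := by
        intro L
        induction L with
        | nil => intro _; simp
        | cons a L ih =>
          intro h
          rw [List.prod_cons, List.length_cons, pow_succ', QuotientGroup.mk_mul]
          refine Set.mul_mem_mul ?_ (ih fun y hy => h y (List.mem_cons_of_mem _ hy))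
          rw [← hT3]
          exact ⟨a, h a List.mem_cons_self, rfl⟩
      refine ⟨L.length, fun T' _ _ h3 => ?_⟩
      have := gen L hL
      simp only at h3
      rw [← h3, hLx] at this
      have e : (QuotientGroup.mk '' T' : Set (G ⧸ K)) = (QuotientGroup.mk' K) '' T' := rfl
      rw [e, ← Set.image_pow] at this
      obtain ⟨w, hw, hwx⟩ := this
      exact ⟨w, hw, hwx⟩
    · exact ⟨0, fun T h1 h2 h3 => (hT ⟨T, h1, h2, h3⟩).elim⟩
  choose N hN using key
  obtain ⟨B, hB⟩ := (Set.finite_range N).bddAbove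
  refine ⟨B + 1, by omega, fun T h1 h2 h3 x => ?_⟩
  obtain ⟨w, hw, hwx⟩ := hN (QuotientGroup.mk '' T, (x : G ⧸ K)) T h1 h2 rfl
  have := hB ⟨(QuotientGroup.mk '' T, (x : G ⧸ K)), rfl⟩
  exact ⟨w, Set.pow_subset_pow_right h3 (by omega) hw, QuotientGroup.eq.1 hwx⟩

lemma Spcongruence_anti {P : R} (hP : IsLocalRing.maximalIdeal R = Ideal.span {P}) {k l : ℕ}
    (h : k ≤ l) : Spcongruence g R l ≤ Spcongruence g R k := by
  intro A hA
  rw [mem_Spcongruence_iff hP] at hA ⊢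
  obtain ⟨X, hX⟩ := hA
  refine ⟨P ^ (l - k) • X, ?_⟩
  rw [hX, smul_smul, ← pow_add, Nat.add_sub_cancel' h]

lemma spaux_comm {P : R} (hP : IsLocalRing.maximalIdeal R = Ideal.span {P}) {s t : ℕ}
    (hst : s ≤ t) (a b : SpGroup g R) (U W X Y : Matrix (Fin g ⊕ Fin g) (Fin g ⊕ Fin g) R)
    (ha : spVal a = 1 + P ^ s • (U + P ^ s • X)) (hb : spVal b = 1 + P ^ t • (W + P ^ s • Y)) :
    ∃ E, spVal (a * b * (a⁻¹ * b⁻¹)) =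
      1 + P ^ (s + t) • (U * W - W * U) + P ^ (s + t + s) • E := by
  have ha' : a ∈ Spcongruence g R s := (mem_Spcongruence_iff hP _ _).2 ⟨_, ha⟩
  have hb' : b ∈ Spcongruence g R s :=
    Spcongruence_anti hP hst ((mem_Spcongruence_iff hP _ _).2 ⟨_, hb⟩)
  obtain ⟨F, hF⟩ := (mem_Spcongruence_iff hP _ _).1 (inv_mem (mul_mem hb' ha'))
  have h1 : spVal (b * a) * spVal (b * a)⁻¹ = 1 := by rw [← map_mul, mul_inv_cancel, map_one]
  have h2 : spVal (a * b * (a⁻¹ * b⁻¹)) = 1 +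
      (spVal a * spVal b - spVal b * spVal a) * spVal (b * a)⁻¹ := by
    rw [← _root_.mul_inv_rev, map_mul spVal, sub_mul, ← map_mul spVal b a, h1, map_mul spVal a b]
    abel
  have h3 : spVal a * spVal b - spVal b * spVal a = P ^ (s + t) •
      ((U * W - W * U) + P ^ s • (U * Y + X * W + P ^ s • (X * Y) -
        (Y * U + W * X + P ^ s • (Y * X)))) := by
    rw [ha, hb]
    simp only [mul_add, add_mul, mul_one, one_mul, smul_add, smul_sub, smul_mul_assoc,
      mul_smul_comm, smul_smul, pow_add]
    module
  rw [h2, h3, hF]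
  refine ⟨(U * Y + X * W + P ^ s • (X * Y) - (Y * U + W * X + P ^ s • (Y * X))) +
    (U * W - W * U) * F + P ^ s • ((U * Y + X * W + P ^ s • (X * Y) -
        (Y * U + W * X + P ^ s • (Y * X))) * F), ?_⟩
  generalize (U * Y + X * W + P ^ s • (X * Y) - (Y * U + W * X + P ^ s • (Y * X))) = D
  generalize U * W - W * U = C
  simp only [mul_add, add_mul, mul_one, one_mul, smul_add, smul_mul_assoc,
      mul_smul_comm, smul_smul, pow_add]
  module

/-- `1 + P^m X` is, modulo `P^(m+s)`, an element of `T^N`. -/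
def spQ (P : R) (T : Set (SpGroup g R)) (m s : ℕ)
    (X : Matrix (Fin g ⊕ Fin g) (Fin g ⊕ Fin g) R) (N : ℕ) : Prop :=
  ∃ y ∈ T ^ N, ∃ E, spVal y = 1 + P ^ m • X + P ^ (m + s) • E

lemma spQ_add {P : R} {T : Set (SpGroup g R)} {m s : ℕ} (hsm : s ≤ m)
    {X X' : Matrix (Fin g ⊕ Fin g) (Fin g ⊕ Fin g) R} {N N' : ℕ}
    (h : spQ P T m s X N) (h' : spQ P T m s X' N') : spQ P T m s (X + X') (N + N') := by
  obtain ⟨y, hy, E, hE⟩ := h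
  obtain ⟨y', hy', E', hE'⟩ := h'
  refine ⟨y * y', by rw [pow_add]; exact Set.mul_mem_mul hy hy', ?_⟩
  obtain ⟨r, rfl⟩ := Nat.exists_eq_add_of_le hsm
  refine ⟨E + E' + P ^ r • (X * X') + P ^ (s + r) • (X * E' + E * X') +
    P ^ (s + r + s) • (E * E'), ?_⟩
  rw [map_mul, hE, hE']
  simp only [mul_add, add_mul, mul_one, one_mul, smul_add, smul_mul_assoc,
      mul_smul_comm, smul_smul, pow_add]
  module

lemma spQ_mono {P : R} {T : Set (SpGroup g R)} {m s : ℕ} (h1 : (1 : SpGroup g R) ∈ T)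
    {X : Matrix (Fin g ⊕ Fin g) (Fin g ⊕ Fin g) R} {N N' : ℕ} (hN : N ≤ N')
    (h : spQ P T m s X N) : spQ P T m s X N' := by
  obtain ⟨y, hy, hE⟩ := h
  exact ⟨y, Set.pow_subset_pow_right h1 hN hy, hE⟩

lemma spQ_sum {P : R} {T : Set (SpGroup g R)} {m s : ℕ} (hsm : s ≤ m) {α : Type*}
    (F : Finset α) (f : α → Matrix (Fin g ⊕ Fin g) (Fin g ⊕ Fin g) R) (N : ℕ)
    (h : ∀ a, spQ P T m s (f a) N) : spQ P T m s (∑ a ∈ F, f a) (F.card * N) := by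
  classical
  induction F using Finset.induction_on with
  | empty => exact ⟨1, by simp, 0, by simp⟩
  | insert a F ha ih =>
    rw [Finset.sum_insert ha, Finset.card_insert_of_notMem ha, add_mul, one_mul, add_comm (_ * _)]
    exact spQ_add hsm (h a) ih

/-- `T^l` covers `G` modulo `K_m`. -/
def spCov (T : Set (SpGroup g R)) (l m : ℕ) : Prop :=
  ∀ x : SpGroup g R, ∃ w ∈ T ^ l, w⁻¹ * x ∈ Spcongruence g R m

lemma spCov_approx {P : R} (hP : IsLocalRing.maximalIdeal R = Ideal.span {P})
    {T : Set (SpGroup g R)} {l m : ℕ} (h : spCov T l m) (x : SpGroup g R) :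
    ∃ w ∈ T ^ l, ∃ E, spVal w = spVal x + P ^ m • E := by
  obtain ⟨w, hw, hx⟩ := h x
  obtain ⟨E, hE⟩ := (mem_Spcongruence_iff hP _ _).1 (inv_mem hx)
  refine ⟨w, hw, spVal x * E, ?_⟩
  have : w = x * (w⁻¹ * x)⁻¹ := by group
  conv_lhs => rw [this, map_mul, hE]
  rw [mul_add, mul_one, mul_smul_comm]

lemma spQ_comm {P : R} (hP : IsLocalRing.maximalIdeal R = Ideal.span {P})
    {T : Set (SpGroup g R)} (hT : T⁻¹ = T) {l s t : ℕ} (hst : s ≤ t) (h : spCov T l (s + t))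
    (A B : SpGroup g R) (U W : Matrix (Fin g ⊕ Fin g) (Fin g ⊕ Fin g) R)
    (hA : spVal A = 1 + P ^ s • U) (hB : spVal B = 1 + P ^ t • W) :
    spQ P T (s + t) s (U * W - W * U) (4 * l) := by
  obtain ⟨a, ha, X, hX⟩ := spCov_approx hP h A
  obtain ⟨b, hb, Y, hY⟩ := spCov_approx hP h B
  obtain ⟨r, rfl⟩ := Nat.exists_eq_add_of_le hst
  have inv : ∀ c ∈ T ^ l, c⁻¹ ∈ T ^ l := by
    intro c hc
    rw [← hT, inv_pow]
    simpa using hc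
  refine ⟨a * b * (a⁻¹ * b⁻¹), ?_, ?_⟩
  · have : 4 * l = (l + l) + (l + l) := by ring
    rw [this, pow_add, pow_add]
    exact Set.mul_mem_mul (Set.mul_mem_mul ha hb) (Set.mul_mem_mul (inv a ha) (inv b hb))
  · refine spaux_comm hP hst a b U W (P ^ r • X) Y ?_ ?_
    · rw [hX, hA]
      simp only [smul_add, smul_smul, pow_add]
      module
    · rw [hY, hB]
      simp only [smul_add, smul_smul, pow_add]
      module

lemma spQ_form {P : R} (hP : IsLocalRing.maximalIdeal R = Ideal.span {P})
    {T : Set (SpGroup g R)} (hT : T⁻¹ = T) {l s t : ℕ} (hst : s ≤ t) (h : spCov T l (s + t))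
    (c : R) (v w : Fin g ⊕ Fin g → R) :
    spQ P T (s + t) s (c • spForm v w • (spNil v w + spNil w v)) (4 * l) := by
  have := spQ_comm hP hT hst h (spTrans (P ^ s) v) (spTrans (P ^ t * c) w) (spNil v v)
    (c • spNil w w) (spTrans_val _ _) (by rw [spTrans_val, smul_smul])
  rwa [mul_smul_comm, smul_mul_assoc, ← smul_sub, spNil_bracket] at this

lemma spForm_single (i j : Fin g ⊕ Fin g) :
    spForm (Pi.single i (1 : R)) (Pi.single j 1) = sympOmega g R i j := by
  simp [spForm]

lemma sympOmega_swap (i : Fin g ⊕ Fin g) :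
    sympOmega g R i i.swap * sympOmega g R i i.swap = 1 := by
  cases i <;> simp [sympOmega]

lemma sympOmega_ne {i j : Fin g ⊕ Fin g} (h : j ≠ i.swap) : sympOmega g R i j = 0 := by
  cases i <;> cases j <;> simp_all [sympOmega, Matrix.one_apply, eq_comm]

lemma spQ_basis {P : R} (hP : IsLocalRing.maximalIdeal R = Ideal.span {P})
    {T : Set (SpGroup g R)} (hT : T⁻¹ = T) (h1 : (1 : SpGroup g R) ∈ T)
    {l s t : ℕ} (hst : s ≤ t) (h : spCov T l (s + t))
    (c : R) (i j : Fin g ⊕ Fin g) :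
    spQ P T (s + t) s (c • (spNil (Pi.single i 1) (Pi.single j 1) +
      spNil (Pi.single j 1) (Pi.single i 1))) (8 * l) := by
  have e := sympOmega_swap (R := R) i
  by_cases hij : j = i.swap
  · subst hij
    have := spQ_form hP hT hst h (c * sympOmega g R i i.swap) (Pi.single i 1) (Pi.single i.swap 1)
    rw [spForm_single, smul_smul, mul_assoc, e, mul_one] at this
    exact spQ_mono h1 (by omega) this
  · have q1 := spQ_form hP hT hst h (c * sympOmega g R i i.swap) (Pi.single i 1)
      (Pi.single j 1 + Pi.single i.swap 1)
    have q2 := spQ_form hP hT hst h (-c * sympOmega g R i i.swap) (Pi.single i 1)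
      (Pi.single i.swap 1)
    rw [spForm_add, spForm_single, spForm_single, sympOmega_ne hij, zero_add, smul_smul, mul_assoc,
      e, mul_one] at q1
    rw [spForm_single, smul_smul, mul_assoc, e, mul_one] at q2
    have q := spQ_add (by omega) q1 q2
    convert q using 1
    · rw [spNil_add_right, spNil_add_left]
      module
    · ring

lemma spaux_decomp (Z : Matrix (Fin g ⊕ Fin g) (Fin g ⊕ Fin g) R) :
    ∑ q : (Fin g ⊕ Fin g) × (Fin g ⊕ Fin g), Z q.1 q.2 •
      (spNil (Pi.single q.1 1) (Pi.single q.2 1) + spNil (Pi.single q.2 1) (Pi.single q.1 1))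
      = (Z + Zᵀ) * sympOmega g R := by
  have h : ∀ Z : Matrix (Fin g ⊕ Fin g) (Fin g ⊕ Fin g) R,
      ∑ i, ∑ j, Z i j • Matrix.vecMulVec (Pi.single i (1 : R)) (Pi.single j (1 : R)) = Z := by
    intro Z
    conv_rhs => rw [Matrix.matrix_eq_sum_single Z]
    simp [← Matrix.single_eq_single_vecMulVec_single]
  have h2 : ∑ i, ∑ j, Z i j • Matrix.vecMulVec (Pi.single j (1 : R)) (Pi.single i (1 : R)) = Zᵀ := by
    rw [Finset.sum_comm]
    exact h Zᵀ
  rw [Fintype.sum_prod_type]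
  simp only [spNil, ← add_mul, ← smul_mul_assoc, ← Finset.sum_mul, smul_add,
    Finset.sum_add_distrib]
  rw [h, h2]

lemma spaux_lie [IsDomain R] {P : R} (hP0 : P ≠ 0) {m : ℕ} (y : SpGroup g R)
    (X : Matrix (Fin g ⊕ Fin g) (Fin g ⊕ Fin g) R) (hy : spVal y = 1 + P ^ m • X)
    (c : R) (hc : c * 2 = 1) :
    ∃ Z E, X = (Z + Zᵀ) * sympOmega g R + P ^ m • E := by
  have hsymp : (spVal y)ᵀ * sympOmega g R * spVal y = sympOmega g R := y.2
  have hsq := spaux_omega_sq (R := R) (g := g)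
  have htr := spaux_omega_transpose (R := R) (g := g)
  set Om := sympOmega g R with hOm
  have k1 : P ^ m • (Xᵀ * Om + Om * X + P ^ m • (Xᵀ * Om * X)) = 0 := by
    rw [hy, Matrix.transpose_add, Matrix.transpose_smul, Matrix.transpose_one] at hsymp
    have e : (1 + P ^ m • Xᵀ) * Om * (1 + P ^ m • X) = Om +
        P ^ m • (Xᵀ * Om + Om * X + P ^ m • (Xᵀ * Om * X)) := by
      simp only [mul_add, add_mul, mul_one, one_mul, smul_add, smul_mul_assoc, mul_smul_comm]
      abel
    rw [e] at hsymp
    simpa using hsymp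
  have k2 : Xᵀ * Om + Om * X + P ^ m • (Xᵀ * Om * X) = 0 :=
    (smul_eq_zero.1 k1).resolve_left (pow_ne_zero _ hP0)
  have k3 : Om * Xᵀ = - (X * Om) + P ^ m • (Om * (Xᵀ * Om * X) * Om) := by
    have := congrArg (fun M => Om * M * Om) k2
    simp only [mul_add, add_mul, mul_smul_comm, smul_mul_assoc, mul_zero, zero_mul] at this
    have e1 : Om * (Xᵀ * Om) * Om = - (Om * Xᵀ) := by
      rw [Matrix.mul_assoc, Matrix.mul_assoc, hsq]; simp
    have e2 : Om * (Om * X) * Om = - (X * Om) := by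
      rw [← Matrix.mul_assoc, hsq]; simp
    rw [e1, e2] at this
    have := sub_eq_zero.2 this
    rw [← sub_eq_zero, ← neg_eq_zero, ← this]
    abel
  refine ⟨-c • (X * Om), -c • ((Om * (Xᵀ * Om * X) * Om) * Om), ?_⟩
  rw [Matrix.transpose_smul, Matrix.transpose_mul, htr, neg_mul, k3]
  simp only [add_mul, smul_mul_assoc, neg_mul, Matrix.mul_assoc X Om Om, hsq, smul_add,
    mul_neg, smul_neg, neg_neg, mul_one]
  have : X = (c * 2) • X := by rw [hc, one_smul]
  conv_lhs => rw [this]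
  module

lemma spCov_step [IsDomain R] {P : R} (hP : IsLocalRing.maximalIdeal R = Ideal.span {P})
    (c : R) (hc : c * 2 = 1)
    {T : Set (SpGroup g R)} (hT : T⁻¹ = T) (h1 : (1 : SpGroup g R) ∈ T)
    {l s t : ℕ} (hst : s ≤ t) (ht : 1 ≤ t) (h : spCov T l (s + t)) :
    spCov T ((8 * (2 * g) ^ 2 + 1) * l) (s + t + s) := by
  intro x
  obtain ⟨w, hw, hx⟩ := h x
  obtain ⟨X, hX⟩ := (mem_Spcongruence_iff hP _ _).1 hx
  by_cases hP0 : P = 0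
  · refine ⟨w, Set.pow_subset_pow_right h1 (by nlinarith) hw, ?_⟩
    refine (mem_Spcongruence_iff hP _ _).2 ⟨X, ?_⟩
    rw [hX, hP0, zero_pow (by omega), zero_pow (by omega)]
  obtain ⟨Z, E, hZ⟩ := spaux_lie hP0 _ X hX c hc
  have q := spQ_sum (P := P) (T := T) (m := s + t) (s := s) (by omega) Finset.univ
    (fun q : (Fin g ⊕ Fin g) × (Fin g ⊕ Fin g) => Z q.1 q.2 •
      (spNil (Pi.single q.1 1) (Pi.single q.2 1) + spNil (Pi.single q.2 1) (Pi.single q.1 1)))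
    (8 * l) (fun q => spQ_basis hP hT h1 hst h _ _ _)
  rw [spaux_decomp] at q
  obtain ⟨y, hy, F, hF⟩ := q
  refine ⟨w * y, ?_, ?_⟩
  · have : (8 * (2 * g) ^ 2 + 1) * l = l +
      (Finset.univ : Finset ((Fin g ⊕ Fin g) × (Fin g ⊕ Fin g))).card * (8 * l) := by
      simp
      ring
    rw [this, pow_add]
    exact Set.mul_mem_mul hw hy
  · have e : (w * y)⁻¹ * x = y⁻¹ * (w⁻¹ * x) := by group
    rw [e]
    refine (mem_Spcongruence_iff hP _ _).2 ⟨spVal y⁻¹ * (P ^ t • E - F), ?_⟩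
    have e2 : spVal (w⁻¹ * x) = spVal y + P ^ (s + t + s) • (P ^ t • E - F) := by
      rw [hX, hF, hZ]
      simp only [smul_add, smul_sub, smul_smul, pow_add]
      module
    rw [map_mul, e2, mul_add, ← map_mul, inv_mul_cancel, map_one, mul_smul_comm]

lemma spCov_anti {P : R} (hP : IsLocalRing.maximalIdeal R = Ideal.span {P})
    {T : Set (SpGroup g R)} {l m m' : ℕ} (hm : m' ≤ m) (h : spCov T l m) : spCov T l m' := by
  intro x
  obtain ⟨w, hw, hx⟩ := h x
  exact ⟨w, hw, Spcongruence_anti hP hm hx⟩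

lemma spCov_double [IsDomain R] {P : R} (hP : IsLocalRing.maximalIdeal R = Ideal.span {P})
    (c : R) (hc : c * 2 = 1)
    {T : Set (SpGroup g R)} (hT : T⁻¹ = T) (h1 : (1 : SpGroup g R) ∈ T)
    {l m : ℕ} (hm : 2 ≤ m) (h : spCov T l m) :
    spCov T ((8 * (2 * g) ^ 2 + 1) ^ 2 * l) (2 * m) := by
  have key : ∀ l m, 2 ≤ m → spCov T l m → spCov T ((8 * (2 * g) ^ 2 + 1) * l) (m + m / 2) := by
    intro l m hm h
    have e : m = m / 2 + (m - m / 2) := by omega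
    have h' := h
    rw [e] at h'
    have := spCov_step hP c hc hT h1 (by omega) (by omega) h'
    rwa [← e] at this
  have := key _ _ (by omega) (key _ _ hm h)
  rw [← mul_assoc, ← pow_two] at this
  exact spCov_anti hP (by omega) this

lemma spCov_pow [IsDomain R] {P : R} (hP : IsLocalRing.maximalIdeal R = Ideal.span {P})
    (c : R) (hc : c * 2 = 1)
    {T : Set (SpGroup g R)} (hT : T⁻¹ = T) (h1 : (1 : SpGroup g R) ∈ T)
    {l : ℕ} (h : spCov T l 2) (k : ℕ) :
    spCov T (((8 * (2 * g) ^ 2 + 1) ^ 2) ^ k * l) (2 ^ (k + 1)) := by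
  induction k with
  | zero => simpa using h
  | succ k ih =>
    have := spCov_double hP c hc hT h1 (by rw [pow_succ]; have := Nat.one_le_two_pow (n := k); omega) ih
    rwa [← mul_assoc, ← pow_succ', ← pow_succ'] at this

end SpAux

section SpAuxMain

open scoped Pointwise

theorem spaux_main
    (p : ℕ) (hp : p.Prime) (hp3 : 3 ≤ p)
    {R : Type*} [CommRing R] [IsDomain R] [IsNoetherianRing R] [IsLocalRing R]
    (P : R) (hP : IsLocalRing.maximalIdeal R = Ideal.span {P})
    [IsAdicComplete (IsLocalRing.maximalIdeal R) R]
    [Finite (IsLocalRing.ResidueField R)] [CharP (IsLocalRing.ResidueField R) p]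
    (g : ℕ) (hg : 1 ≤ g) :
    (∀ n, 1 ≤ n → Finite (SpGroup g R ⧸ Spcongruence g R n)) ∧
    ∃ C₁ C₂ : ℝ, 0 < C₁ ∧ 0 < C₂ ∧ ∀ n, 1 ≤ n →
      ∀ S : Set (SpGroup g R ⧸ Spcongruence g R n),
        Subgroup.closure S = ⊤ →
        ∀ x, ∃ L : List (SpGroup g R ⧸ Spcongruence g R n),
          (∀ y ∈ L, y ∈ S ∪ S⁻¹ ∪ {1}) ∧
          (L.length : ℝ) ≤ C₁ * (n : ℝ) ^ C₂ ∧
          L.prod = x := by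
  refine ⟨fun n _ => Spcongruence_finite n, ?_⟩
  have hfin : Finite (SpGroup g R ⧸ Spcongruence g R 2) := Spcongruence_finite 2
  obtain ⟨N, hN1, hN⟩ := spaux_base (Spcongruence g R 2)
  -- two is invertible
  have h2 : IsUnit (2 : R) := by
    by_contra hu
    have hmem : (2 : R) ∈ IsLocalRing.maximalIdeal R := (IsLocalRing.mem_maximalIdeal _).2 hu
    have h0 : (IsLocalRing.residue R) 2 = 0 := (IsLocalRing.residue_eq_zero_iff _).2 hmem
    have h0' : ((2 : ℕ) : IsLocalRing.ResidueField R) = 0 := by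
      rw [← h0, map_ofNat]; rfl
    have := (CharP.cast_eq_zero_iff (IsLocalRing.ResidueField R) p 2).1 h0'
    have := Nat.le_of_dvd (by norm_num) this
    omega
  obtain ⟨c, hc⟩ := h2.exists_left_inv
  set C : ℕ := (8 * (2 * g) ^ 2 + 1) ^ 2 with hC
  have hCe : C ≤ 2 ^ C := Nat.lt_two_pow_self.le
  have hCpos : 0 < C := by positivity
  refine ⟨N, C, by exact_mod_cast hN1, by exact_mod_cast hCpos, ?_⟩
  intro n hn S hS x
  set U : Set (SpGroup g R ⧸ (Spcongruence g R n)) := S ∪ S⁻¹ ∪ {1} with hU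
  set T : Set (SpGroup g R) := (QuotientGroup.mk' (Spcongruence g R n)) ⁻¹' U with hT
  have hT1 : (1 : SpGroup g R) ∈ T := by
    change QuotientGroup.mk' (Spcongruence g R n) 1 ∈ U
    rw [map_one]
    exact Or.inr rfl
  have hTinv : T⁻¹ = T := by
    ext y
    simp only [hT, hU, Set.mem_inv, Set.mem_preimage, map_inv, Set.mem_union, inv_inv,
      Set.mem_singleton_iff, inv_eq_one]
    tauto
  have hKT : ∀ y ∈ (Spcongruence g R n), y ∈ T := by
    intro y hy
    have : QuotientGroup.mk' (Spcongruence g R n) y = 1 := (QuotientGroup.eq_one_iff y).2 hy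
    change QuotientGroup.mk' (Spcongruence g R n) y ∈ U
    rw [this]
    exact Or.inr rfl
  have hTtop : Subgroup.closure T = ⊤ := by
    have hmap : (Subgroup.closure T).map (QuotientGroup.mk' (Spcongruence g R n)) = ⊤ := by
      rw [MonoidHom.map_closure, eq_top_iff, ← hS]
      apply Subgroup.closure_mono
      intro y hy
      obtain ⟨z, rfl⟩ := QuotientGroup.mk'_surjective (Spcongruence g R n) y
      exact ⟨z, Or.inl (Or.inl hy), rfl⟩
    have hle : (QuotientGroup.mk' (Spcongruence g R n)).ker ≤ Subgroup.closure T := by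
      rw [QuotientGroup.ker_mk']
      exact fun y hy => Subgroup.subset_closure (hKT y hy)
    rw [← Subgroup.comap_map_eq_self hle, hmap, Subgroup.comap_top]
  have hcov : spCov T N 2 := hN T hTtop hTinv hT1
  have hlt : n < 2 ^ (Nat.log 2 n + 1) := Nat.lt_pow_succ_log_self (by norm_num) n
  have hle : 2 ^ Nat.log 2 n ≤ n := Nat.pow_log_le_self 2 (by omega)
  have hcovn := spCov_anti hP hlt.le (spCov_pow hP c hc hTinv hT1 hcov (Nat.log 2 n))
  rw [← hC] at hcovn
  obtain ⟨z, rfl⟩ := QuotientGroup.mk'_surjective (Spcongruence g R n) x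
  obtain ⟨w, hw, hwz⟩ := hcovn z
  obtain ⟨f, hf⟩ := Set.mem_pow.1 hw
  refine ⟨(List.ofFn fun i => ((f i : T) : SpGroup g R)).map (QuotientGroup.mk' (Spcongruence g R n)), ?_, ?_, ?_⟩
  · intro y hy
    rw [List.mem_map] at hy
    obtain ⟨a, ha, rfl⟩ := hy
    rw [List.mem_ofFn] at ha
    obtain ⟨i, rfl⟩ := ha
    exact (f i).2
  · rw [List.length_map, List.length_ofFn, Real.rpow_natCast]
    have : C ^ Nat.log 2 n * N ≤ N * n ^ C := by
      rw [mul_comm]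
      apply Nat.mul_le_mul_left
      calc C ^ Nat.log 2 n ≤ (2 ^ C) ^ Nat.log 2 n := Nat.pow_le_pow_left hCe _
        _ = (2 ^ Nat.log 2 n) ^ C := by rw [← pow_mul, ← pow_mul, mul_comm]
        _ ≤ n ^ C := Nat.pow_le_pow_left hle _
    exact_mod_cast this
  · rw [← map_list_prod, hf]
    exact QuotientGroup.eq.2 hwz

end SpAuxMain

/-- **Theorem 1.5 for `Sp_{2g}` (classical case of Theorem 1.5).**
Let `p ≥ 3` be a prime and `R` a commutative unital Noetherian local domain with
principal maximal ideal `M = (P)`, complete in the `M`-adic topology, with finite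
residue field of characteristic `p`.  Let `g ≥ 1`, `d = 2g`, and
`G = Sp_d(R) = {A : AᵀΩA = Ω}`, with congruence subgroups `K_n`.  Then each
`G/K_n` is finite and there are `C₁, C₂ > 0` such that for every `n ≥ 1` and
every generating set `S` of `G/K_n`, every element of `G/K_n` is a product of at
most `C₁ · n^{C₂}` elements of `S ∪ S⁻¹ ∪ {1}`. -/
theorem Sp_congruence_diameter_bound
    (p : ℕ) (hp : p.Prime) (hp3 : 3 ≤ p)
    {R : Type*} [CommRing R] [IsDomain R] [IsNoetherianRing R] [IsLocalRing R]
    (P : R) (hP : IsLocalRing.maximalIdeal R = Ideal.span {P})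
    [IsAdicComplete (IsLocalRing.maximalIdeal R) R]
    [Finite (IsLocalRing.ResidueField R)] [CharP (IsLocalRing.ResidueField R) p]
    (g : ℕ) (hg : 1 ≤ g) :
    (∀ n, 1 ≤ n → Finite (SpGroup g R ⧸ Spcongruence g R n)) ∧
    ∃ C₁ C₂ : ℝ, 0 < C₁ ∧ 0 < C₂ ∧ ∀ n, 1 ≤ n →
      ∀ S : Set (SpGroup g R ⧸ Spcongruence g R n),
        Subgroup.closure S = ⊤ →
        ∀ x, ∃ L : List (SpGroup g R ⧸ Spcongruence g R n),
          (∀ y ∈ L, y ∈ S ∪ S⁻¹ ∪ {1}) ∧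
          (L.length : ℝ) ≤ C₁ * (n : ℝ) ^ C₂ ∧
          L.prod = x := by
  exact spaux_main p hp hp3 P hP g hg
end

section
/- Let p ≥ 3 be a prime, q a power of p, and F a finite field with q elements. Let N = { σ : F⟦X⟧ ≃ F⟦X⟧ an F-algebra automorphism of the formal power series ring such that σ(X) − X lies in the ideal (X²) }. Then N is a subgroup of the group of F-algebra automorphisms of F⟦X⟧; for each n ≥ 1 the set K_n = { σ ∈ N : σ(X) − X ∈ (X^{n+1}) } is a normal subgroup of N of finite index; and there exist real constants C₁, C₂ > 0 such that for every n ≥ 1 and every generating set S of the finite group N/K_n, every element of N/K_n is a product of at most C₁·n^{C₂} elements of S ∪ S⁻¹ ∪ {1}. -/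
open PowerSeries

section Nottingham

variable {F : Type*} [Field F]

private lemma X_dvd_algEquiv_X (σ : PowerSeries F ≃ₐ[F] PowerSeries F) :
    (PowerSeries.X : PowerSeries F) ∣ σ PowerSeries.X := by
  rw [PowerSeries.X_dvd_iff]
  by_contra h
  have hu : IsUnit (σ (PowerSeries.X : PowerSeries F)) := by
    rw [PowerSeries.isUnit_iff_constantCoeff]
    exact isUnit_iff_ne_zero.mpr h
  have hX : IsUnit (PowerSeries.X : PowerSeries F) := by
    have := hu.map (σ.symm : PowerSeries F →+* PowerSeries F)
    simpa using this
  rw [PowerSeries.isUnit_iff_constantCoeff] at hX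
  simp at hX

private lemma algEquiv_mem_span_pow (σ : PowerSeries F ≃ₐ[F] PowerSeries F)
    (k : ℕ) {f : PowerSeries F}
    (hf : f ∈ Ideal.span {(PowerSeries.X : PowerSeries F) ^ k}) :
    σ f ∈ Ideal.span {(PowerSeries.X : PowerSeries F) ^ k} := by
  rw [Ideal.mem_span_singleton] at hf ⊢
  obtain ⟨c, rfl⟩ := hf
  rw [map_mul, map_pow]
  exact Dvd.dvd.mul_right (pow_dvd_pow_of_dvd (X_dvd_algEquiv_X σ) k) _

/-- The Nottingham group of the field `F`: the group of `F`-algebra automorphisms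
`σ` of `F⟦X⟧` such that `σ X − X ∈ (X²)`. -/
def NottinghamGroup (F : Type*) [Field F] :
    Subgroup (PowerSeries F ≃ₐ[F] PowerSeries F) where
  carrier := {σ | σ PowerSeries.X - PowerSeries.X ∈
    Ideal.span {(PowerSeries.X : PowerSeries F) ^ 2}}
  one_mem' := by simp
  mul_mem' := by
    intro σ τ hσ hτ
    have h : (σ * τ) (PowerSeries.X : PowerSeries F) - PowerSeries.X =
        (σ (τ PowerSeries.X) - σ PowerSeries.X) + (σ PowerSeries.X - PowerSeries.X) := by
      rw [AlgEquiv.mul_apply]; ring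
    rw [Set.mem_setOf_eq, h]
    refine add_mem ?_ hσ
    rw [← map_sub]
    exact algEquiv_mem_span_pow σ 2 hτ
  inv_mem' := by
    intro σ hσ
    have h : σ⁻¹ (PowerSeries.X : PowerSeries F) - PowerSeries.X =
        -(σ.symm (σ PowerSeries.X - PowerSeries.X)) := by
      rw [map_sub, AlgEquiv.symm_apply_apply]
      show σ.symm (PowerSeries.X : PowerSeries F) - PowerSeries.X = _
      ring
    rw [Set.mem_setOf_eq, h]
    exact neg_mem (algEquiv_mem_span_pow σ.symm 2 hσ)

/-- The `n`-th congruence subgroup of the Nottingham group: automorphisms `σ`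
with `σ X − X ∈ (X^(n+1))`. -/
def NottinghamCong (F : Type*) [Field F] (n : ℕ) : Subgroup (NottinghamGroup F) where
  carrier := {σ | (σ : PowerSeries F ≃ₐ[F] PowerSeries F) PowerSeries.X - PowerSeries.X ∈
    Ideal.span {(PowerSeries.X : PowerSeries F) ^ (n + 1)}}
  one_mem' := by simp
  mul_mem' := by
    intro σ τ hσ hτ
    have hcoe : ((σ * τ : NottinghamGroup F) : PowerSeries F ≃ₐ[F] PowerSeries F) =
        (σ : PowerSeries F ≃ₐ[F] PowerSeries F) * (τ : PowerSeries F ≃ₐ[F] PowerSeries F) :=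
      rfl
    have h : ((σ * τ : NottinghamGroup F) : PowerSeries F ≃ₐ[F] PowerSeries F)
          (PowerSeries.X : PowerSeries F) - PowerSeries.X =
        ((σ : PowerSeries F ≃ₐ[F] PowerSeries F)
            ((τ : PowerSeries F ≃ₐ[F] PowerSeries F) PowerSeries.X) -
          (σ : PowerSeries F ≃ₐ[F] PowerSeries F) PowerSeries.X) +
        ((σ : PowerSeries F ≃ₐ[F] PowerSeries F) PowerSeries.X - PowerSeries.X) := by
      rw [hcoe, AlgEquiv.mul_apply]; ring
    rw [Set.mem_setOf_eq, h]
    refine add_mem ?_ hσ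
    rw [← map_sub]
    exact algEquiv_mem_span_pow _ (n + 1) hτ
  inv_mem' := by
    intro σ hσ
    have hcoe : ((σ⁻¹ : NottinghamGroup F) : PowerSeries F ≃ₐ[F] PowerSeries F) =
        ((σ : PowerSeries F ≃ₐ[F] PowerSeries F))⁻¹ := rfl
    have h : ((σ⁻¹ : NottinghamGroup F) : PowerSeries F ≃ₐ[F] PowerSeries F)
          (PowerSeries.X : PowerSeries F) - PowerSeries.X =
        -((σ : PowerSeries F ≃ₐ[F] PowerSeries F).symm
          ((σ : PowerSeries F ≃ₐ[F] PowerSeries F) PowerSeries.X - PowerSeries.X)) := by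
      rw [map_sub, AlgEquiv.symm_apply_apply, hcoe]
      show (σ : PowerSeries F ≃ₐ[F] PowerSeries F).symm (PowerSeries.X : PowerSeries F) -
        PowerSeries.X = _
      ring
    rw [Set.mem_setOf_eq, h]
    exact neg_mem (algEquiv_mem_span_pow _ (n + 1) hσ)

end Nottingham

section NottinghamProof

variable {F : Type*} [Field F]

local notation "D" => PowerSeries.derivative F

lemma nott_derivative_dvd {m : ℕ} {u : PowerSeries F} (hu : (X : PowerSeries F) ^ m ∣ u) :
    (X : PowerSeries F) ^ (m - 1) ∣ D u := by
  rw [PowerSeries.X_pow_dvd_iff] at hu ⊢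
  intro k hk
  rw [PowerSeries.coeff_derivative, hu (k + 1) (by omega), zero_mul]

lemma nott_equiv_dvd (σ : PowerSeries F ≃ₐ[F] PowerSeries F) {m : ℕ} {u : PowerSeries F}
    (hu : (X : PowerSeries F) ^ m ∣ u) : (X : PowerSeries F) ^ m ∣ σ u := by
  have := algEquiv_mem_span_pow σ m (Ideal.mem_span_singleton.mpr hu)
  exact Ideal.mem_span_singleton.mp this

/-- Second order Taylor error. -/
lemma nott_error_mul (σ : PowerSeries F ≃ₐ[F] PowerSeries F) (v u : PowerSeries F)
    (hv : σ X = X + v) :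
    σ (X * u) - X * u - D (X * u) * v = D u * v ^ 2 + (X + v) * (σ u - u - D u * v) := by
  rw [map_mul, hv, Derivation.leibniz, PowerSeries.derivative_X]
  simp only [smul_eq_mul]
  ring

lemma nott_error_all (σ : PowerSeries F ≃ₐ[F] PowerSeries F) (v : PowerSeries F)
    (hv : σ X = X + v) (a : ℕ) (hva : (X : PowerSeries F) ^ (a + 1) ∣ v) :
    ∀ k, k ≤ 2 * a + 2 → ∀ u : PowerSeries F,
      (X : PowerSeries F) ^ k ∣ σ u - u - D u * v := by
  have hv1 : (X : PowerSeries F) ∣ X + v :=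
    dvd_add dvd_rfl ((dvd_pow_self X (Nat.succ_ne_zero a)).trans hva)
  have hv2 : (X : PowerSeries F) ^ (2 * a + 2) ∣ v ^ 2 := by
    have := pow_dvd_pow_of_dvd hva 2
    rwa [← pow_mul, show (a + 1) * 2 = 2 * a + 2 by ring] at this
  intro k
  induction k with
  | zero => intro _ u; simp
  | succ k ih =>
    intro hk u
    obtain ⟨w, hw⟩ : (X : PowerSeries F) ∣ u - C (constantCoeff u) := by
      rw [PowerSeries.X_dvd_iff]; simp
    have hu : u = C (constantCoeff u) + X * w := by rw [← hw]; ring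
    have hC : σ (C (constantCoeff u)) = C (constantCoeff u) := by
      exact σ.commutes (constantCoeff u)
    have : σ u - u - D u * v = σ (X * w) - X * w - D (X * w) * v := by
      conv_lhs => rw [hu]
      rw [map_add, map_add, hC, PowerSeries.derivative_C]
      ring
    rw [this, nott_error_mul σ v w hv]
    refine dvd_add (Dvd.dvd.mul_left ((pow_dvd_pow X hk).trans hv2) _) ?_
    rw [pow_succ']
    exact mul_dvd_mul hv1 (ih (by omega) w)

lemma nott_error (σ : PowerSeries F ≃ₐ[F] PowerSeries F) (v : PowerSeries F)
    (hv : σ X = X + v) (a : ℕ) (hva : (X : PowerSeries F) ^ (a + 1) ∣ v)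
    (m : ℕ) (u : PowerSeries F) (hu : (X : PowerSeries F) ^ m ∣ u) :
    (X : PowerSeries F) ^ (m + 2 * a) ∣ σ u - u - D u * v := by
  have hv1 : (X : PowerSeries F) ∣ X + v :=
    dvd_add dvd_rfl ((dvd_pow_self X (Nat.succ_ne_zero a)).trans hva)
  have hv2 : (X : PowerSeries F) ^ (2 * a + 2) ∣ v ^ 2 := by
    have := pow_dvd_pow_of_dvd hva 2
    rwa [← pow_mul, show (a + 1) * 2 = 2 * a + 2 by ring] at this
  induction m generalizing u with
  | zero => exact nott_error_all σ v hv a hva _ (by omega) u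
  | succ m ih =>
    obtain ⟨w, rfl⟩ := hu
    have h1 : (X : PowerSeries F) ^ m ∣ X ^ m * w := Dvd.intro _ rfl
    rw [pow_succ', mul_assoc, nott_error_mul σ v _ hv]
    refine dvd_add ?_ ?_
    · have := mul_dvd_mul (nott_derivative_dvd h1) hv2
      rw [← pow_add] at this
      exact (pow_dvd_pow X (by omega)).trans this
    · rw [show m + 1 + 2 * a = (m + 2 * a) + 1 by ring, pow_succ']
      exact mul_dvd_mul hv1 (ih _ h1)

/-- First order estimate. -/
lemma nott_first (σ : PowerSeries F ≃ₐ[F] PowerSeries F) (a : ℕ)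
    (hσ : (X : PowerSeries F) ^ (a + 1) ∣ σ X - X)
    (m : ℕ) (u : PowerSeries F) (hu : (X : PowerSeries F) ^ m ∣ u) :
    (X : PowerSeries F) ^ (m + a) ∣ σ u - u := by
  have h := nott_error σ (σ X - X) (by ring) a hσ m u hu
  have h2 := mul_dvd_mul (nott_derivative_dvd hu) hσ
  rw [← pow_add] at h2
  have := dvd_add ((pow_dvd_pow X (by omega : m + a ≤ m + 2 * a)).trans h)
    ((pow_dvd_pow X (by omega : m + a ≤ m - 1 + (a + 1))).trans h2)
  simpa using this

lemma nott_comm_tool (σ τ : PowerSeries F ≃ₐ[F] PowerSeries F) (a b r d : ℕ) (u : PowerSeries F)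
    (hab : a + b = r) (hda : d ≤ a) (hdb : d ≤ b)
    (hσ : (X : PowerSeries F) ^ (r + 1) ∣ σ X - X - X ^ (a + 1))
    (hu : (X : PowerSeries F) ^ (b + 1) ∣ u)
    (hτ : (X : PowerSeries F) ^ (r + 1) ∣ τ X - X - u) :
    (X : PowerSeries F) ^ (r + d + 1) ∣
      σ (τ X) - τ (σ X) - X ^ a * (X * D u - ((a + 1 : ℕ) : PowerSeries F) * u) := by
  set v' : PowerSeries F := σ X - X with hv'
  set u' : PowerSeries F := τ X - X with hu'
  have hv1 : (X : PowerSeries F) ^ (a + 1) ∣ v' := by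
    have := dvd_add ((pow_dvd_pow X (by omega : a + 1 ≤ r + 1)).trans hσ)
      (dvd_refl (X ^ (a + 1) : PowerSeries F))
    simpa using this
  have hu1 : (X : PowerSeries F) ^ (b + 1) ∣ u' := by
    have := dvd_add ((pow_dvd_pow X (by omega : b + 1 ≤ r + 1)).trans hτ) hu
    simpa using this
  have e1 := nott_error σ v' (by rw [hv']; ring) a hv1 (b + 1) u' hu1
  have e2 := nott_error τ u' (by rw [hu']; ring) b hu1 (a + 1) v' hv1
  have e3 := mul_dvd_mul (nott_derivative_dvd hτ) hv1
  have e4 := mul_dvd_mul (nott_derivative_dvd hσ) hu1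
  have e5 := mul_dvd_mul (nott_derivative_dvd hu) hσ
  have e6 := mul_dvd_mul (nott_derivative_dvd (dvd_refl (X ^ (a + 1) : PowerSeries F))) hτ
  rw [← pow_add] at e3 e4 e5 e6
  have key : σ (τ X) - τ (σ X) - X ^ a * (X * D u - ((a + 1 : ℕ) : PowerSeries F) * u) =
      (σ u' - u' - D u' * v') - (τ v' - v' - D v' * u') + D (u' - u) * v'
      - D (v' - X ^ (a + 1)) * u' + D u * (v' - X ^ (a + 1))
      - D (X ^ (a + 1)) * (u' - u) := by
    have h1 : τ X = X + u' := by rw [hu']; ring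
    have h2 : σ X = X + v' := by rw [hv']; ring
    have h3 : D (u' - u) = D u' - D u := map_sub _ _ _
    have h4 : D (v' - X ^ (a + 1)) = D v' - D (X ^ (a + 1)) := map_sub _ _ _
    have h5 : σ (X + u') = X + v' + σ u' := by rw [map_add, h2]
    have h6 : τ (X + v') = X + u' + τ v' := by rw [map_add, h1]
    rw [h1, h2, h3, h4, h5, h6, PowerSeries.derivative_pow, PowerSeries.derivative_X]
    simp only [Nat.add_sub_cancel]
    ring
  rw [key]
  have mono : ∀ {k : ℕ} {z : PowerSeries F}, X ^ k ∣ z → r + d + 1 ≤ k → X ^ (r + d + 1) ∣ z :=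
    fun h hk => (pow_dvd_pow X hk).trans h
  exact dvd_sub (dvd_add (dvd_sub (dvd_add (dvd_sub (mono e1 (by omega)) (mono e2 (by omega)))
    (mono e3 (by omega))) (mono e4 (by omega))) (mono e5 (by omega))) (mono e6 (by omega))

lemma nott_mem_cong {n : ℕ} {σ : NottinghamGroup F} :
    σ ∈ NottinghamCong F n ↔ (X : PowerSeries F) ^ (n + 1) ∣
      (σ : PowerSeries F ≃ₐ[F] PowerSeries F) X - X :=
  Ideal.mem_span_singleton

lemma nott_mem_group {σ : PowerSeries F ≃ₐ[F] PowerSeries F} :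
    σ ∈ NottinghamGroup F ↔ (X : PowerSeries F) ^ 2 ∣ σ X - X :=
  Ideal.mem_span_singleton

lemma nott_inv_mul_apply (α β : NottinghamGroup F) :
    ((α⁻¹ * β : NottinghamGroup F) : PowerSeries F ≃ₐ[F] PowerSeries F) X - X =
      ((α⁻¹ : NottinghamGroup F) : PowerSeries F ≃ₐ[F] PowerSeries F)
        ((β : PowerSeries F ≃ₐ[F] PowerSeries F) X - (α : PowerSeries F ≃ₐ[F] PowerSeries F) X) := by
  rw [map_sub]
  congr 1
  exact ((α : PowerSeries F ≃ₐ[F] PowerSeries F).symm_apply_apply X).symm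

lemma nott_inv_mul_mem {n : ℕ} {α β : NottinghamGroup F} :
    α⁻¹ * β ∈ NottinghamCong F n ↔ (X : PowerSeries F) ^ (n + 1) ∣
      (β : PowerSeries F ≃ₐ[F] PowerSeries F) X - (α : PowerSeries F ≃ₐ[F] PowerSeries F) X := by
  rw [nott_mem_cong, nott_inv_mul_apply]
  constructor
  · intro h
    have := nott_equiv_dvd (α : PowerSeries F ≃ₐ[F] PowerSeries F) h
    have e := (α : PowerSeries F ≃ₐ[F] PowerSeries F).apply_symm_apply
      ((β : PowerSeries F ≃ₐ[F] PowerSeries F) X - (α : PowerSeries F ≃ₐ[F] PowerSeries F) X)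
    rw [← e]
    exact this
  · exact nott_equiv_dvd _

lemma nott_cong_mono {m n : ℕ} (h : m ≤ n) : NottinghamCong F n ≤ NottinghamCong F m := by
  intro σ hσ
  rw [nott_mem_cong] at hσ ⊢
  exact (pow_dvd_pow X (by omega)).trans hσ

lemma nott_normal (n : ℕ) : (NottinghamCong F n).Normal := by
  constructor
  intro τ hτ σ
  rw [nott_mem_cong] at hτ
  have h : σ * τ * σ⁻¹ = (σ⁻¹)⁻¹ * (τ * σ⁻¹) := by group
  rw [h, nott_inv_mul_mem]
  have hX : (X : PowerSeries F) ^ 1 ∣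
      ((σ⁻¹ : NottinghamGroup F) : PowerSeries F ≃ₐ[F] PowerSeries F) X :=
    nott_equiv_dvd _ (by simp)
  have := nott_first (τ : PowerSeries F ≃ₐ[F] PowerSeries F) n hτ 1 _ hX
  rw [add_comm] at this
  exact this

lemma nott_finite_quot [Finite F] (n : ℕ) : Finite (NottinghamGroup F ⧸ NottinghamCong F n) := by
  let f : NottinghamGroup F ⧸ NottinghamCong F n → (Fin (n + 1) → F) := fun x i =>
    coeff (i : ℕ) (((Quotient.out x : NottinghamGroup F) : PowerSeries F ≃ₐ[F] PowerSeries F) X)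
  refine Finite.of_injective f ?_
  intro x y hxy
  rw [← Quotient.out_eq x, ← Quotient.out_eq y]
  refine QuotientGroup.eq.mpr ?_
  rw [nott_inv_mul_mem, PowerSeries.X_pow_dvd_iff]
  intro m hm
  have := congrFun hxy ⟨m, hm⟩
  simp only [f] at this
  rw [map_sub, this, sub_self]

lemma nott_finiteIndex [Finite F] (n : ℕ) : (NottinghamCong F n).FiniteIndex :=
  haveI := nott_finite_quot (F := F) n
  Subgroup.finiteIndex_of_finite_quotient

lemma nott_surj (φ : PowerSeries F →ₐ[F] PowerSeries F) (u : PowerSeries F)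
    (hφ : φ X = X + X ^ 2 * u) : Function.Surjective φ := by
  intro f
  let P : ℕ → PowerSeries F := fun n => Nat.rec 0
    (fun n Q => Q + C (coeff n (f - φ Q)) * X ^ n) n
  have hP : ∀ n, P (n + 1) = P n + C (coeff n (f - φ (P n))) * X ^ n := fun n => rfl
  have hd : ∀ n, (X : PowerSeries F) ^ n ∣ f - φ (P n) := by
    intro n
    induction n with
    | zero => simp
    | succ n ih =>
      obtain ⟨e, he⟩ := ih
      have hc : coeff n (f - φ (P n)) = constantCoeff e := by
        rw [he]
        have := coeff_X_pow_mul e n 0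
        simpa using this
      have hC : φ (C (constantCoeff e)) = C (constantCoeff e) := φ.commutes (constantCoeff e)
      have : f - φ (P (n + 1)) = X ^ n * (e - C (constantCoeff e) * (1 + X * u) ^ n) := by
        rw [hP, hc, map_add, map_mul, hC, map_pow, hφ, mul_sub, ← he,
          show X + X ^ 2 * u = X * (1 + X * u) by ring, mul_pow]
        ring
      rw [this, pow_succ]
      refine mul_dvd_mul_left _ ?_
      rw [PowerSeries.X_dvd_iff]
      simp
  let g : PowerSeries F := PowerSeries.mk fun n => coeff n (f - φ (P n))
  have hc : ∀ n k, coeff k (P n) = if k < n then coeff k g else 0 := by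
    intro n
    induction n with
    | zero => intro k; simp [P]
    | succ n ih =>
      intro k
      rw [hP, map_add, ih, coeff_C_mul, coeff_X_pow]
      by_cases h1 : k = n
      · subst h1; simp [g]
      · by_cases h2 : k < n
        · simp [h1, h2, Nat.lt_succ_of_lt h2]
        · have : ¬ k < n + 1 := by omega
          simp [h1, h2, this]
  have hg : ∀ n, (X : PowerSeries F) ^ n ∣ g - P n := by
    intro n
    rw [PowerSeries.X_pow_dvd_iff]
    intro m hm
    rw [map_sub, hc, if_pos hm, sub_self]
  have hφX : (X : PowerSeries F) ∣ φ X := by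
    rw [hφ]; exact Dvd.intro (1 + X * u) (by ring)
  refine ⟨g, ?_⟩
  ext n
  have h1 : (X : PowerSeries F) ^ (n + 1) ∣ φ (g - P (n + 1)) := by
    obtain ⟨e, he⟩ := hg (n + 1)
    rw [he, map_mul, map_pow]
    exact Dvd.dvd.mul_right (pow_dvd_pow_of_dvd hφX _) _
  have h2 := dvd_sub (hd (n + 1)) h1
  rw [map_sub, sub_sub_sub_cancel_right] at h2
  have := (PowerSeries.X_pow_dvd_iff.mp h2) n (by omega)
  rw [map_sub, sub_eq_zero] at this
  exact this.symm

lemma nott_exists (u : PowerSeries F) (hu : (X : PowerSeries F) ^ 2 ∣ u) :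
    ∃ σ : NottinghamGroup F, (σ : PowerSeries F ≃ₐ[F] PowerSeries F) X = X + u := by
  obtain ⟨w, rfl⟩ := hu
  have hs : HasSubst (X + X ^ 2 * w : PowerSeries F) :=
    HasSubst.of_constantCoeff_zero' (by simp)
  let φ : PowerSeries F →ₐ[F] PowerSeries F := substAlgHom hs
  have hφ : φ X = X + X ^ 2 * w := substAlgHom_X hs
  have hsurj := nott_surj φ w hφ
  have hinj : Function.Injective φ := by
    rw [injective_iff_map_eq_zero]
    intro f hf
    by_contra hne
    have h1 := PowerSeries.X_pow_order_mul_divXPowOrder (f := f)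
    have h2 : IsUnit (divXPowOrder f) := by
      rw [PowerSeries.isUnit_iff_constantCoeff, isUnit_iff_ne_zero]
      exact constantCoeff_divXPowOrder_eq_zero_iff.not.mpr hne
    rw [← h1, map_mul, map_pow, hφ] at hf
    rcases mul_eq_zero.mp hf with h | h
    · have h3 := eq_zero_of_pow_eq_zero h
      have := congrArg (coeff 1) h3
      rw [show X + X ^ 2 * w = X ^ 1 * (1 + X * w) by ring] at this
      have h4 := coeff_X_pow_mul (1 + X * w) 1 0
      simp only [zero_add] at h4
      rw [h4] at this
      simp at this
    · exact (h2.map φ).ne_zero h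
  refine ⟨⟨AlgEquiv.ofBijective φ ⟨hinj, hsurj⟩, ?_⟩, ?_⟩
  · rw [nott_mem_group]
    have h5 : (X : PowerSeries F) ^ 2 ∣ φ X - X := by rw [hφ]; simp
    exact h5
  · exact hφ


lemma nott_coeff_op (a j : ℕ) (u : PowerSeries F) :
    coeff (a + j) (X ^ a * (X * D u - ((a + 1 : ℕ) : PowerSeries F) * u)) =
      ((j : F) - ((a + 1 : ℕ) : F)) * coeff j u := by
  rw [add_comm a j, coeff_X_pow_mul, map_sub, ← map_natCast (C (R := F)), coeff_C_mul, sub_mul]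
  congr 1
  cases j with
  | zero => simp
  | succ j => rw [coeff_succ_X_mul, coeff_derivative]; push_cast; ring

lemma nott_op_dvd (a b : ℕ) (u : PowerSeries F) (hu : (X : PowerSeries F) ^ (b + 1) ∣ u) :
    (X : PowerSeries F) ^ (a + b + 1) ∣
      X ^ a * (X * D u - ((a + 1 : ℕ) : PowerSeries F) * u) := by
  rw [add_assoc, pow_add]
  refine mul_dvd_mul_left _ (dvd_sub ?_ (Dvd.dvd.mul_left hu _))
  have := mul_dvd_mul_left (X : PowerSeries F) (nott_derivative_dvd hu)
  rwa [Nat.add_sub_cancel, ← pow_succ'] at this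

/-- Every high order series is a sum of two brackets (this uses `p ≠ 2`). -/
lemma nott_split (h2 : (2 : F) ≠ 0) (a b : ℕ) (w : PowerSeries F)
    (hw : (X : PowerSeries F) ^ (a + 1 + b + 1) ∣ w) :
    ∃ u₁ u₂ : PowerSeries F, (X : PowerSeries F) ^ (b + 1 + 1) ∣ u₁ ∧
      (X : PowerSeries F) ^ (b + 1) ∣ u₂ ∧
      w = X ^ a * (X * D u₁ - ((a + 1 : ℕ) : PowerSeries F) * u₁) +
        X ^ (a + 1) * (X * D u₂ - ((a + 1 + 1 : ℕ) : PowerSeries F) * u₂) := by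
  let u₁ : PowerSeries F := PowerSeries.mk fun j => coeff (a + j) w / ((j : F) - ((a + 1 : ℕ) : F))
  have hu₁ : (X : PowerSeries F) ^ (b + 1 + 1) ∣ u₁ := by
    rw [PowerSeries.X_pow_dvd_iff] at hw ⊢
    intro m hm
    simp only [u₁, coeff_mk]
    rw [hw (a + m) (by omega), zero_div]
  let z : PowerSeries F := w - X ^ a * (X * D u₁ - ((a + 1 : ℕ) : PowerSeries F) * u₁)
  have hz : (X : PowerSeries F) ^ (a + 1 + b + 1) ∣ z := by
    refine dvd_sub hw ?_
    have := nott_op_dvd a (b + 1) u₁ hu₁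
    rwa [show a + (b + 1) + 1 = a + 1 + b + 1 by ring] at this
  let u₂ : PowerSeries F := PowerSeries.mk fun j =>
    coeff (a + 1 + j) z / ((j : F) - ((a + 1 + 1 : ℕ) : F))
  have hu₂ : (X : PowerSeries F) ^ (b + 1) ∣ u₂ := by
    rw [PowerSeries.X_pow_dvd_iff] at hz ⊢
    intro m hm
    simp only [u₂, coeff_mk]
    rw [hz (a + 1 + m) (by omega), zero_div]
  refine ⟨u₁, u₂, hu₁, hu₂, ?_⟩
  suffices h : z = X ^ (a + 1) * (X * D u₂ - ((a + 1 + 1 : ℕ) : PowerSeries F) * u₂) by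
    rw [← h]; simp only [z]; ring
  ext n
  by_cases hn : n < a + 1
  · rw [(PowerSeries.X_pow_dvd_iff.mp hz) n (by omega),
      (PowerSeries.X_pow_dvd_iff.mp (Dvd.intro _ rfl)) n hn]
  · obtain ⟨j, rfl⟩ := Nat.exists_eq_add_of_le (not_lt.mp hn)
    rw [nott_coeff_op]
    simp only [u₂, coeff_mk]
    by_cases hs : (j : F) - ((a + 1 + 1 : ℕ) : F) = 0
    · rw [hs, zero_mul]
      simp only [z]
      rw [map_sub, add_assoc, nott_coeff_op]
      simp only [u₁, coeff_mk]
      have ht : ((1 + j : ℕ) : F) - ((a + 1 : ℕ) : F) ≠ 0 := by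
        intro ht
        apply h2
        push_cast at hs ht
        linear_combination ht - hs
      rw [mul_div_cancel₀ _ ht, sub_self]
    · rw [mul_div_cancel₀ _ hs]

lemma nott_comm (σ τ : NottinghamGroup F) (a b r d : ℕ) (u : PowerSeries F)
    (hab : a + b = r) (hda : d ≤ a) (hdb : d ≤ b)
    (hσ : (X : PowerSeries F) ^ (r + 1) ∣
      (σ : PowerSeries F ≃ₐ[F] PowerSeries F) X - X - X ^ (a + 1))
    (hu : (X : PowerSeries F) ^ (b + 1) ∣ u)
    (hτ : (X : PowerSeries F) ^ (r + 1) ∣ (τ : PowerSeries F ≃ₐ[F] PowerSeries F) X - X - u) :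
    (X : PowerSeries F) ^ (r + d + 1) ∣
      (((τ * σ)⁻¹ * (σ * τ) : NottinghamGroup F) : PowerSeries F ≃ₐ[F] PowerSeries F) X - X
        - X ^ a * (X * D u - ((a + 1 : ℕ) : PowerSeries F) * u) := by
  have key := nott_comm_tool σ.1 τ.1 a b r d u hab hda hdb hσ hu hτ
  have hop := nott_op_dvd a b u hu
  rw [hab] at hop
  have hσd : σ ∈ NottinghamCong F d := by
    rw [nott_mem_cong]
    have := dvd_add ((pow_dvd_pow X (by omega : d + 1 ≤ r + 1)).trans hσ)
      (pow_dvd_pow (X : PowerSeries F) (by omega : d + 1 ≤ a + 1))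
    simpa using this
  have hτd : τ ∈ NottinghamCong F d := by
    rw [nott_mem_cong]
    have := dvd_add ((pow_dvd_pow X (by omega : d + 1 ≤ r + 1)).trans hτ)
      ((pow_dvd_pow X (by omega : d + 1 ≤ b + 1)).trans hu)
    simpa using this
  have hβ := nott_mem_cong.mp (inv_mem (mul_mem hτd hσd))
  rw [nott_inv_mul_apply]
  have e1 : ((σ * τ : NottinghamGroup F) : PowerSeries F ≃ₐ[F] PowerSeries F) X =
    σ.1 (τ.1 X) := rfl
  have e2 : ((τ * σ : NottinghamGroup F) : PowerSeries F ≃ₐ[F] PowerSeries F) X =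
    τ.1 (σ.1 X) := rfl
  rw [e1, e2]
  have hz : (X : PowerSeries F) ^ (r + 1) ∣ σ.1 (τ.1 X) - τ.1 (σ.1 X) := by
    have := dvd_add ((pow_dvd_pow X (by omega : r + 1 ≤ r + d + 1)).trans key) hop
    simpa using this
  have h1 := nott_first _ d hβ (r + 1) _ hz
  rw [show r + 1 + d = r + d + 1 by ring] at h1
  have := dvd_add h1 key
  rwa [sub_add_sub_cancel] at this

/-- `g` is a product of at most `l` elements of `S ∪ S⁻¹ ∪ {1}`. -/
def NottWord {G : Type*} [Group G] (S : Set G) (l : ℕ) (g : G) : Prop :=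
  ∃ L : List G, (∀ y ∈ L, y ∈ S ∪ S⁻¹ ∪ {1}) ∧ L.length ≤ l ∧ L.prod = g

lemma NottWord.mul {G : Type*} [Group G] {S : Set G} {l m : ℕ} {g h : G}
    (hg : NottWord S l g) (hh : NottWord S m h) : NottWord S (l + m) (g * h) := by
  obtain ⟨L, h1, h2, rfl⟩ := hg
  obtain ⟨M, h3, h4, rfl⟩ := hh
  refine ⟨L ++ M, ?_, ?_, by simp⟩
  · intro y hy
    rcases List.mem_append.mp hy with h | h
    · exact h1 y h
    · exact h3 y h
  · rw [List.length_append]; omega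

lemma NottWord.inv {G : Type*} [Group G] {S : Set G} {l : ℕ} {g : G}
    (hg : NottWord S l g) : NottWord S l g⁻¹ := by
  obtain ⟨L, h1, h2, rfl⟩ := hg
  refine ⟨(L.map (·⁻¹)).reverse, ?_, by simpa using h2, by rw [List.prod_inv_reverse]⟩
  intro y hy
  simp only [List.mem_reverse, List.mem_map] at hy
  obtain ⟨x, hx, rfl⟩ := hy
  have := h1 x hx
  simp only [Set.mem_union, Set.mem_inv, Set.mem_singleton_iff, inv_inv, inv_eq_one] at this ⊢
  tauto

lemma NottWord.mono {G : Type*} [Group G] {S : Set G} {l m : ℕ} {g : G} (hlm : l ≤ m)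
    (hg : NottWord S l g) : NottWord S m g := by
  obtain ⟨L, h1, h2, h3⟩ := hg
  exact ⟨L, h1, h2.trans hlm, h3⟩

lemma NottWord.of_mem_closure {G : Type*} [Group G] {S : Set G} {g : G}
    (hg : g ∈ Subgroup.closure S) : ∃ l, NottWord S l g := by
  induction hg using Subgroup.closure_induction with
  | mem x hx => exact ⟨1, [x], by simp [hx], by simp, by simp⟩
  | one => exact ⟨0, [], by simp, by simp, by simp⟩
  | mul x y _ _ hx hy =>
    obtain ⟨l, hl⟩ := hx
    obtain ⟨m, hm⟩ := hy
    exact ⟨l + m, hl.mul hm⟩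
  | inv x _ hx =>
    obtain ⟨l, hl⟩ := hx
    exact ⟨l, hl.inv⟩

lemma NottWord.lift {G Q : Type*} [Group G] [Group Q] (f : G →* Q) {S : Set G} {l : ℕ} {x : Q}
    (hx : NottWord (f '' S) l x) : ∃ W, NottWord S l W ∧ f W = x := by
  obtain ⟨L, h1, h2, rfl⟩ := hx
  have : ∀ y : Q, ∃ z : G, y ∈ f '' S ∪ (f '' S)⁻¹ ∪ {1} → z ∈ S ∪ S⁻¹ ∪ {1} ∧ f z = y := by
    intro y
    by_cases hy : y ∈ f '' S ∪ (f '' S)⁻¹ ∪ {1}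
    · rcases hy with (⟨z, hz, rfl⟩ | ⟨z, hz, hzy⟩) | hy
      · exact ⟨z, fun _ => ⟨by simp [hz], rfl⟩⟩
      · exact ⟨z⁻¹, fun _ => ⟨by simp [hz], by rw [map_inv, hzy, inv_inv]⟩⟩
      · exact ⟨1, fun _ => ⟨by simp, by rw [map_one]; exact (Set.mem_singleton_iff.mp hy).symm⟩⟩
    · exact ⟨1, fun h => absurd h hy⟩
  choose s hs using this
  refine ⟨(L.map s).prod, ⟨L.map s, ?_, by simpa using h2, rfl⟩, ?_⟩
  · intro y hy
    obtain ⟨x, hx, rfl⟩ := List.mem_map.mp hy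
    exact (hs x (h1 x hx)).1
  · rw [map_list_prod, List.map_map]
    congr 1
    conv_rhs => rw [← List.map_id L]
    exact List.map_congr_left fun x hx => (hs x (h1 x hx)).2

lemma nott_base {G : Type*} [Group G] (K : Subgroup G) [K.Normal] [Finite (G ⧸ K)] :
    ∃ B : ℕ, ∀ S : Set G, Subgroup.closure S ⊔ K = ⊤ → ∀ g : G,
      ∃ W, NottWord S B W ∧ W⁻¹ * g ∈ K := by
  have h : ∀ t : Set (G ⧸ K) × (G ⧸ K), ∃ l, t.2 ∈ Subgroup.closure t.1 → NottWord t.1 l t.2 := by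
    intro t
    by_cases ht : t.2 ∈ Subgroup.closure t.1
    · obtain ⟨l, hl⟩ := NottWord.of_mem_closure ht
      exact ⟨l, fun _ => hl⟩
    · exact ⟨0, fun h => absurd h ht⟩
  choose l hl using h
  obtain ⟨B, hB⟩ := Set.Finite.bddAbove (Set.finite_range l)
  refine ⟨B, fun S hS g => ?_⟩
  have hg : g ∈ Subgroup.closure S ⊔ K := by rw [hS]; trivial
  obtain ⟨y, hy, z, hz, rfl⟩ := Subgroup.mem_sup_of_normal_right.mp hg
  have hm : (QuotientGroup.mk' K) y ∈ Subgroup.closure ((QuotientGroup.mk' K) '' S) := by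
    rw [← MonoidHom.map_closure]
    exact Subgroup.mem_map_of_mem _ hy
  have hw := (hl ((QuotientGroup.mk' K) '' S, (QuotientGroup.mk' K) y) hm).mono
    (hB (Set.mem_range_self _))
  obtain ⟨W, hW, hWy⟩ := hw.lift
  refine ⟨W, hW, ?_⟩
  rw [← mul_assoc]
  exact mul_mem (QuotientGroup.eq.mp hWy) hz

lemma nott_step (h2 : (2 : F) ≠ 0) (S : Set (NottinghamGroup F)) (r d l : ℕ) (hd : 1 ≤ d)
    (hdr : 2 * d + 1 ≤ r)
    (hP : ∀ g : NottinghamGroup F, ∃ W, NottWord S l W ∧ W⁻¹ * g ∈ NottinghamCong F r) :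
    ∀ g : NottinghamGroup F, ∃ W, NottWord S (9 * l) W ∧ W⁻¹ * g ∈ NottinghamCong F (r + d) := by
  have happ : ∀ u : PowerSeries F, (X : PowerSeries F) ^ 2 ∣ u → ∃ W : NottinghamGroup F,
      NottWord S l W ∧
      (X : PowerSeries F) ^ (r + 1) ∣ (W : PowerSeries F ≃ₐ[F] PowerSeries F) X - X - u := by
    intro u hu
    obtain ⟨g, hg⟩ := nott_exists u hu
    obtain ⟨W, hW, hWg⟩ := hP g
    refine ⟨W, hW, ?_⟩
    rw [nott_inv_mul_mem, hg, ← dvd_neg] at hWg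
    convert hWg using 1
    ring
  have hcomm : ∀ (a b : ℕ) (u : PowerSeries F), a + b = r → d ≤ a → d ≤ b →
      (X : PowerSeries F) ^ (b + 1) ∣ u → ∃ W : NottinghamGroup F, NottWord S (4 * l) W ∧
        (X : PowerSeries F) ^ (r + d + 1) ∣ (W : PowerSeries F ≃ₐ[F] PowerSeries F) X - X
        - X ^ a * (X * D u - ((a + 1 : ℕ) : PowerSeries F) * u) := by
    intro a b u hab hda hdb hu
    obtain ⟨σ, hσ, hσ'⟩ := happ (X ^ (a + 1)) (pow_dvd_pow X (by omega))
    obtain ⟨τ, hτ, hτ'⟩ := happ u ((pow_dvd_pow X (by omega)).trans hu)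
    exact ⟨(τ * σ)⁻¹ * (σ * τ), ((hτ.mul hσ).inv.mul (hσ.mul hτ)).mono (by omega),
      nott_comm σ τ a b r d u hab hda hdb hσ' hu hτ'⟩
  intro g
  obtain ⟨W, hW, hWg⟩ := hP g
  rw [nott_mem_cong] at hWg
  obtain ⟨b, rfl⟩ : ∃ b, r = d + 1 + b := ⟨r - d - 1, by omega⟩
  obtain ⟨u₁, u₂, hu₁, hu₂, hw⟩ := nott_split h2 d b _ hWg
  obtain ⟨c₁, hc₁, hc₁'⟩ := hcomm d (b + 1) u₁ (by omega) le_rfl (by omega) hu₁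
  obtain ⟨c₂, hc₂, hc₂'⟩ := hcomm (d + 1) b u₂ (by omega) (by omega) (by omega) hu₂
  refine ⟨W * (c₁ * c₂), (hW.mul (hc₁.mul hc₂)).mono (by omega), ?_⟩
  rw [mul_inv_rev, mul_assoc, nott_inv_mul_mem]
  have ho₁ := nott_op_dvd d (b + 1) u₁ hu₁
  have ho₂ := nott_op_dvd (d + 1) b u₂ hu₂
  rw [show d + (b + 1) + 1 = d + 1 + b + 1 by ring] at ho₁
  have hk₁ : (X : PowerSeries F) ^ (d + 1 + b + 1) ∣ c₁.1 X - X := by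
    have := dvd_add ((pow_dvd_pow X (by omega)).trans hc₁') ho₁
    simpa using this
  have hk₂ : (X : PowerSeries F) ^ (d + 1 + b + 1) ∣ c₂.1 X - X := by
    have := dvd_add ((pow_dvd_pow X (by omega)).trans hc₂') ho₂
    simpa using this
  have h3 := nott_first c₁.1 _ hk₁ _ _ hk₂
  have h3' := (pow_dvd_pow X (by omega : d + 1 + b + d + 1 ≤ d + 1 + b + 1 + (d + 1 + b))).trans h3
  have e1 : ((c₁ * c₂ : NottinghamGroup F) : PowerSeries F ≃ₐ[F] PowerSeries F) X =
    c₁.1 (c₂.1 X - X) + c₁.1 X := by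
    rw [← map_add, sub_add_cancel]; rfl
  rw [e1]
  have := (dvd_add (dvd_add hc₁' hc₂') h3')
  rw [← dvd_neg] at this
  convert this using 1
  linear_combination hw

end NottinghamProof

/-- **Theorem 1.7 (diameters of congruence quotients of the Nottingham group).**
Let `p ≥ 3` be a prime, `q` a power of `p` and `F` a finite field with `q`
elements.  Let `N` be the Nottingham group of `F` (the group of `F`-algebra
automorphisms `σ` of `F⟦X⟧` with `σX − X ∈ (X²)`), and `K_n` its congruence
subgroups.  Then each `K_n` (`n ≥ 1`) is a normal subgroup of finite index, and
there are `C₁, C₂ > 0` such that for every `n ≥ 1` and every generating set `S`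
of the finite group `N/K_n`, every element of `N/K_n` is a product of at most
`C₁ · n^{C₂}` elements of `S ∪ S⁻¹ ∪ {1}` (stated in `N`: every element of `N` is
congruent modulo `K_n` to such a product of lifts). -/
theorem nottingham_diameter_bound
    (p q : ℕ) (hp : p.Prime) (hp3 : 3 ≤ p) (hq : ∃ k : ℕ, 0 < k ∧ q = p ^ k)
    (F : Type*) [Field F] [Fintype F] (hF : Fintype.card F = q) :
    (∀ n, 1 ≤ n → (NottinghamCong F n).Normal ∧ (NottinghamCong F n).FiniteIndex) ∧
    ∃ C₁ C₂ : ℝ, 0 < C₁ ∧ 0 < C₂ ∧ ∀ n, 1 ≤ n →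
      ∀ S : Set (NottinghamGroup F),
        Subgroup.closure S ⊔ NottinghamCong F n = ⊤ →
        ∀ g : NottinghamGroup F, ∃ L : List (NottinghamGroup F),
          (∀ y ∈ L, y ∈ S ∪ S⁻¹ ∪ {1}) ∧
          (L.length : ℝ) ≤ C₁ * (n : ℝ) ^ C₂ ∧
          L.prod⁻¹ * g ∈ NottinghamCong F n := by
  obtain ⟨k, hk, rfl⟩ := hq
  haveI : Fact p.Prime := ⟨hp⟩
  haveI : CharP F p := charP_of_card_eq_prime_pow hF
  have h2 : (2 : F) ≠ 0 := by
    have : ((2 : ℕ) : F) ≠ 0 := by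
      rw [Ne, CharP.cast_eq_zero_iff F p]
      intro h
      have := Nat.le_of_dvd (by norm_num) h
      omega
    simpa using this
  refine ⟨fun n _ => ⟨nott_normal n, nott_finiteIndex n⟩, ?_⟩
  have hb : ∀ n : ℕ, ∃ B : ℕ, ∀ S : Set (NottinghamGroup F),
      Subgroup.closure S ⊔ NottinghamCong F n = ⊤ → ∀ g : NottinghamGroup F,
      ∃ W, NottWord S B W ∧ W⁻¹ * g ∈ NottinghamCong F n := by
    intro n
    haveI := nott_normal (F := F) n
    haveI := nott_finite_quot (F := F) n
    exact nott_base (NottinghamCong F n)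
  choose B hB using hb
  let M : ℕ := (Finset.range 10).sup B + 1
  have hM : ∀ n, 1 ≤ n → ∀ S : Set (NottinghamGroup F),
      Subgroup.closure S ⊔ NottinghamCong F n = ⊤ → ∀ g : NottinghamGroup F,
      ∃ W, NottWord S (M * n ^ 8) W ∧ W⁻¹ * g ∈ NottinghamCong F n := by
    intro n
    induction n using Nat.strong_induction_on with
    | _ n ih =>
      intro hn S hS
      by_cases h9 : n < 10
      · intro g
        obtain ⟨W, hW, hWg⟩ := hB n S hS g
        refine ⟨W, hW.mono ?_, hWg⟩
        have h1 : B n ≤ M :=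
          (Finset.le_sup (f := B) (Finset.mem_range.mpr h9)).trans (Nat.le_succ _)
        exact h1.trans (Nat.le_mul_of_pos_right _ (by positivity))
      · have hr := ih (3 * n / 4) (by omega) (by omega) S
          (top_le_iff.mp (hS ▸ sup_le_sup_left (nott_cong_mono (by omega)) _))
        have := nott_step h2 S (3 * n / 4) (n - 3 * n / 4) _ (by omega) (by omega) hr
        rw [show 3 * n / 4 + (n - 3 * n / 4) = n by omega] at this
        intro g
        obtain ⟨W, hW, hWg⟩ := this g
        refine ⟨W, hW.mono ?_, hWg⟩
        have h4 : 4 * (3 * n / 4) ≤ 3 * n := Nat.mul_div_le _ _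
        have h5 := Nat.pow_le_pow_left h4 8
        rw [mul_pow, mul_pow] at h5
        have h6 : 9 * (3 * n / 4) ^ 8 ≤ n ^ 8 := by
          norm_num at h5
          omega
        calc 9 * (M * (3 * n / 4) ^ 8) = M * (9 * (3 * n / 4) ^ 8) := by ring
          _ ≤ M * n ^ 8 := Nat.mul_le_mul_left _ h6
  refine ⟨M, 8, by positivity, by norm_num, ?_⟩
  intro n hn S hS g
  obtain ⟨W, ⟨L, hL1, hL2, rfl⟩, hWg⟩ := hM n hn S hS g
  refine ⟨L, hL1, ?_, hWg⟩
  have : (L.length : ℝ) ≤ ((M * n ^ 8 : ℕ) : ℝ) := Nat.cast_le.mpr hL2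
  push_cast at this
  have h8 : (n : ℝ) ^ (8 : ℝ) = (n : ℝ) ^ (8 : ℕ) := by
    rw [← Real.rpow_natCast]; norm_num
  rw [h8]
  exact this
end

section
/- Let p ≥ 3 be a prime, q a power of p, and F a finite field with q elements. Let N be the group of F-algebra automorphisms σ of F⟦X⟧ with σ(X) − X ∈ (X²), and for k ≥ 1 let K_k = { σ ∈ N : σ(X) − X ∈ (X^{k+1}) }. Let n ≤ m ≤ 2n be natural numbers with n ≥ 1 and p not dividing m − n. Then for every σ ∈ K_{n+m} there exist σ₁, σ₂ ∈ K_n and τ₁, τ₂ ∈ K_m such that [σ₁,τ₁]·[σ₂,τ₂]·σ⁻¹ ∈ K_{2n+m}, where [a,b] = a⁻¹b⁻¹ab. -/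
open PowerSeries

section Aux

variable {F : Type*} [Field F]

lemma nott_exists_equiv (b : PowerSeries F) (hb : (PowerSeries.X : PowerSeries F) ^ 2 ∣ b) :
    ∃ τ : PowerSeries F ≃ₐ[F] PowerSeries F, τ PowerSeries.X = PowerSeries.X + b := by
  rw [PowerSeries.X_pow_dvd_iff] at hb
  have h0 : PowerSeries.constantCoeff (PowerSeries.X + b) = 0 := by
    have := hb 0 (by norm_num)
    rw [PowerSeries.coeff_zero_eq_constantCoeff_apply] at this
    simp [this]
  have h1 : IsUnit (PowerSeries.coeff 1 (PowerSeries.X + b)) := by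
    have := hb 1 (by norm_num)
    simp [this]
  set P : PowerSeries F := PowerSeries.X + b with hP
  have hs : PowerSeries.HasSubst P := PowerSeries.HasSubst.of_constantCoeff_zero' h0
  have hs' : PowerSeries.HasSubst (P.substInvOfIsUnit h1) :=
    PowerSeries.HasSubst.substInvOfIsUnit ..
  refine ⟨AlgEquiv.ofAlgHom (PowerSeries.substAlgHom hs) (PowerSeries.substAlgHom hs') ?_ ?_, ?_⟩
  · ext1 f
    simp only [AlgHom.comp_apply, PowerSeries.coe_substAlgHom, AlgHom.id_apply]
    rw [PowerSeries.subst_comp_subst_apply hs' hs, PowerSeries.subst_substInvOfIsUnit_left _ h0,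
      PowerSeries.X_subst]
  · ext1 f
    simp only [AlgHom.comp_apply, PowerSeries.coe_substAlgHom, AlgHom.id_apply]
    rw [PowerSeries.subst_comp_subst_apply hs hs', PowerSeries.subst_substInvOfIsUnit_right _ h0,
      PowerSeries.X_subst]
  · simp only [AlgEquiv.ofAlgHom_apply, PowerSeries.coe_substAlgHom]
    rw [PowerSeries.subst_X hs]

lemma nott_dvd (σ : PowerSeries F ≃ₐ[F] PowerSeries F) (k : ℕ) {f : PowerSeries F}
    (hf : (PowerSeries.X : PowerSeries F) ^ k ∣ f) :
    (PowerSeries.X : PowerSeries F) ^ k ∣ σ f := by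
  rw [← Ideal.mem_span_singleton] at hf ⊢
  exact algEquiv_mem_span_pow σ k hf

/-- Base congruence. -/
lemma nott_sub_dvd (σ : PowerSeries F ≃ₐ[F] PowerSeries F) (n : ℕ)
    (h : (PowerSeries.X : PowerSeries F) ^ n ∣ σ PowerSeries.X - PowerSeries.X)
    (g : PowerSeries F) : (PowerSeries.X : PowerSeries F) ^ n ∣ σ g - g := by
  have hg := PowerSeries.eq_X_pow_mul_shift_add_trunc n g
  generalize (PowerSeries.mk fun i => PowerSeries.coeff (i + n) g) = u at hg
  generalize PowerSeries.trunc n g = P at hg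
  have hP : ((P : Polynomial F) : PowerSeries F) = Polynomial.aeval (PowerSeries.X) P := by
    rw [Polynomial.aeval_def, PowerSeries.algebraMap_eq, Polynomial.eval₂_C_X_eq_coe]
  have h1 : (PowerSeries.X : PowerSeries F) ^ n ∣ σ (P : PowerSeries F) - (P : PowerSeries F) := by
    refine h.trans ?_
    have h2 : σ (P : PowerSeries F) = Polynomial.aeval (σ PowerSeries.X) P := by
      rw [hP, Polynomial.aeval_algHom_apply]
    rw [h2, hP, ← Polynomial.eval_map_algebraMap, ← Polynomial.eval_map_algebraMap]
    exact Polynomial.sub_dvd_eval_sub _ _ _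
  have h3 : (PowerSeries.X : PowerSeries F) ^ n ∣ σ (PowerSeries.X ^ n * u) :=
    nott_dvd σ n (Dvd.intro _ rfl)
  rw [hg, map_add]
  have : σ (PowerSeries.X ^ n * u) + σ (P : PowerSeries F) - (PowerSeries.X ^ n * u + (P : PowerSeries F))
      = σ (PowerSeries.X ^ n * u) + (σ (P : PowerSeries F) - (P : PowerSeries F)) - PowerSeries.X ^ n * u := by ring
  rw [this]
  exact dvd_sub (dvd_add h3 h1) (Dvd.intro _ rfl)

lemma nott_pow_expand {R : Type*} [CommRing R] (y : R) (k : ℕ) :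
    ∃ w, (1 + y) ^ k = 1 + k * y + y ^ 2 * w := by
  induction k with
  | zero => exact ⟨0, by simp⟩
  | succ k ih =>
    obtain ⟨w, hw⟩ := ih
    exact ⟨w + y * w + k, by rw [pow_succ, hw]; push_cast; ring⟩

lemma nott_X_pow (σ : PowerSeries F ≃ₐ[F] PowerSeries F) (n k : ℕ) (u : PowerSeries F)
    (h : σ PowerSeries.X = PowerSeries.X + PowerSeries.X ^ (n + 1) * u) :
    (PowerSeries.X : PowerSeries F) ^ (2 * n + k) ∣
      σ (PowerSeries.X ^ k) - PowerSeries.X ^ k - (k : PowerSeries F) * PowerSeries.X ^ (n + k) * u := by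
  obtain ⟨w, hw⟩ := nott_pow_expand ((PowerSeries.X : PowerSeries F) ^ n * u) k
  have : σ PowerSeries.X = PowerSeries.X * (1 + PowerSeries.X ^ n * u) := by rw [h]; ring
  rw [map_pow, this, mul_pow, hw]
  exact ⟨u ^ 2 * w, by ring⟩

lemma nott_gain (σ : PowerSeries F ≃ₐ[F] PowerSeries F) (n k : ℕ)
    (h : (PowerSeries.X : PowerSeries F) ^ (n + 1) ∣ σ PowerSeries.X - PowerSeries.X)
    {f : PowerSeries F} (hf : (PowerSeries.X : PowerSeries F) ^ k ∣ f) :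
    (PowerSeries.X : PowerSeries F) ^ (n + k) ∣ σ f - f := by
  obtain ⟨u, hu⟩ := h
  obtain ⟨g, rfl⟩ := hf
  have hg := nott_sub_dvd σ (n + 1) ⟨u, hu⟩ g
  obtain ⟨v, hv⟩ := nott_X_pow σ n k u (by rw [← hu]; ring)
  have h1 : (PowerSeries.X : PowerSeries F) ^ (n + k) ∣
      σ (PowerSeries.X ^ k) - PowerSeries.X ^ k := by
    refine ⟨(k : PowerSeries F) * u + PowerSeries.X ^ n * v, ?_⟩
    linear_combination hv
  have h2 : (PowerSeries.X : PowerSeries F) ^ k ∣ σ (PowerSeries.X ^ k) := nott_dvd σ k dvd_rfl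
  have h3 : σ (PowerSeries.X ^ k * g) - PowerSeries.X ^ k * g =
      (σ g - g) * σ (PowerSeries.X ^ k) + (σ (PowerSeries.X ^ k) - PowerSeries.X ^ k) * g := by
    rw [map_mul]; ring
  rw [h3]
  refine dvd_add ?_ (h1.mul_right g)
  rw [pow_add]
  exact mul_dvd_mul ((pow_dvd_pow _ (Nat.le_succ n)).trans hg) h2

/-- The commutator modulo `X^(2n+m+1)`. -/
lemma nott_comm_s14 (n m r : ℕ) (hnm : n ≤ m) (hr : n ≤ r)
    (s : Finset ℕ) (d : ℕ → F) (e : ℕ → ℕ) (he : ∀ i ∈ s, d i = 0 ∨ m + 1 ≤ e i)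
    (σ τ : PowerSeries F ≃ₐ[F] PowerSeries F)
    (hσ : σ PowerSeries.X = PowerSeries.X + PowerSeries.X ^ (r + 1))
    (hτ : τ PowerSeries.X = PowerSeries.X + ∑ i ∈ s, d i • PowerSeries.X ^ (e i)) :
    (PowerSeries.X : PowerSeries F) ^ (2 * n + m + 1) ∣
      (σ⁻¹ * τ⁻¹ * σ * τ) PowerSeries.X - PowerSeries.X -
        ∑ i ∈ s, (d i * ((e i : F) - r - 1)) • (PowerSeries.X : PowerSeries F) ^ (r + e i) := by
  set b : PowerSeries F := ∑ i ∈ s, d i • PowerSeries.X ^ (e i) with hb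
  set B : PowerSeries F :=
    ∑ i ∈ s, (d i * ((e i : F) - r - 1)) • (PowerSeries.X : PowerSeries F) ^ (r + e i) with hB
  have hbd : (PowerSeries.X : PowerSeries F) ^ (m + 1) ∣ b := by
    refine Finset.dvd_sum fun i hi => ?_
    rcases he i hi with h | h
    · simp [h]
    · rw [PowerSeries.smul_eq_C_mul]
      exact (pow_dvd_pow _ h).mul_left _
  have hBd : (PowerSeries.X : PowerSeries F) ^ (n + m + 1) ∣ B := by
    refine Finset.dvd_sum fun i hi => ?_
    rcases he i hi with h | h
    · simp [h]
    · rw [PowerSeries.smul_eq_C_mul]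
      exact (pow_dvd_pow _ (by omega)).mul_left _
  -- expansion of `σ b`
  have hA : (PowerSeries.X : PowerSeries F) ^ (2 * n + m + 1) ∣
      σ b - b - ∑ i ∈ s, (d i * (e i : F)) • (PowerSeries.X : PowerSeries F) ^ (r + e i) := by
    rw [hb, map_sum, ← Finset.sum_sub_distrib, ← Finset.sum_sub_distrib]
    refine Finset.dvd_sum fun i hi => ?_
    rcases he i hi with h | h
    · simp [h]
    · have h1 := nott_X_pow σ r (e i) 1 (by rw [hσ, mul_one])
      have h2 : σ (d i • PowerSeries.X ^ (e i)) - d i • PowerSeries.X ^ (e i)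
          - (d i * (e i : F)) • (PowerSeries.X : PowerSeries F) ^ (r + e i) =
          PowerSeries.C (d i) * (σ (PowerSeries.X ^ (e i)) - PowerSeries.X ^ (e i)
            - (e i : PowerSeries F) * PowerSeries.X ^ (r + e i) * 1) := by
        rw [map_smul]
        simp only [PowerSeries.smul_eq_C_mul, map_mul, map_natCast]
        ring
      rw [h2]
      exact ((pow_dvd_pow _ (by omega)).trans h1).mul_left _
  obtain ⟨v, hv⟩ := hbd
  have hC : (PowerSeries.X : PowerSeries F) ^ (2 * n + m + 1) ∣
      τ (PowerSeries.X ^ (r + 1)) - PowerSeries.X ^ (r + 1)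
        - ((r : PowerSeries F) + 1) * PowerSeries.X ^ r * b := by
    have h1 := nott_X_pow τ m (r + 1) v (by rw [hτ, hv])
    refine (pow_dvd_pow _ (show 2 * n + m + 1 ≤ 2 * m + (r + 1) by omega)).trans ?_
    convert h1 using 2
    rw [hv]; push_cast; ring
  have hBsum : B = ∑ i ∈ s, (d i * (e i : F)) • (PowerSeries.X : PowerSeries F) ^ (r + e i)
      - ((r : PowerSeries F) + 1) * PowerSeries.X ^ r * b := by
    rw [hB, hb, Finset.mul_sum, ← Finset.sum_sub_distrib]
    refine Finset.sum_congr rfl fun i _ => ?_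
    simp only [PowerSeries.smul_eq_C_mul, map_mul, map_sub, map_natCast, map_one]
    ring
  set δ : PowerSeries F := σ (τ PowerSeries.X) - τ (σ PowerSeries.X) with hδ
  have hδB : (PowerSeries.X : PowerSeries F) ^ (2 * n + m + 1) ∣ δ - B := by
    have : δ - B = (σ b - b - ∑ i ∈ s, (d i * (e i : F)) • (PowerSeries.X : PowerSeries F) ^ (r + e i))
      - (τ (PowerSeries.X ^ (r + 1)) - PowerSeries.X ^ (r + 1)
        - ((r : PowerSeries F) + 1) * PowerSeries.X ^ r * b) := by
      rw [hδ, hBsum, hσ, hτ, map_add, map_add, hσ, hτ]; ring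
    rw [this]
    exact dvd_sub hA hC
  have hδd : (PowerSeries.X : PowerSeries F) ^ (n + m + 1) ∣ δ := by
    have := dvd_add ((pow_dvd_pow _ (show n + m + 1 ≤ 2 * n + m + 1 by omega)).trans hδB) hBd
    simpa using this
  set π : PowerSeries F ≃ₐ[F] PowerSeries F := σ⁻¹ * τ⁻¹ with hπ
  have hπX : (PowerSeries.X : PowerSeries F) ^ (n + 1) ∣ π PowerSeries.X - PowerSeries.X := by
    have h1 : (PowerSeries.X : PowerSeries F) ^ (n + 1) ∣ τ (σ PowerSeries.X) - PowerSeries.X := by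
      rw [hσ, map_add, hτ, hv]
      have := (pow_dvd_pow (PowerSeries.X : PowerSeries F)
        (show n + 1 ≤ r + 1 by omega)).trans (nott_dvd τ (r + 1) dvd_rfl)
      have h2 := (pow_dvd_pow (PowerSeries.X : PowerSeries F)
        (show n + 1 ≤ m + 1 by omega)).mul_right v
      convert dvd_add this h2 using 1
      ring
    have h2 := (nott_dvd π _ h1).neg_right
    have h3 : π (τ (σ PowerSeries.X)) = PowerSeries.X := by
      simp [hπ, AlgEquiv.mul_apply, AlgEquiv.aut_inv]
    rw [map_sub, h3] at h2
    simpa using h2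
  have hc : (π * σ * τ) PowerSeries.X - PowerSeries.X = π δ := by
    have h3 : π (τ (σ PowerSeries.X)) = PowerSeries.X := by
      simp [hπ, AlgEquiv.mul_apply, AlgEquiv.aut_inv]
    rw [hδ, map_sub, h3]; rfl
  rw [hc]
  have h5 := nott_gain π n _ hπX hδd
  have h6 : π δ - B = (π δ - δ) + (δ - B) := by ring
  rw [h6]
  refine dvd_add ?_ hδB
  convert h5 using 2
  ring

end Aux

/-- **Section 5 (commutator width in congruence quotients of the Nottingham
group).**  Let `p ≥ 3` be a prime, `q` a power of `p`, `F` a finite field with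
`q` elements, and let `N` be the Nottingham group of `F` with congruence
subgroups `K_k`.  Let `1 ≤ n ≤ m ≤ 2n` with `p ∤ (m − n)`.  Then every
`σ ∈ K_{n+m}` satisfies `[σ₁,τ₁]·[σ₂,τ₂]·σ⁻¹ ∈ K_{2n+m}` for suitable
`σ₁, σ₂ ∈ K_n` and `τ₁, τ₂ ∈ K_m`, where `[a,b] = a⁻¹b⁻¹ab`. -/
theorem nottingham_commutator_width
    (p q : ℕ) (hp : p.Prime) (hp3 : 3 ≤ p) (hq : ∃ k : ℕ, 0 < k ∧ q = p ^ k)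
    (F : Type*) [Field F] [Fintype F] (hF : Fintype.card F = q)
    (n m : ℕ) (hn : 1 ≤ n) (hnm : n ≤ m) (hm2n : m ≤ 2 * n)
    (hpdvd : ¬ p ∣ (m - n)) :
    ∀ σ : NottinghamGroup F, σ ∈ NottinghamCong F (n + m) →
      ∃ σ₁ σ₂ τ₁ τ₂ : NottinghamGroup F,
        σ₁ ∈ NottinghamCong F n ∧ σ₂ ∈ NottinghamCong F n ∧
        τ₁ ∈ NottinghamCong F m ∧ τ₂ ∈ NottinghamCong F m ∧
        (σ₁⁻¹ * τ₁⁻¹ * σ₁ * τ₁) * (σ₂⁻¹ * τ₂⁻¹ * σ₂ * τ₂) * σ⁻¹ ∈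
          NottinghamCong F (2 * n + m) := by
  classical
  intro σ hσ
  obtain ⟨k, hk, rfl⟩ := hq
  haveI : Fact p.Prime := ⟨hp⟩
  haveI : CharP F p := charP_of_card_eq_prime_pow hF
  have hmn : (m : F) ≠ n := by
    intro h
    apply hpdvd
    rw [← CharP.cast_eq_zero_iff F p, Nat.cast_sub hnm, h, sub_self]
  have h2 : (2 : F) ≠ 0 := by
    intro h
    have h' : ((2 : ℕ) : F) = 0 := by exact_mod_cast h
    rw [CharP.cast_eq_zero_iff F p] at h'
    have := Nat.le_of_dvd (by norm_num) h'
    omega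
  have mem (k : ℕ) (ρ : NottinghamGroup F) : ρ ∈ NottinghamCong F k ↔
      (PowerSeries.X : PowerSeries F) ^ (k + 1) ∣
        (ρ : PowerSeries F ≃ₐ[F] PowerSeries F) PowerSeries.X - PowerSeries.X :=
    Ideal.mem_span_singleton
  have memN (ρ : PowerSeries F ≃ₐ[F] PowerSeries F) (h : (PowerSeries.X : PowerSeries F) ^ 2 ∣
        ρ PowerSeries.X - PowerSeries.X) : ρ ∈ NottinghamGroup F :=
    Ideal.mem_span_singleton.2 h
  set s : PowerSeries F :=
    (σ : PowerSeries F ≃ₐ[F] PowerSeries F) PowerSeries.X - PowerSeries.X with hs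
  have hsd : (PowerSeries.X : PowerSeries F) ^ (n + m + 1) ∣ s := (mem _ _).1 hσ
  let t : ℕ → F := fun i => PowerSeries.coeff (n + i + 1) s
  let c : ℕ → F := fun i => if (i : F) = n then 0 else t i / ((i : F) - n)
  let d : ℕ → F := fun i => if (i : F) = n then t i / (-2) else 0
  have hcd (i : ℕ) : c i * (((i + 1 : ℕ) : F) - n - 1) + d i * ((i : F) - (n + 1 : ℕ) - 1) = t i := by
    by_cases h : (i : F) = n
    · simp only [c, d, h, if_true]
      push_cast
      field_simp
      ring
    · have h' : (i : F) - n ≠ 0 := sub_ne_zero.2 h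
      simp only [c, d, h, if_false]
      push_cast
      field_simp
      ring
  set S := Finset.Ico m (m + n) with hS
  have hb1 : (PowerSeries.X : PowerSeries F) ^ (m + 1) ∣
      ∑ i ∈ S, c i • (PowerSeries.X : PowerSeries F) ^ (i + 1) := by
    refine Finset.dvd_sum fun i hi => ?_
    rw [hS, Finset.mem_Ico] at hi
    rw [PowerSeries.smul_eq_C_mul]
    exact (pow_dvd_pow _ (by omega)).mul_left _
  have hd (i : ℕ) (hi : i ∈ S) : d i = 0 ∨ m + 1 ≤ i := by
    rw [hS, Finset.mem_Ico] at hi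
    by_cases h : i = m
    · left
      simp only [d, h, hmn, if_false]
    · right; omega
  have hb2 : (PowerSeries.X : PowerSeries F) ^ (m + 1) ∣
      ∑ i ∈ S, d i • (PowerSeries.X : PowerSeries F) ^ i := by
    refine Finset.dvd_sum fun i hi => ?_
    rcases hd i hi with h | h
    · simp [h]
    · rw [PowerSeries.smul_eq_C_mul]
      exact (pow_dvd_pow _ h).mul_left _
  obtain ⟨σ₁, hσ₁⟩ := nott_exists_equiv ((PowerSeries.X : PowerSeries F) ^ (n + 1))
    (pow_dvd_pow _ (by omega))
  obtain ⟨σ₂, hσ₂⟩ := nott_exists_equiv ((PowerSeries.X : PowerSeries F) ^ (n + 1 + 1))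
    (pow_dvd_pow _ (by omega))
  obtain ⟨τ₁, hτ₁⟩ := nott_exists_equiv _ ((pow_dvd_pow _ (by omega)).trans hb1)
  obtain ⟨τ₂, hτ₂⟩ := nott_exists_equiv _ ((pow_dvd_pow _ (by omega)).trans hb2)
  have dσ₁ : (PowerSeries.X : PowerSeries F) ^ (n + 1) ∣ σ₁ PowerSeries.X - PowerSeries.X := by
    rw [hσ₁, add_sub_cancel_left]
  have dσ₂ : (PowerSeries.X : PowerSeries F) ^ (n + 1) ∣ σ₂ PowerSeries.X - PowerSeries.X := by
    rw [hσ₂, add_sub_cancel_left]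
    exact pow_dvd_pow _ (by omega)
  have dτ₁ : (PowerSeries.X : PowerSeries F) ^ (m + 1) ∣ τ₁ PowerSeries.X - PowerSeries.X := by
    rwa [hτ₁, add_sub_cancel_left]
  have dτ₂ : (PowerSeries.X : PowerSeries F) ^ (m + 1) ∣ τ₂ PowerSeries.X - PowerSeries.X := by
    rwa [hτ₂, add_sub_cancel_left]
  have e1 := nott_comm_s14 n m n hnm le_rfl S c (fun i => i + 1)
    (fun i hi => Or.inr (by rw [hS, Finset.mem_Ico] at hi; omega)) σ₁ τ₁ hσ₁ hτ₁
  have e2 := nott_comm_s14 n m (n + 1) hnm (by omega) S d (fun i => i) hd σ₂ τ₂ hσ₂ hτ₂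
  let σ₁' : NottinghamGroup F := ⟨σ₁, memN _ ((pow_dvd_pow _ (by omega)).trans dσ₁)⟩
  let σ₂' : NottinghamGroup F := ⟨σ₂, memN _ ((pow_dvd_pow _ (by omega)).trans dσ₂)⟩
  let τ₁' : NottinghamGroup F := ⟨τ₁, memN _ ((pow_dvd_pow _ (by omega)).trans dτ₁)⟩
  let τ₂' : NottinghamGroup F := ⟨τ₂, memN _ ((pow_dvd_pow _ (by omega)).trans dτ₂)⟩
  have mσ₁ : σ₁' ∈ NottinghamCong F n := (mem _ _).2 dσ₁
  have mσ₂ : σ₂' ∈ NottinghamCong F n := (mem _ _).2 dσ₂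
  have mτ₁ : τ₁' ∈ NottinghamCong F m := (mem _ _).2 dτ₁
  have mτ₂ : τ₂' ∈ NottinghamCong F m := (mem _ _).2 dτ₂
  refine ⟨σ₁', σ₂', τ₁', τ₂', mσ₁, mσ₂, mτ₁, mτ₂, ?_⟩
  have mono {a b : ℕ} (hab : a ≤ b) {ρ : NottinghamGroup F} (h : ρ ∈ NottinghamCong F b) :
      ρ ∈ NottinghamCong F a :=
    (mem _ _).2 ((pow_dvd_pow _ (by omega)).trans ((mem _ _).1 h))
  have nτ₁ := mono hnm mτ₁
  have nτ₂ := mono hnm mτ₂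
  have nσ : σ ∈ NottinghamCong F n := mono (by omega) hσ
  have mc₁ : σ₁'⁻¹ * τ₁'⁻¹ * σ₁' * τ₁' ∈ NottinghamCong F n :=
    mul_mem (mul_mem (mul_mem (inv_mem mσ₁) (inv_mem nτ₁)) mσ₁) nτ₁
  have mc₂ : σ₂'⁻¹ * τ₂'⁻¹ * σ₂' * τ₂' ∈ NottinghamCong F n :=
    mul_mem (mul_mem (mul_mem (inv_mem mσ₂) (inv_mem nτ₂)) mσ₂) nτ₂
  have mρ := mul_mem (mul_mem mc₁ mc₂) (inv_mem nσ)
  have f1 : (PowerSeries.X : PowerSeries F) ^ (2 * n + m + 1) ∣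
      ((σ₁'⁻¹ * τ₁'⁻¹ * σ₁' * τ₁' : NottinghamGroup F) : PowerSeries F ≃ₐ[F] PowerSeries F)
        PowerSeries.X - PowerSeries.X -
        ∑ i ∈ S, (c i * (((i + 1 : ℕ) : F) - n - 1)) •
          (PowerSeries.X : PowerSeries F) ^ (n + (i + 1)) := e1
  have f2 : (PowerSeries.X : PowerSeries F) ^ (2 * n + m + 1) ∣
      ((σ₂'⁻¹ * τ₂'⁻¹ * σ₂' * τ₂' : NottinghamGroup F) : PowerSeries F ≃ₐ[F] PowerSeries F)
        PowerSeries.X - PowerSeries.X -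
        ∑ i ∈ S, (d i * ((i : F) - (n + 1 : ℕ) - 1)) •
          (PowerSeries.X : PowerSeries F) ^ (n + 1 + i) := e2
  generalize σ₁'⁻¹ * τ₁'⁻¹ * σ₁' * τ₁' = c₁ at *
  generalize σ₂'⁻¹ * τ₂'⁻¹ * σ₂' * τ₂' = c₂ at *
  have hρ : ((c₁ * c₂ * σ⁻¹ : NottinghamGroup F) : PowerSeries F ≃ₐ[F] PowerSeries F)
      ((σ : PowerSeries F ≃ₐ[F] PowerSeries F) PowerSeries.X) =
      (c₁ : PowerSeries F ≃ₐ[F] PowerSeries F)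
        ((c₂ : PowerSeries F ≃ₐ[F] PowerSeries F) PowerSeries.X) := by
    rw [← AlgEquiv.mul_apply, ← AlgEquiv.mul_apply, ← Subgroup.coe_mul, ← Subgroup.coe_mul,
      inv_mul_cancel_right]
  rw [mem] at mρ mc₁ ⊢
  generalize ((c₁ * c₂ * σ⁻¹ : NottinghamGroup F) : PowerSeries F ≃ₐ[F] PowerSeries F) = ρ at *
  have hsX : (σ : PowerSeries F ≃ₐ[F] PowerSeries F) PowerSeries.X = PowerSeries.X + s := by
    rw [hs]; ring
  rw [hsX, map_add] at hρ
  set B1 := ∑ i ∈ S, (c i * (((i + 1 : ℕ) : F) - n - 1)) •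
          (PowerSeries.X : PowerSeries F) ^ (n + (i + 1)) with hB1
  set B2 := ∑ i ∈ S, (d i * ((i : F) - (n + 1 : ℕ) - 1)) •
          (PowerSeries.X : PowerSeries F) ^ (n + 1 + i) with hB2
  have hB : B1 + B2 = ∑ i ∈ S, t i • (PowerSeries.X : PowerSeries F) ^ (n + i + 1) := by
    rw [hB1, hB2, ← Finset.sum_add_distrib]
    refine Finset.sum_congr rfl fun i _ => ?_
    rw [← hcd i, add_smul, show n + (i + 1) = n + i + 1 by ring, show n + 1 + i = n + i + 1 by ring]
  have hsB : (PowerSeries.X : PowerSeries F) ^ (2 * n + m + 1) ∣ B1 + B2 - s := by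
    rw [hB, PowerSeries.X_pow_dvd_iff]
    intro l hl
    rw [map_sub, map_sum]
    simp only [PowerSeries.coeff_smul, PowerSeries.coeff_X_pow, smul_eq_mul]
    by_cases hl' : l < n + m + 1
    · rw [PowerSeries.X_pow_dvd_iff.1 hsd l hl', sub_zero]
      refine Finset.sum_eq_zero fun i hi => ?_
      rw [hS, Finset.mem_Ico] at hi
      rw [if_neg (by omega), mul_zero]
    · rw [Finset.sum_eq_single (l - n - 1)]
      · have : n + (l - n - 1) + 1 = l := by omega
        simp only [t, this, if_true, mul_one, sub_self]
      · intro i hi hne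
        rw [if_neg (by omega), mul_zero]
      · intro h
        rw [hS, Finset.mem_Ico] at h
        omega
  set γ₂ := (c₂ : PowerSeries F ≃ₐ[F] PowerSeries F) PowerSeries.X - PowerSeries.X with hγ₂
  have hB2d : (PowerSeries.X : PowerSeries F) ^ (n + m + 1) ∣ B2 := by
    refine Finset.dvd_sum fun i hi => ?_
    rw [hS, Finset.mem_Ico] at hi
    rw [PowerSeries.smul_eq_C_mul]
    exact (pow_dvd_pow _ (by omega)).mul_left _
  have hγd : (PowerSeries.X : PowerSeries F) ^ (n + m + 1) ∣ γ₂ := by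
    have := dvd_add ((pow_dvd_pow _ (show n + m + 1 ≤ 2 * n + m + 1 by omega)).trans f2) hB2d
    simpa using this
  have g1 := nott_gain _ n _ mc₁ hγd
  have g2 := nott_gain _ n _ mρ hsd
  rw [show n + (n + m + 1) = 2 * n + m + 1 by ring] at g1 g2
  have hc2X : (c₂ : PowerSeries F ≃ₐ[F] PowerSeries F) PowerSeries.X = PowerSeries.X + γ₂ := by
    rw [hγ₂]; ring
  rw [hc2X, map_add] at hρ
  have key := dvd_add (dvd_sub (dvd_add (dvd_add f1 f2) g1) g2) hsB
  convert key using 1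
  linear_combination hρ
end
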